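/- Let X ⊂ ℙ^r be an integral and non-degenerate projective variety of dimension n over an algebraically closed field of characteristic 0, and let k be a positive integer. Assume that X is not uniruled by lines and that dim σ_{k+n−1}(X) = (k+n−1)(n+1)−1 < r. Then X is not weakly j-defective, and hence is j-identifiable, for every j ≤ k. -/

import Mathlib

noncomputable section

namespace ContactLoci

variable {K : Type*} [Field K] {ι : Type*} [Fintype ι]

/-- Projective space over `K` with homogeneous coordinates indexed by `ι`. -/
abbrev PP (K : Type*) [Field K] (ι : Type*) : Type _ :=
  Projectivization K (ι → K)

/-- The affine cone over a set of projective points. -/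
def coneOf (S : Set (PP K ι)) : Set (ι → K) :=
  ⋃ x ∈ S, (x.submodule : Set (ι → K))

/-- The linear span, in the underlying vector space, of the cone over `S`. -/
def vspan (S : Set (PP K ι)) : Submodule K (ι → K) :=
  Submodule.span K (coneOf S)

/-- The projective linear span of a set of projective points. -/
def projSpan (S : Set (PP K ι)) : Set (PP K ι) :=
  {x | x.submodule ≤ vspan S}

/-- The projective dimension of the linear span of `S` (`-1` for `S = ∅`). -/
def projDim (S : Set (PP K ι)) : ℤ :=
  (Module.finrank K (vspan S) : ℤ) - 1

/-- A set of projective points is non-degenerate if its linear span is everything. -/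
def Nondegenerate (S : Set (PP K ι)) : Prop :=
  vspan S = ⊤

/-- The common zero locus in projective space of a set of polynomials. -/
def zeroLocus (S : Set (MvPolynomial ι K)) : Set (PP K ι) :=
  {x | ∀ f ∈ S, ∀ v ∈ x.submodule, MvPolynomial.eval v f = 0}

/-- Zariski-closed subsets of projective space: common zero loci of sets of
homogeneous polynomials. -/
def IsZClosed (X : Set (PP K ι)) : Prop :=
  ∃ S : Set (MvPolynomial ι K), (∀ f ∈ S, ∃ d : ℕ, f.IsHomogeneous d) ∧ X = zeroLocus S

/-- Zariski closure. -/
def zclosure (S : Set (PP K ι)) : Set (PP K ι) :=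
  ⋂₀ {Y | IsZClosed Y ∧ S ⊆ Y}

/-- Irreducibility with respect to the Zariski topology. -/
def IsZIrreducible (S : Set (PP K ι)) : Prop :=
  S.Nonempty ∧ ∀ Y Z : Set (PP K ι), IsZClosed Y → IsZClosed Z → S ⊆ Y ∪ Z → S ⊆ Y ∨ S ⊆ Z

/-- An integral projective variety: a Zariski-closed irreducible subset. -/
def IsIntegralVariety (X : Set (PP K ι)) : Prop :=
  IsZClosed X ∧ IsZIrreducible X

/-- `C` is an irreducible component of `S`: a maximal irreducible subset of `S`. -/
def IsZIrredComponent (S C : Set (PP K ι)) : Prop :=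
  IsZIrreducible C ∧ C ⊆ S ∧ ∀ D : Set (PP K ι), IsZIrreducible D → D ⊆ S → C ⊆ D → C = D

/-- The dimension of a set: the Krull dimension of the poset of irreducible
Zariski-closed subsets of its Zariski closure (`⊥` for the empty set). -/
def zdim (S : Set (PP K ι)) : WithBot ℕ∞ :=
  Order.krullDim ({Y : Set (PP K ι) // IsZClosed Y ∧ IsZIrreducible Y ∧ Y ⊆ zclosure S})

/-- A property holds at a general point of `X`: it holds away from a proper
Zariski-closed subset. -/
def HoldsGenerically (X : Set (PP K ι)) (P : PP K ι → Prop) : Prop :=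
  ∃ Y : Set (PP K ι), IsZClosed Y ∧ ¬X ⊆ Y ∧ ∀ x ∈ X \ Y, P x

/-- Zero locus of multihomogeneous polynomials in a self-product of projective space. -/
def multiZeroLocus {m : ℕ} (S : Set (MvPolynomial (Fin m × ι) K)) :
    Set (Fin m → PP K ι) :=
  {u | ∀ f ∈ S, ∀ v : Fin m → ι → K, (∀ i, v i ∈ (u i).submodule) →
    MvPolynomial.eval (fun p => v p.1 p.2) f = 0}

/-- Zariski-closed subsets of the `m`-fold self-product of projective space. -/
def IsMultiZClosed {m : ℕ} (T : Set (Fin m → PP K ι)) : Prop :=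
  ∃ S : Set (MvPolynomial (Fin m × ι) K),
    (∀ f ∈ S, ∀ i : Fin m, ∃ d : ℕ,
      MvPolynomial.IsWeightedHomogeneous (fun p : Fin m × ι => if p.1 = i then 1 else 0) f d) ∧
    T = multiZeroLocus S

/-- A property holds for a general `m`-tuple of points of `X`. -/
def HoldsForGeneralTuples (X : Set (PP K ι)) (m : ℕ) (P : (Fin m → PP K ι) → Prop) : Prop :=
  ∃ T : Set (Fin m → PP K ι), IsMultiZClosed T ∧
    (∃ u : Fin m → PP K ι, (∀ i, u i ∈ X) ∧ u ∉ T) ∧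
    ∀ u : Fin m → PP K ι, (∀ i, u i ∈ X) → u ∉ T → P u

/-- The homogeneous vanishing ideal of `X` (as a set of homogeneous polynomials). -/
def homogVanishingIdeal (X : Set (PP K ι)) : Set (MvPolynomial ι K) :=
  {f | (∃ d : ℕ, f.IsHomogeneous d) ∧ ∀ x ∈ X, ∀ v ∈ x.submodule, MvPolynomial.eval v f = 0}

/-- The embedded (projective) tangent space of `X` at `x`. -/
def embTangentSpace (X : Set (PP K ι)) (x : PP K ι) : Set (PP K ι) :=
  {y | ∀ f ∈ homogVanishingIdeal X,
    ∑ i : ι, y.rep i * MvPolynomial.eval x.rep (MvPolynomial.pderiv i f) = 0}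

/-- Smooth points of `X`. -/
def IsSmoothPoint (X : Set (PP K ι)) (x : PP K ι) : Prop :=
  x ∈ X ∧ zdim (embTangentSpace X x) = zdim X

/-- `M_A`: the linear span of the tangent spaces of `X` at the points of `A`. -/
def tangentSpan (X A : Set (PP K ι)) : Set (PP K ι) :=
  projSpan (⋃ a ∈ A, embTangentSpace X a)

/-- The locus of smooth points of `X` at which `M_A` is tangent to `X`. -/
def tangencyLocus (X A : Set (PP K ι)) : Set (PP K ι) :=
  {x | IsSmoothPoint X x ∧ embTangentSpace X x ⊆ tangentSpan X A}

/-- The tangential contact locus of `X` at `A`: the closure of the union of the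
irreducible components of the tangency locus meeting `A`. -/
def contactLocus (X A : Set (PP K ι)) : Set (PP K ι) :=
  zclosure (⋃ C ∈ {C : Set (PP K ι) |
    IsZIrredComponent (tangencyLocus X A) C ∧ (C ∩ A).Nonempty}, C)

/-- `X` is weakly `k`-defective: the tangential contact locus at `k` general points
has positive dimension. -/
def WeaklyDefective (X : Set (PP K ι)) (k : ℕ) : Prop :=
  HoldsForGeneralTuples X k fun u => 0 < zdim (contactLocus X (Set.range u))

/-- The `k`-th secant variety of `X`. -/
def secant (k : ℕ) (X : Set (PP K ι)) : Set (PP K ι) :=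
  zclosure {q | ∃ S : Finset (PP K ι), ↑S ⊆ X ∧ S.card = k ∧ q ∈ projSpan (S : Set (PP K ι))}

/-- The `X`-rank of a point. -/
def xrank (X : Set (PP K ι)) (q : PP K ι) : ℕ :=
  sInf {k | ∃ S : Finset (PP K ι), ↑S ⊆ X ∧ S.card = k ∧ q ∈ projSpan (S : Set (PP K ι))}

/-- `𝒮(q,X)`: the set of minimal `X`-decompositions of `q`. -/
def decompositions (X : Set (PP K ι)) (q : PP K ι) : Set (Finset (PP K ι)) :=
  {S | ↑S ⊆ X ∧ S.card = xrank X q ∧ q ∈ projSpan (S : Set (PP K ι))}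

/-- `X` is `k`-identifiable: a general point of `σ_k(X)` has a unique minimal
decomposition. -/
def Identifiable (X : Set (PP K ι)) (k : ℕ) : Prop :=
  HoldsGenerically (secant k X) fun q => ∃! S : Finset (PP K ι), S ∈ decompositions X q

/-- `α` is the `k`-th secant degree of `X`. -/
def HasSecantDegree (X : Set (PP K ι)) (k α : ℕ) : Prop :=
  HoldsGenerically (secant k X) fun q => (decompositions X q).ncard = α

/-- Projective linear subspaces. -/
def IsProjLinear (L : Set (PP K ι)) : Prop :=
  L = projSpan L

/-- Lines in projective space. -/
def IsLine (L : Set (PP K ι)) : Prop :=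
  IsProjLinear L ∧ Module.finrank K (vspan L) = 2

/-- `X` is uniruled by lines: through a general point of `X` there is a line
contained in `X`. -/
def UniruledByLines (X : Set (PP K ι)) : Prop :=
  HoldsGenerically X fun x => ∃ L : Set (PP K ι), IsLine L ∧ x ∈ L ∧ L ⊆ X

/-- The join of two sets in projective space. -/
def join (A B : Set (PP K ι)) : Set (PP K ι) :=
  zclosure (⋃ a ∈ A, ⋃ b ∈ B, projSpan {a, b})

/-- The linear space `M` is tangent to `X` along `W`. -/
def TangentAlong (M X W : Set (PP K ι)) : Prop :=
  ∀ x ∈ W, IsSmoothPoint X x → embTangentSpace X x ⊆ M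

/-- `S` has exactly `m` irreducible components, all of them projective linear
subspaces, and these components are linearly independent. -/
def ComponentsAreIndepLinear (S : Set (PP K ι)) (m : ℕ) : Prop :=
  ∃ C : Fin m → Set (PP K ι), Function.Injective C ∧
    (∀ D : Set (PP K ι), IsZIrredComponent S D ↔ ∃ i, D = C i) ∧
    (∀ i, IsProjLinear (C i)) ∧
    Module.finrank K (vspan S) = ∑ i, Module.finrank K (vspan (C i))


/-- The Segre variety: the image of `ℙ^{n 1} × ⋯ × ℙ^{n s}` under the Segre
embedding, given by the complete linear system `|O(1,…,1)|`. -/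
def segreVariety (K : Type*) [Field K] (s : ℕ) (n : Fin s → ℕ) :
    Set (PP K (∀ i : Fin s, Fin (n i + 1))) :=
  {x | ∃ u : ∀ i : Fin s, Fin (n i + 1) → K,
    x.submodule = Submodule.span K
      ({fun t => ∏ i, u i (t i)} : Set ((∀ i : Fin s, Fin (n i + 1)) → K))}

/-- The projection of `L ⊆ Segre` to the `i`-th factor is a single point, i.e. `L`
lies in a single fiber of the `i`-th projection. -/
def SegreFactorIsPoint (K : Type*) [Field K] (s : ℕ) (n : Fin s → ℕ) (i : Fin s)
    (L : Set (PP K (∀ j : Fin s, Fin (n j + 1)))) : Prop :=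
  ∃ w : Fin (n i + 1) → K, w ≠ 0 ∧ ∀ x ∈ L,
    ∃ u : ∀ j : Fin s, Fin (n j + 1) → K,
      x.submodule = Submodule.span K
        ({fun t => ∏ j, u j (t j)} : Set ((∀ j : Fin s, Fin (n j + 1)) → K)) ∧
      u i ∈ Submodule.span K ({w} : Set (Fin (n i + 1) → K))

/-- Index type for the Segre–Veronese embedding of multidegree `d`:
multi-indices of degree `d i` in the homogeneous variables of the `i`-th factor. -/
abbrev svIndex (s : ℕ) (n d : Fin s → ℕ) : Type :=
  ∀ i : Fin s, {w : Fin (n i + 1) → Fin (d i + 1) // ∑ j, (w j : ℕ) = d i}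

/-- The Segre–Veronese variety of multidegree `d`: the image of
`ℙ^{n 1} × ⋯ × ℙ^{n s}` under the embedding by `|L_1^{d 1} ⊗ ⋯ ⊗ L_s^{d s}|`. -/
def segreVeroneseVariety (K : Type*) [Field K] (s : ℕ) (n d : Fin s → ℕ) :
    Set (PP K (svIndex s n d)) :=
  {x | ∃ u : ∀ i : Fin s, Fin (n i + 1) → K,
    x.submodule = Submodule.span K
      ({fun t => ∏ i, ∏ j, u i j ^ ((t i).1 j : ℕ)} : Set (svIndex s n d → K))}

/-- The vector of the moments of degree `≤ d` of the one-dimensional Gaussian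
distribution with mean `μ` and variance `t`. -/
def gaussMomentVec (K : Type*) [Field K] (d : ℕ) (μ t : K) : Fin (d + 1) → K := fun i =>
  ∑ j ∈ Finset.range ((i : ℕ) / 2 + 1),
    ((Nat.choose (i : ℕ) (2 * j) * Nat.doubleFactorial (2 * j - 1) : ℕ) : K) *
      t ^ j * μ ^ ((i : ℕ) - 2 * j)

/-- The Gaussian moment variety `𝒢_{1,d} ⊆ ℙ^d`. -/
def gaussianMomentVariety (K : Type*) [Field K] (d : ℕ) : Set (PP K (Fin (d + 1))) :=
  zclosure {x | ∃ μ t : K,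
    x.submodule = Submodule.span K ({gaussMomentVec K d μ t} : Set (Fin (d + 1) → K))}

/-- Zariski-closed families of `m`-tuples of coefficient vectors of linear forms. -/
def IsAffineClosedFamily {m : ℕ} (T : Set (Fin m → ι → K)) : Prop :=
  ∃ S : Set (MvPolynomial (Fin m × ι) K),
    T = {h | ∀ f ∈ S, MvPolynomial.eval (fun p => h p.1 p.2) f = 0}

/-- The linear subspace cut out by the `m` linear forms with coefficient vectors `h`. -/
def linearSlice {m : ℕ} (h : Fin m → ι → K) : Set (PP K ι) :=
  {x | ∀ j : Fin m, ∑ i : ι, h j i * x.rep i = 0}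

/-- `x` lies on the hyperplane with coefficient vector `f`. -/
def inHyperplane (f : ι → K) (x : PP K ι) : Prop :=
  ∑ i : ι, f i * x.rep i = 0

/-- `X ⊆ ℙ^r` (of dimension `n`, `r + 1 = card ι`) is very strange: for a general
codimension-`n` linear subspace `M`, some `r - n + 2` points of `X ∩ M` lie in a
hyperplane of `M`, i.e. in a linear subspace of projective dimension `r - n - 1`. -/
def VeryStrange (n : ℕ) (X : Set (PP K ι)) : Prop :=
  ∃ T : Set (Fin n → ι → K), IsAffineClosedFamily T ∧ (∃ h, h ∉ T) ∧
    ∀ h : Fin n → ι → K, h ∉ T →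
      ∃ A : Finset (PP K ι), ↑A ⊆ X ∩ linearSlice h ∧
        A.card = Fintype.card ι + 1 - n ∧
        Module.finrank K (vspan (A : Set (PP K ι))) ≤ Fintype.card ι - 1 - n


set_option linter.unusedSectionVars false
set_option linter.style.haveILetI false

open MvPolynomial in
/-- vanishing ideal -/
def vI {κ : Type*} (V : Set (κ → K)) : Ideal (MvPolynomial κ K) where
  carrier := {f | ∀ v ∈ V, eval v f = 0}
  add_mem' := by intro a b ha hb v hv; simp [ha v hv, hb v hv]
  zero_mem' := by intro v _; simp
  smul_mem' := by intro c a ha v hv; simp [ha v hv]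

theorem mem_vI {κ : Type*} {V : Set (κ → K)} {f : MvPolynomial κ K} :
    f ∈ vI V ↔ ∀ v ∈ V, MvPolynomial.eval v f = 0 := Iff.rfl

theorem mem_coneOf {X : Set (PP K ι)} {v : ι → K} : v ∈ coneOf X ↔ ∃ x ∈ X, v ∈ x.submodule := by
  simp [coneOf]

theorem rep_mem_submodule (x : PP K ι) : x.rep ∈ x.submodule := by
  rw [Projectivization.submodule_eq]; exact Submodule.mem_span_singleton_self _

theorem mem_submodule_iff {x : PP K ι} {v : ι → K} : v ∈ x.submodule ↔ ∃ c : K, c • x.rep = v := by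
  rw [Projectivization.submodule_eq, Submodule.mem_span_singleton]

theorem eq_mk_of_mem {x : PP K ι} {v : ι → K} (hv : v ∈ x.submodule) (h0 : v ≠ 0) :
    Projectivization.mk K v h0 = x := by
  obtain ⟨c, rfl⟩ := mem_submodule_iff.1 hv
  conv_rhs => rw [← Projectivization.mk_rep x]
  rw [Projectivization.mk_eq_mk_iff']
  exact ⟨c, rfl⟩

theorem mem_coneOf_iff {X : Set (PP K ι)} {v : ι → K} (h0 : v ≠ 0) :
    v ∈ coneOf X ↔ Projectivization.mk K v h0 ∈ X := by
  rw [mem_coneOf]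
  constructor
  · rintro ⟨x, hx, hv⟩; rwa [eq_mk_of_mem hv h0]
  · intro h; refine ⟨_, h, ?_⟩
    rw [Projectivization.submodule_mk]; exact Submodule.mem_span_singleton_self _

theorem coneOf_smul {X : Set (PP K ι)} {v : ι → K} (c : K) (h : v ∈ coneOf X) : c • v ∈ coneOf X := by
  obtain ⟨x, hx, hv⟩ := mem_coneOf.1 h
  exact mem_coneOf.2 ⟨x, hx, x.submodule.smul_mem c hv⟩

theorem rep_mem_coneOf {X : Set (PP K ι)} {x : PP K ι} (h : x ∈ X) : x.rep ∈ coneOf X :=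
  mem_coneOf.2 ⟨x, h, rep_mem_submodule x⟩

theorem coneOf_mono {X Y : Set (PP K ι)} (h : X ⊆ Y) : coneOf X ⊆ coneOf Y := by
  intro v hv; obtain ⟨x, hx, h'⟩ := mem_coneOf.1 hv; exact mem_coneOf.2 ⟨x, h hx, h'⟩

theorem vI_mono {κ : Type*} {V W : Set (κ → K)} (h : V ⊆ W) : vI W ≤ vI V :=
  fun _ hf v hv => hf v (h hv)

open MvPolynomial in
/-- restriction to a line through the origin -/
def lineP {κ : Type*} (v : κ → K) (f : MvPolynomial κ K) : Polynomial K :=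
  aeval (fun i => Polynomial.C (v i) * Polynomial.X) f

open MvPolynomial in
theorem lineP_eval {κ : Type*} (v : κ → K) (f : MvPolynomial κ K) (c : K) :
    (lineP v f).eval c = eval (c • v) f := by
  have : (Polynomial.evalRingHom c).comp
      ((aeval (fun i => Polynomial.C (v i) * Polynomial.X) :
        MvPolynomial κ K →ₐ[K] Polynomial K) : MvPolynomial κ K →+* Polynomial K) = eval (c • v) := by
    ext i
    · simp
    · simp only [RingHom.coe_comp, Function.comp_apply, RingHom.coe_coe, aeval_X, Polynomial.coe_evalRingHom, Polynomial.eval_mul, Polynomial.eval_C, Polynomial.eval_X, eval_X, Pi.smul_apply, smul_eq_mul]; ring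
  exact RingHom.congr_fun this f

open MvPolynomial in
theorem eval_smul_homog {κ : Type*} {A : Type*} [CommRing A] [Algebra K A] {d : ℕ}
    {f : MvPolynomial κ K} (hf : f.IsHomogeneous d)
    (c : A) (v : κ → A) : aeval (c • v) f = c ^ d * aeval v f := by
  rw [aeval_def, aeval_def, eval₂_eq, eval₂_eq, Finset.mul_sum]
  refine Finset.sum_congr rfl fun m hm => ?_
  have : ∏ i ∈ m.support, (c • v) i ^ m i = c ^ d * ∏ i ∈ m.support, v i ^ m i := by
    simp only [Pi.smul_apply, smul_eq_mul, mul_pow, Finset.prod_mul_distrib]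
    rw [Finset.prod_pow_eq_pow_sum, hf.degree_eq_sum_deg_support hm]
  rw [this]; ring

open MvPolynomial in
theorem lineP_eq {κ : Type*} (v : κ → K) (f : MvPolynomial κ K) :
    lineP v f = ∑ d ∈ Finset.range (f.totalDegree + 1),
      Polynomial.C (eval v (homogeneousComponent d f)) * Polynomial.X ^ d := by
  conv_lhs => rw [← sum_homogeneousComponent f]
  unfold lineP
  rw [map_sum]
  refine Finset.sum_congr rfl fun d _ => ?_
  have h := eval_smul_homog (homogeneousComponent_isHomogeneous d f) (Polynomial.X : Polynomial K)
    (fun i => Polynomial.C (v i))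
  have e : (fun i => Polynomial.C (v i) * Polynomial.X) =
    (Polynomial.X : Polynomial K) • (fun i => Polynomial.C (v i)) := by
    ext1 i; exact mul_comm _ _
  rw [e, h, mul_comm]
  congr 1
  have : (aeval (fun i => Polynomial.C (v i)) : MvPolynomial κ K →ₐ[K] Polynomial K) =
    (Algebra.ofId K (Polynomial K)).comp (aeval v) := by ext i; simp [Algebra.ofId_apply]
  rw [this]; simp [Algebra.ofId_apply, aeval_eq_eval]

open MvPolynomial in
theorem homogComp_mem_vI [Infinite K] {κ : Type*} {V : Set (κ → K)}
    (hV : ∀ v ∈ V, ∀ c : K, c • v ∈ V)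
    {f : MvPolynomial κ K} (hf : f ∈ vI V) (d : ℕ) : homogeneousComponent d f ∈ vI V := by
  intro v hv
  have h0 : lineP v f = 0 := by
    apply Polynomial.funext; intro c
    rw [lineP_eval, Polynomial.eval_zero]; exact hf _ (hV v hv c)
  by_cases hd : d ∈ Finset.range (f.totalDegree + 1)
  · have := congrArg (fun p => Polynomial.coeff p d) h0
    simp only [lineP_eq, Polynomial.finsetSum_coeff, Polynomial.coeff_C_mul,
      Polynomial.coeff_X_pow, Polynomial.coeff_zero] at this
    rw [Finset.sum_eq_single d] at this
    · simpa using this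
    · intro b _ hb; simp [hb.symm]
    · intro h; exact absurd hd h
  · rw [homogeneousComponent_eq_zero]; · simp
    simp at hd; omega

open MvPolynomial in
theorem isZClosed_zeroLocus [Infinite K] (S : Set (MvPolynomial ι K)) : IsZClosed (zeroLocus S) := by
  refine ⟨{g | ∃ f ∈ S, ∃ d, g = homogeneousComponent d f}, ?_, ?_⟩
  · rintro _ ⟨f, _, d, rfl⟩; exact ⟨d, homogeneousComponent_isHomogeneous d f⟩
  · ext x; constructor
    · rintro h _ ⟨f, hf, d, rfl⟩ v hv
      exact homogComp_mem_vI (V := (x.submodule : Set (ι → K)))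
        (fun v hv c => x.submodule.smul_mem c hv) (fun w hw => h f hf w hw) d v hv
    · intro h f hf v hv
      rw [← sum_homogeneousComponent f, map_sum]
      exact Finset.sum_eq_zero fun d _ => h _ ⟨f, hf, d, rfl⟩ v hv

theorem mem_of_closed {X : Set (PP K ι)} (hX : IsZClosed X) {v : ι → K} (h0 : v ≠ 0)
    (h : ∀ f ∈ vI (coneOf X), MvPolynomial.eval v f = 0) : Projectivization.mk K v h0 ∈ X := by
  obtain ⟨S, hS, rfl⟩ := hX
  intro f hf w hw
  rw [Projectivization.submodule_mk, Submodule.mem_span_singleton] at hw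
  obtain ⟨c, rfl⟩ := hw
  obtain ⟨d, hd⟩ := hS f hf
  have := eval_smul_homog hd c v
  rw [MvPolynomial.aeval_eq_eval, MvPolynomial.aeval_eq_eval] at this
  rw [this, h f, mul_zero]
  intro w hw
  obtain ⟨x, hx, hw⟩ := mem_coneOf.1 hw
  exact hx f hf w hw

theorem zeroLocus_iff {f : MvPolynomial ι K} {X : Set (PP K ι)} :
    X ⊆ zeroLocus {f} ↔ f ∈ vI (coneOf X) := by
  constructor
  · intro h v hv; obtain ⟨x, hx, hv⟩ := mem_coneOf.1 hv
    exact h hx f rfl v hv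
  · rintro h x hx _ rfl v hv
    exact h v (mem_coneOf.2 ⟨x, hx, hv⟩)

theorem zero_mem_coneOf {X : Set (PP K ι)} (h : X.Nonempty) : (0 : ι → K) ∈ coneOf X := by
  obtain ⟨x, hx⟩ := h; exact mem_coneOf.2 ⟨x, hx, zero_mem _⟩

theorem vI_prime [Infinite K] {X : Set (PP K ι)} (hX : IsZIrreducible X) :
    (vI (coneOf X)).IsPrime := by
  constructor
  · intro h
    have : (1 : MvPolynomial ι K) ∈ vI (coneOf X) := by rw [h]; trivial
    simpa using this 0 (zero_mem_coneOf hX.1)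
  · intro f g hfg
    have := hX.2 (zeroLocus {f}) (zeroLocus {g}) (isZClosed_zeroLocus _) (isZClosed_zeroLocus _) ?_
    · simpa only [zeroLocus_iff] using this
    · intro x hx
      have h0 : lineP x.rep f * lineP x.rep g = 0 := by
        have : lineP x.rep f * lineP x.rep g = lineP x.rep (f * g) := by simp [lineP]
        rw [this]
        apply Polynomial.funext; intro c
        rw [lineP_eval, Polynomial.eval_zero]
        exact hfg _ (coneOf_smul c (rep_mem_coneOf hx))
      rcases mul_eq_zero.1 h0 with h | h
      · left; rintro _ rfl v hv; obtain ⟨c, rfl⟩ := mem_submodule_iff.1 hv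
        rw [← lineP_eval, h, Polynomial.eval_zero]
      · right; rintro _ rfl v hv; obtain ⟨c, rfl⟩ := mem_submodule_iff.1 hv
        rw [← lineP_eval, h, Polynomial.eval_zero]

/-- the power of a set, as a set of tuples -/
def pw (α : Type*) {κ : Type*} (V : Set (κ → K)) : Set (α × κ → K) :=
  {z | ∀ a, (fun i => z (a, i)) ∈ V}

open MvPolynomial in
theorem exists_eval_sub {α κ : Type*} [DecidableEq α] (a : α) (u : α × κ → K)
    (g : MvPolynomial (α × κ) K) : ∃ g' : MvPolynomial κ K, ∀ y : κ → K,
      eval y g' = eval (fun p => if p.1 = a then y p.2 else u p) g := by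
  refine ⟨bind₁ (fun p => if p.1 = a then X p.2 else C (u p)) g, fun y => ?_⟩
  rw [← aeval_eq_eval, ← aeval_eq_eval, aeval_bind₁]
  congr 2
  ext p; split_ifs <;> simp

theorem pw_prime {α κ : Type*} [Finite α] {V : Set (κ → K)} (hV : (vI V).IsPrime) :
    (vI (pw α V)).IsPrime := by
  classical
  have := Fintype.ofFinite α
  have hne : V.Nonempty := by
    by_contra h
    rw [Set.not_nonempty_iff_eq_empty] at h
    apply hV.ne_top; rw [Ideal.eq_top_iff_one]; intro v hv; simp [h] at hv
  constructor
  · intro h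
    obtain ⟨v, hv⟩ := hne
    have : (1 : MvPolynomial (α × κ) K) ∈ vI (pw α V) := by rw [h]; trivial
    simpa using this (fun p => v p.2) (fun a => hv)
  · intro g h hgh
    by_contra hcon
    push Not at hcon
    obtain ⟨hg, hh⟩ := hcon
    simp only [mem_vI, not_forall] at hg hh
    have key : ∀ A : Finset α, ∃ u ∈ pw α V, ∃ w ∈ pw α V, (∀ a ∈ A, ∀ i, u (a, i) = w (a, i)) ∧
        MvPolynomial.eval u g ≠ 0 ∧ MvPolynomial.eval w h ≠ 0 := by
      intro A
      induction A using Finset.induction_on with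
      | empty =>
        obtain ⟨u, hu, h1⟩ := hg
        obtain ⟨w, hw, h2⟩ := hh
        exact ⟨u, hu, w, hw, by simp, h1, h2⟩
      | insert a A _ ih =>
        obtain ⟨u, hu, w, hw, h1, h2, h3⟩ := ih
        obtain ⟨g', hg'⟩ := exists_eval_sub a u g
        obtain ⟨h', hh'⟩ := exists_eval_sub a w h
        have e1 : ∀ u : α × κ → K, (fun p : α × κ => if p.1 = a then u (a, p.2) else u p) = u := by
          intro u; ext ⟨b, i⟩; by_cases hb : b = a
          · subst hb; simp
          · simp [hb]
        have n1 : g' ∉ vI V := fun hc => h2 (by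
          have := hc _ (hu a); rw [hg'] at this; simpa [e1] using this)
        have n2 : h' ∉ vI V := fun hc => h3 (by
          have := hc _ (hw a); rw [hh'] at this; simpa [e1] using this)
        have n3 : g' * h' ∉ vI V := fun hc => (hV.mem_or_mem hc).elim n1 n2
        simp only [mem_vI, not_forall, map_mul] at n3
        obtain ⟨y, hy, n3⟩ := n3
        refine ⟨fun p => if p.1 = a then y p.2 else u p, ?_,
          fun p => if p.1 = a then y p.2 else w p, ?_, ?_, ?_, ?_⟩
        · intro b; by_cases hb : b = a <;> simp [hb, hy]; exact hu b
        · intro b; by_cases hb : b = a <;> simp [hb, hy]; exact hw b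
        · intro b hb i; by_cases hba : b = a
          · simp [hba]
          · simp only [hba, if_false]; exact h1 b (by simpa [hba] using hb) i
        · rw [← hg']; exact left_ne_zero_of_mul n3
        · rw [← hh']; exact right_ne_zero_of_mul n3
    obtain ⟨u, hu, w, hw, h1, h2, h3⟩ := key Finset.univ
    have : u = w := by ext ⟨a, i⟩; exact h1 a (Finset.mem_univ _) i
    subst this
    exact mul_ne_zero h2 h3 (by simpa using hgh u hu)

theorem formallySmooth_charZero {A E : Type*} [CommRing A] [IsDomain A] [Field E] [CharZero E]
    [Algebra A E] (hinj : Function.Injective (algebraMap A E)) : Algebra.FormallySmooth A E := by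
  have : FaithfulSMul A E := (faithfulSMul_iff_algebraMap_injective A E).2 hinj
  let F := FractionRing A
  let : Algebra F E := FractionRing.liftAlgebra A E
  have : IsScalarTower A F E := FractionRing.isScalarTower_liftAlgebra A E
  have h1 : Algebra.FormallySmooth A F := Algebra.FormallySmooth.of_isLocalization (nonZeroDivisors A)
  have h2 : Algebra.FormallySmooth F E := by
    obtain ⟨s, hs⟩ := exists_isTranscendenceBasis F E
    have : CharZero F := (algebraMap F E).charZero
    have halg : Algebra.IsAlgebraic (IntermediateField.adjoin F (Set.range ((↑) : s → E))) E :=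
      hs.isAlgebraic_field
    exact Algebra.FormallySmooth.of_algebraicIndependent_of_isSeparable hs.1
  exact Algebra.FormallySmooth.comp A F E

/-- square-zero extension, as a type synonym without extra algebra structures -/
def SqB (E : Type*) [Field E] := TrivSqZeroExt E E

instance (E : Type*) [Field E] : CommRing (SqB E) := inferInstanceAs (CommRing (TrivSqZeroExt E E))

/-- the ring hom attached to a derivation -/
def sqHom {A E : Type*} [CommRing A] [Algebra K A] [Field E] [Algebra K E] [Algebra A E]
    [IsScalarTower K A E] (d : Derivation K A E) : A →+* SqB E where
  toFun a := ((algebraMap A E a, d a) : E × E)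
  map_one' := by
    refine TrivSqZeroExt.ext ?_ ?_
    · exact map_one _
    · exact d.map_one_eq_zero
  map_mul' a b := by
    refine TrivSqZeroExt.ext ?_ ?_
    · exact map_mul _ _ _
    · change d (a * b) = algebraMap A E a • d b + MulOpposite.op (algebraMap A E b) • d a
      simp [Algebra.smul_def, mul_comm]
  map_zero' := by
    refine TrivSqZeroExt.ext ?_ ?_
    · exact map_zero _
    · exact d.map_zero
  map_add' a b := by
    refine TrivSqZeroExt.ext ?_ ?_
    · exact map_add _ _ _
    · exact d.map_add a b

/-- the first projection -/
def sqFst (E : Type*) [Field E] : SqB E →+* E :=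
  (TrivSqZeroExt.fstHom E E E : TrivSqZeroExt E E →ₐ[E] E).toRingHom

/-- the second projection -/
def sqSnd {E : Type*} [Field E] (b : SqB E) : E := TrivSqZeroExt.snd (b : TrivSqZeroExt E E)

theorem sqSnd_mul {E : Type*} [Field E] (a b : SqB E) :
    sqSnd (a * b) = sqFst E a * sqSnd b + sqFst E b * sqSnd a := by
  change TrivSqZeroExt.fst a • TrivSqZeroExt.snd b
    + MulOpposite.op (TrivSqZeroExt.fst b) • TrivSqZeroExt.snd a = _
  rw [op_smul_eq_smul]; rfl

theorem sqSnd_add {E : Type*} [Field E] (a b : SqB E) :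
    sqSnd (a + b) = sqSnd a + sqSnd b := rfl

theorem exists_derivation_ext {A E : Type*} [CommRing A] [IsDomain A] [Algebra K A] [Field E]
    [CharZero E] [Algebra K E] [Algebra A E] [IsScalarTower K A E]
    (hinj : Function.Injective (algebraMap A E)) (d : Derivation K A E) :
    ∃ D : Derivation K E E, ∀ a, D (algebraMap A E a) = d a := by
  have := formallySmooth_charZero hinj
  let alg : Algebra A (SqB E) := (sqHom d).toAlgebra
  let g : SqB E →ₐ[A] E := { sqFst E with commutes' := fun a => rfl }
  have hg : Function.Surjective g := fun e => ⟨((e, 0) : E × E), rfl⟩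
  have hker : IsNilpotent (RingHom.ker (g : SqB E →+* E)) := by
    refine ⟨2, ?_⟩
    rw [sq, Ideal.zero_eq_bot, eq_bot_iff, Ideal.mul_le]
    intro r hr s hs
    have hr' : sqFst E r = 0 := hr
    have hs' : sqFst E s = 0 := hs
    rw [Ideal.mem_bot]
    refine TrivSqZeroExt.ext ?_ ?_
    · change sqFst E (r * s) = 0; rw [map_mul, hr', zero_mul]
    · change sqSnd (r * s) = 0; rw [sqSnd_mul, hr', hs', zero_mul, zero_mul, zero_add]
  let f := Algebra.FormallySmooth.liftOfSurjective (AlgHom.id A E) g hg hker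
  have hf : ∀ e, sqFst E (f e) = e := fun e =>
    Algebra.FormallySmooth.liftOfSurjective_apply (AlgHom.id A E) g hg hker e
  have hfa : ∀ a, sqSnd (f (algebraMap A E a)) = d a := by
    intro a
    rw [f.commutes]
    rfl
  let D : Derivation K E E := Derivation.mk'
    { toFun := fun e => sqSnd (f e)
      map_add' := by intro a b; rw [map_add, sqSnd_add]
      map_smul' := by
        intro c e
        rw [Algebra.smul_def c e, IsScalarTower.algebraMap_apply K A E, map_mul,
          sqSnd_mul, hfa, hf, d.map_algebraMap, ← IsScalarTower.algebraMap_apply K A E]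
        simp [Algebra.smul_def] } (by
      intro a b
      change sqSnd (f (a * b)) = a * sqSnd (f b) + b * sqSnd (f a)
      rw [map_mul, sqSnd_mul, hf, hf])
  exact ⟨D, hfa⟩

open MvPolynomial in
/-- gradient of a polynomial at an `E`-point -/
def grad {κ E : Type*} [CommRing E] [Algebra K E] (x : κ → E) (f : MvPolynomial κ K) : κ → E :=
  fun i => aeval x (pderiv i f)

open MvPolynomial in
/-- directional derivative -/
def dd {κ E : Type*} [Fintype κ] [CommRing E] [Algebra K E] (x : κ → E) (f : MvPolynomial κ K)
  (v : κ → E) : E := ∑ i, v i * aeval x (pderiv i f)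

open MvPolynomial in
theorem deriv_aeval {κ E : Type*} [Fintype κ] [CommRing E] [Algebra K E]
    (δ : Derivation K E E) (x : κ → E) (f : MvPolynomial κ K) :
    δ (aeval x f) = dd x f (fun i => δ (x i)) := by
  unfold dd
  induction f using MvPolynomial.induction_on with
  | C a => simp
  | add p q hp hq => simp [hp, hq, mul_add, Finset.sum_add_distrib]
  | mul_X p i hp =>
    classical
    simp only [map_mul, aeval_X, Derivation.leibniz, pderiv_X, hp, smul_eq_mul, map_add,
      mul_add, Finset.sum_add_distrib]
    congr 1
    · rw [Finset.sum_eq_single i]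
      · simp only [Pi.single_eq_same, map_one, mul_one]
        exact mul_comm _ _
      · intro b _ hb; simp [Pi.single_eq_of_ne hb.symm]
      · simp
    · rw [Finset.mul_sum]; refine Finset.sum_congr rfl fun j _ => ?_
      ring

/-- apply a derivation coordinatewise -/
def dv {κ E : Type*} [CommRing E] [Algebra K E] (δ : Derivation K E E) (x : κ → E) : κ → E :=
  fun i => δ (x i)

/-- generic points -/
def Gen {κ E : Type*} [Field E] [Algebra K E] (V : Set (κ → K)) (x : κ → E) : Prop :=
  ∀ g : MvPolynomial κ K, MvPolynomial.aeval x g = 0 ↔ g ∈ vI V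

theorem dd_add {κ E : Type*} [Fintype κ] [CommRing E] [Algebra K E] (x : κ → E)
    (f : MvPolynomial κ K) (v w : κ → E) : dd x f (v + w) = dd x f v + dd x f w := by
  simp [dd, add_mul, Finset.sum_add_distrib]

theorem dd_smul {κ E : Type*} [Fintype κ] [CommRing E] [Algebra K E] (x : κ → E)
    (f : MvPolynomial κ K) (c : E) (v : κ → E) : dd x f (c • v) = c * dd x f v := by
  simp [dd, mul_assoc, Finset.mul_sum]

theorem dd_zero {κ E : Type*} [Fintype κ] [CommRing E] [Algebra K E] (x : κ → E)
    (f : MvPolynomial κ K) : dd x f 0 = 0 := by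
  simp [dd]

theorem dd_add_poly {κ E : Type*} [Fintype κ] [CommRing E] [Algebra K E] (x : κ → E)
    (f g : MvPolynomial κ K) (v : κ → E) : dd x (f + g) v = dd x f v + dd x g v := by
  simp [dd, mul_add, Finset.sum_add_distrib]

theorem dd_sub_poly {κ E : Type*} [Fintype κ] [CommRing E] [Algebra K E] (x : κ → E)
    (f g : MvPolynomial κ K) (v : κ → E) : dd x (f - g) v = dd x f v - dd x g v := by
  simp [dd, mul_sub, Finset.sum_sub_distrib]

theorem dd_smul_poly {κ E : Type*} [Fintype κ] [CommRing E] [Algebra K E] (x : κ → E)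
    (c : K) (f : MvPolynomial κ K) (v : κ → E) : dd x (c • f) v = c • dd x f v := by
  simp [dd, Finset.smul_sum]

theorem dd_mul_poly {κ E : Type*} [Fintype κ] [CommRing E] [Algebra K E] (x : κ → E)
    (f g : MvPolynomial κ K) (v : κ → E) : dd x (f * g) v =
      MvPolynomial.aeval x f * dd x g v + MvPolynomial.aeval x g * dd x f v := by
  simp only [dd, Finset.mul_sum, ← Finset.sum_add_distrib, Derivation.leibniz, map_add,
    smul_eq_mul, map_mul]
  exact Finset.sum_congr rfl fun i _ => by ring

/-- If `x` is a generic point for `V` and `v` is killed by all differentials of `vI V`, then `v`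
is `δ x` for a derivation `δ`. More generally, on a subset of functions. -/
theorem exists_derivation_of_tangent {κ E : Type*} [Fintype κ] [Field E] [CharZero E] [Algebra K E]
    (x v : κ → E)
    (hv : ∀ g : MvPolynomial κ K, MvPolynomial.aeval x g = 0 → dd x g v = 0) :
    ∃ δ : Derivation K E E, dv δ x = v := by
  let φ : MvPolynomial κ K →ₐ[K] E := MvPolynomial.aeval x
  let A := φ.range
  have hs : Function.Surjective φ.rangeRestrict := φ.rangeRestrict_surjective
  let ch : A → MvPolynomial κ K := Function.surjInv hs
  have hch : ∀ a : A, MvPolynomial.aeval x (ch a) = a := fun a =>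
    congrArg Subtype.val (Function.surjInv_eq hs a)
  have hwd : ∀ g h : MvPolynomial κ K, MvPolynomial.aeval x g = MvPolynomial.aeval x h →
      dd x g v = dd x h v := by
    intro g h hgh
    have := hv (g - h) (by rw [map_sub, hgh, sub_self])
    rw [dd_sub_poly] at this
    exact sub_eq_zero.1 this
  let d : Derivation K A E := Derivation.mk'
    { toFun := fun a => dd x (ch a) v
      map_add' := fun a b => by
        rw [← dd_add_poly]; exact hwd _ _ (by rw [map_add, hch, hch, hch]; rfl)
      map_smul' := fun c a => by
        rw [RingHom.id_apply, ← dd_smul_poly]; exact hwd _ _ (by rw [map_smul, hch, hch]; rfl) } (by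
      intro a b
      change dd x (ch (a * b)) v = (a : E) * dd x (ch b) v + (b : E) * dd x (ch a) v
      rw [hwd (ch (a * b)) (ch a * ch b) (by rw [map_mul, hch, hch, hch]; rfl), dd_mul_poly,
        hch, hch])
  obtain ⟨D, hD⟩ := exists_derivation_ext (A := A) (E := E) Subtype.val_injective d
  refine ⟨D, ?_⟩
  ext i
  have h1 : x i = algebraMap A E (φ.rangeRestrict (MvPolynomial.X i)) := by
    change x i = φ (MvPolynomial.X i); simp [φ]
  change D (x i) = v i
  rw [h1, hD]
  change dd x (ch _) v = v i
  rw [hwd _ (MvPolynomial.X i) (by rw [hch]; rfl)]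
  classical
  simp [dd, MvPolynomial.pderiv_X, Pi.single_apply]

section Tang
variable {κ : Type*} [Fintype κ] {E : Type*} [Field E] [Algebra K E]

/-- tangent space of the cone at an `E`-point -/
def tsp (V : Set (κ → K)) (p : κ → E) : Submodule E (κ → E) where
  carrier := {v | ∀ f ∈ vI V, dd p f v = 0}
  add_mem' := by intro a b ha hb f hf; rw [dd_add, ha f hf, hb f hf, add_zero]
  zero_mem' := fun f _ => dd_zero p f
  smul_mem' := by intro c a ha f hf; rw [dd_smul, ha f hf, mul_zero]

theorem dv_mem_tsp {V : Set (κ → K)} {x : κ → E}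
    (hx : ∀ f ∈ vI V, MvPolynomial.aeval x f = 0) (δ : Derivation K E E) : dv δ x ∈ tsp V x := by
  intro f hf
  have := deriv_aeval δ x f
  rw [hx f hf, map_zero] at this
  exact this.symm

theorem Gen.dv_mem {V : Set (κ → K)} {x : κ → E} (hx : Gen V x) (δ : Derivation K E E) :
    dv δ x ∈ tsp V x := dv_mem_tsp (fun f hf => (hx f).2 hf) δ

theorem Gen.exists_dv [CharZero E] {V : Set (κ → K)} {x : κ → E} (hx : Gen V x) {v : κ → E}
    (hv : v ∈ tsp V x) : ∃ δ : Derivation K E E, dv δ x = v :=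
  exists_derivation_of_tangent x v fun g hg => hv g ((hx g).1 hg)

/-- second derivative -/
def hs (p : κ → E) (f : MvPolynomial κ K) (v w : κ → E) : E :=
  ∑ i, w i * dd p (MvPolynomial.pderiv i f) v

theorem hs_add_left (p : κ → E) (f : MvPolynomial κ K) (v v' w : κ → E) :
    hs p f (v + v') w = hs p f v w + hs p f v' w := by
  simp [hs, dd_add, mul_add, Finset.sum_add_distrib]

theorem hs_smul_left (p : κ → E) (f : MvPolynomial κ K) (c : E) (v w : κ → E) :
    hs p f (c • v) w = c * hs p f v w := by
  simp only [hs, dd_smul, Finset.mul_sum]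
  exact Finset.sum_congr rfl fun i _ => by ring

theorem deriv_dd (δ : Derivation K E E) (x : κ → E) (f : MvPolynomial κ K) (w : κ → E) :
    δ (dd x f w) = dd x f (dv δ w) + hs x f (dv δ x) w := by
  unfold dd hs
  rw [map_sum, ← Finset.sum_add_distrib]
  refine Finset.sum_congr rfl fun i _ => ?_
  rw [Derivation.leibniz, deriv_aeval]
  simp only [dv, smul_eq_mul]
  rw [add_comm, mul_comm]; rfl

/-- combination of differentials -/
def cd {V : Set (κ → K)} (p : κ → E) (c : vI V →₀ E) (z : κ → E) : E :=
  c.sum fun f a => a * dd p (f : MvPolynomial κ K) z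

/-- combination of second differentials -/
def ch {V : Set (κ → K)} (p : κ → E) (c : vI V →₀ E) (v w : κ → E) : E :=
  c.sum fun f a => a * hs p (f : MvPolynomial κ K) v w

/-- the infinitesimal contact space -/
def ctc (V : Set (κ → K)) (p : κ → E) (M : Submodule E (κ → E)) : Submodule E (κ → E) where
  carrier := {v | v ∈ tsp V p ∧ ∀ c : vI V →₀ E, (∀ z ∈ M, cd p c z = 0) →
    ∀ w ∈ tsp V p, ch p c v w = 0}
  add_mem' := by
    rintro a b ⟨ha, ha'⟩ ⟨hb, hb'⟩
    refine ⟨add_mem ha hb, fun c hc w hw => ?_⟩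
    have : ch p c (a + b) w = ch p c a w + ch p c b w := by
      simp [ch, hs_add_left, mul_add, Finsupp.sum_add]
    rw [this, ha' c hc w hw, hb' c hc w hw, add_zero]
  zero_mem' := by
    refine ⟨zero_mem _, fun c hc w hw => ?_⟩
    simp [ch, hs, dd_zero]
  smul_mem' := by
    rintro e a ⟨ha, ha'⟩
    refine ⟨Submodule.smul_mem _ _ ha, fun c hc w hw => ?_⟩
    have : ch p c (e • a) w = e * ch p c a w := by
      simp only [ch, hs_smul_left, Finsupp.mul_sum]
      exact Finsupp.sum_congr fun f _ => by ring
    rw [this, ha' c hc w hw, mul_zero]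

theorem ctc_le_tsp (V : Set (κ → K)) (p : κ → E) (M : Submodule E (κ → E)) :
    ctc V p M ≤ tsp V p := fun _ h => h.1

theorem ctc_mono (V : Set (κ → K)) (p : κ → E) {M M' : Submodule E (κ → E)} (h : M ≤ M') :
    ctc V p M ≤ ctc V p M' := fun _ hv => ⟨hv.1, fun c hc => hv.2 c fun z hz => hc z (h hz)⟩

theorem cd_eq_zero {V : Set (κ → K)} {p : κ → E} (c : vI V →₀ E) {z : κ → E} (hz : z ∈ tsp V p) :
    cd p c z = 0 := by
  rw [cd, Finsupp.sum]
  exact Finset.sum_eq_zero fun f _ => by rw [hz f f.2, mul_zero]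

theorem deriv_cd {V : Set (κ → K)} (δ : Derivation K E E) {p w : κ → E} (hw : w ∈ tsp V p)
    (c : vI V →₀ E) : cd p c (dv δ w) + ch p c (dv δ p) w = 0 := by
  rw [cd, ch, ← Finsupp.sum_add, Finsupp.sum]
  refine Finset.sum_eq_zero fun f _ => ?_
  rw [← mul_add, ← deriv_dd, hw f f.2, map_zero, mul_zero]

/-- `cd` as a linear functional -/
def cdL {V : Set (κ → K)} (p : κ → E) (f : vI V) : Module.Dual E (κ → E) where
  toFun z := dd p (f : MvPolynomial κ K) z
  map_add' := dd_add p _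
  map_smul' c z := by rw [dd_smul]; rfl

theorem exists_cd {V : Set (κ → K)} {p : κ → E} (l : Module.Dual E (κ → E))
    (hl : ∀ z ∈ tsp V p, l z = 0) : ∃ c : vI V →₀ E, ∀ z, cd p c z = l z := by
  have h1 : tsp V p = (Submodule.span E (Set.range (cdL (V := V) p))).dualCoannihilator := by
    ext z
    rw [Submodule.mem_dualCoannihilator]
    constructor
    · intro hz φ hφ
      induction hφ using Submodule.span_induction with
      | mem φ h => obtain ⟨f, rfl⟩ := h; exact hz f f.2
      | zero => rfl
      | add a b _ _ ha hb => rw [LinearMap.add_apply, ha, hb, add_zero]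
      | smul c a _ ha => rw [LinearMap.smul_apply, ha, smul_zero]
    · intro h f hf
      exact h (cdL p ⟨f, hf⟩) (Submodule.subset_span ⟨_, rfl⟩)
  have h2 : l ∈ Submodule.span E (Set.range (cdL (V := V) p)) := by
    rw [← Subspace.dualCoannihilator_dualAnnihilator_eq
      (W := Submodule.span E (Set.range (cdL (V := V) p))), ← h1,
      Submodule.mem_dualAnnihilator]
    exact hl
  obtain ⟨c, hc⟩ := Finsupp.mem_span_range_iff_exists_finsupp.1 h2
  refine ⟨c, fun z => ?_⟩
  rw [← hc, cd, Finsupp.sum, Finsupp.sum, LinearMap.sum_apply]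
  rfl

theorem dv_mem_of_ctc {V : Set (κ → K)} {p : κ → E} {M : Submodule E (κ → E)}
    (hM : tsp V p ≤ M) (δ : Derivation K E E) (h : dv δ p ∈ ctc V p M) {w : κ → E}
    (hw : w ∈ tsp V p) : dv δ w ∈ M := by
  by_contra hcon
  obtain ⟨l, hl, hl'⟩ := Submodule.exists_le_ker_of_notMem hcon
  obtain ⟨c, hc⟩ := exists_cd (V := V) (p := p) l (fun z hz => hl' (hM hz))
  have := deriv_cd δ hw c
  rw [h.2 c (fun z hz => by rw [hc]; exact hl' hz) w hw, add_zero, hc] at this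
  exact hl this

theorem mem_ctc_of_dv {V : Set (κ → K)} {p : κ → E} {M : Submodule E (κ → E)}
    (δ : Derivation K E E) (hp : dv δ p ∈ tsp V p) (h : ∀ w ∈ tsp V p, dv δ w ∈ M) :
    dv δ p ∈ ctc V p M := by
  refine ⟨hp, fun c hc w hw => ?_⟩
  have := deriv_cd δ hw c
  rwa [hc _ (h w hw), zero_add] at this

theorem dd_self_homog {p : κ → E} {f : MvPolynomial κ K} {d : ℕ} (hf : f.IsHomogeneous d) :
    dd p f p = d * MvPolynomial.aeval p f := by
  have := congrArg (MvPolynomial.aeval p) hf.sum_X_mul_pderiv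
  simpa [dd] using this

theorem self_mem_tsp [Infinite K] {V : Set (κ → K)} (hV : ∀ v ∈ V, ∀ c : K, c • v ∈ V) {p : κ → E}
    (hp : ∀ f ∈ vI V, MvPolynomial.aeval p f = 0) : p ∈ tsp V p := by
  intro f hf
  have h : dd p (∑ d ∈ Finset.range (f.totalDegree + 1), MvPolynomial.homogeneousComponent d f) p
      = ∑ d ∈ Finset.range (f.totalDegree + 1), dd p (MvPolynomial.homogeneousComponent d f) p := by
    simp only [dd, map_sum, Finset.mul_sum]; exact Finset.sum_comm
  rw [MvPolynomial.sum_homogeneousComponent] at h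
  rw [h]
  refine Finset.sum_eq_zero fun d _ => ?_
  rw [dd_self_homog (MvPolynomial.homogeneousComponent_isHomogeneous d f),
    hp _ (homogComp_mem_vI hV hf d), mul_zero]

theorem hs_self [Infinite K] {V : Set (κ → K)} (hV : ∀ v ∈ V, ∀ c : K, c • v ∈ V) {p : κ → E}
    {f : MvPolynomial κ K} (hf : f ∈ vI V)
    {w : κ → E} (hw : w ∈ tsp V p) : hs p f p w = 0 := by
  have h : hs p (∑ d ∈ Finset.range (f.totalDegree + 1), MvPolynomial.homogeneousComponent d f) p w
     = ∑ d ∈ Finset.range (f.totalDegree + 1), hs p (MvPolynomial.homogeneousComponent d f) p w := by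
    simp only [hs, dd, map_sum, Finset.mul_sum]
    rw [Finset.sum_comm]
    conv_rhs => rw [Finset.sum_comm]
    rw [Finset.sum_comm]
    refine Finset.sum_congr rfl fun i _ => ?_
    rw [Finset.sum_comm]
  rw [MvPolynomial.sum_homogeneousComponent] at h
  rw [h]
  refine Finset.sum_eq_zero fun d _ => ?_
  have hd := MvPolynomial.homogeneousComponent_isHomogeneous d f
  have h2 := hw _ (homogComp_mem_vI hV hf d)
  have : hs p (MvPolynomial.homogeneousComponent d f) p w =
      ((d - 1 : ℕ) : E) * dd p (MvPolynomial.homogeneousComponent d f) w := by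
    rw [hs, dd, Finset.mul_sum]
    refine Finset.sum_congr rfl fun i _ => ?_
    rw [dd_self_homog (hd.pderiv)]; ring
  rw [this, h2, mul_zero]

theorem self_mem_ctc [Infinite K] {V : Set (κ → K)} (hV : ∀ v ∈ V, ∀ c : K, c • v ∈ V) {p : κ → E}
    (hp : ∀ f ∈ vI V, MvPolynomial.aeval p f = 0) (M : Submodule E (κ → E)) : p ∈ ctc V p M := by
  refine ⟨self_mem_tsp hV hp, fun c _ w hw => ?_⟩
  rw [ch, Finsupp.sum]
  exact Finset.sum_eq_zero fun f _ => by rw [hs_self hV f.2 hw, mul_zero]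

/-- if `δ p` is zero or `p` then `δ` preserves the tangent space. -/
theorem dv_tsp_of_zero {V : Set (κ → K)} {p : κ → E} (δ : Derivation K E E) (h : dv δ p = 0)
    {w : κ → E} (hw : w ∈ tsp V p) : dv δ w ∈ tsp V p := by
  intro f hf
  have := deriv_dd δ p f w
  rw [h, hw f hf, map_zero] at this
  simpa [hs, dd_zero] using this.symm

theorem dv_tsp_of_self [Infinite K] {V : Set (κ → K)} (hV : ∀ v ∈ V, ∀ c : K, c • v ∈ V) {p : κ → E}
    (δ : Derivation K E E) (h : dv δ p = p)
    {w : κ → E} (hw : w ∈ tsp V p) : dv δ w ∈ tsp V p := by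
  intro f hf
  have := deriv_dd δ p f w
  rw [h, hw f hf, map_zero, hs_self hV hf hw, add_zero] at this
  exact this.symm

end Tang

section BaseChange
variable {κ : Type*} [Fintype κ] {E : Type*} [Field E] [Algebra K E]
  {E' : Type*} [Field E'] [Algebra K E'] [Algebra E E'] [IsScalarTower K E E']

/-- base change of vectors -/
def ac (E' : Type*) [Field E'] [Algebra E E'] (v : κ → E) : κ → E' := fun i => algebraMap E E' (v i)

theorem coords_mem (v' : κ → E') (W : Submodule E' (κ → E'))
    (h : ∀ ψ : E' →ₗ[E] E, ac E' (fun i => ψ (v' i)) ∈ W) : v' ∈ W := by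
  classical
  let b := Module.Basis.ofVectorSpace E E'
  let F := Finset.univ.biUnion fun i => (b.repr (v' i)).support
  have : v' = ∑ t ∈ F, (b t) • ac E' (fun i => (b.coord t) (v' i)) := by
    funext i
    rw [Finset.sum_apply]
    conv_lhs => rw [← b.linearCombination_repr (v' i)]
    rw [Finsupp.linearCombination_apply, Finsupp.sum_of_support_subset (s := F)]
    · refine Finset.sum_congr rfl fun t _ => ?_
      simp [ac, Algebra.smul_def, mul_comm]
    · exact Finset.subset_biUnion_of_mem (fun i => (b.repr (v' i)).support) (Finset.mem_univ i)
    · simp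
  rw [this]
  exact sum_mem fun t _ => W.smul_mem _ (h _)

theorem scalar_zero (a : E') (h : ∀ ψ : E' →ₗ[E] E, ψ a = 0) : a = 0 :=
  (Module.forall_dual_apply_eq_zero_iff E a).1 h

theorem dd_ac (p : κ → E) (f : MvPolynomial κ K) (v : κ → E) :
    dd (ac E' p) f (ac E' v) = algebraMap E E' (dd p f v) := by
  simp only [dd, map_sum, map_mul]
  refine Finset.sum_congr rfl fun i _ => ?_
  congr 1
  exact MvPolynomial.aeval_algebraMap_apply E' p _

theorem psi_dd (ψ : E' →ₗ[E] E) (p : κ → E) (f : MvPolynomial κ K) (v : κ → E') :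
    ψ (dd (ac E' p) f v) = dd p f (fun i => ψ (v i)) := by
  simp only [dd, map_sum]
  refine Finset.sum_congr rfl fun i _ => ?_
  have : MvPolynomial.aeval (ac E' p) (MvPolynomial.pderiv i f) = algebraMap E E' (MvPolynomial.aeval p (MvPolynomial.pderiv i f)) :=
    MvPolynomial.aeval_algebraMap_apply E' p _
  rw [this, mul_comm, ← Algebra.smul_def, map_smul, smul_eq_mul, mul_comm]

theorem hs_ac (p : κ → E) (f : MvPolynomial κ K) (v w : κ → E) :
    hs (ac E' p) f (ac E' v) (ac E' w) = algebraMap E E' (hs p f v w) := by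
  simp only [hs, dd_ac, map_sum, map_mul]; rfl

theorem psi_hs (ψ : E' →ₗ[E] E) (p : κ → E) (f : MvPolynomial κ K) (v : κ → E') (w : κ → E) :
    ψ (hs (ac E' p) f v (ac E' w)) = hs p f (fun i => ψ (v i)) w := by
  simp only [hs, map_sum]
  refine Finset.sum_congr rfl fun i _ => ?_
  rw [ac, ← Algebra.smul_def, map_smul, smul_eq_mul, psi_dd]

theorem tsp_ac {V : Set (κ → K)} {p v : κ → E} (h : v ∈ tsp V p) : ac E' v ∈ tsp V (ac E' p) :=
  fun f hf => by rw [dd_ac, h f hf, map_zero]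

theorem tsp_psi {V : Set (κ → K)} {p : κ → E} {v : κ → E'} (h : v ∈ tsp V (ac E' p))
    (ψ : E' →ₗ[E] E) : (fun i => ψ (v i)) ∈ tsp V p :=
  fun f hf => by rw [← psi_dd, h f hf, map_zero]

theorem psi_ch {V : Set (κ → K)} (ψ : E' →ₗ[E] E) (p : κ → E) (c : vI V →₀ E') (v w : κ → E) :
    ψ (ch (ac E' p) c (ac E' v) (ac E' w)) = ch p (c.mapRange ψ (map_zero ψ)) v w := by
  rw [ch, ch, Finsupp.sum_mapRange_index (by simp), Finsupp.sum, map_sum]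
  refine Finset.sum_congr rfl fun f _ => ?_
  rw [hs_ac, mul_comm, ← Algebra.smul_def, map_smul, smul_eq_mul, mul_comm]

theorem psi_cd {V : Set (κ → K)} (ψ : E' →ₗ[E] E) (p : κ → E) (c : vI V →₀ E') (v : κ → E) :
    ψ (cd (ac E' p) c (ac E' v)) = cd p (c.mapRange ψ (map_zero ψ)) v := by
  rw [cd, cd, Finsupp.sum_mapRange_index (by simp), Finsupp.sum, map_sum]
  refine Finset.sum_congr rfl fun f _ => ?_
  rw [dd_ac, mul_comm, ← Algebra.smul_def, map_smul, smul_eq_mul, mul_comm]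

theorem psi_cd' {V : Set (κ → K)} (ψ : E' →ₗ[E] E) (p : κ → E) (c : vI V →₀ E) (v : κ → E') :
    ψ (cd (ac E' p) (c.mapRange (algebraMap E E') (map_zero _)) v) = cd p c (fun i => ψ (v i)) := by
  rw [cd, cd, Finsupp.sum_mapRange_index (by simp), Finsupp.sum, map_sum]
  refine Finset.sum_congr rfl fun f _ => ?_
  rw [← Algebra.smul_def, map_smul, smul_eq_mul, psi_dd]

theorem psi_ch' {V : Set (κ → K)} (ψ : E' →ₗ[E] E) (p : κ → E) (c : vI V →₀ E) (v : κ → E')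
    (w : κ → E) :
    ψ (ch (ac E' p) (c.mapRange (algebraMap E E') (map_zero _)) v (ac E' w)) =
      ch p c (fun i => ψ (v i)) w := by
  rw [ch, ch, Finsupp.sum_mapRange_index (by simp), Finsupp.sum, map_sum]
  refine Finset.sum_congr rfl fun f _ => ?_
  rw [← Algebra.smul_def, map_smul, smul_eq_mul, psi_hs]

theorem ctc_ac {V : Set (κ → K)} {p v : κ → E} {M : Submodule E (κ → E)}
    {M' : Submodule E' (κ → E')} (hM : ∀ z ∈ M, ac E' z ∈ M')
    (h : v ∈ ctc V p M) : ac E' v ∈ ctc V (ac E' p) M' := by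
  refine ⟨tsp_ac h.1, fun c hc w hw => ?_⟩
  let L : (κ → E') →ₗ[E'] E' :=
    { toFun := fun w => ch (ac E' p) c (ac E' v) w
      map_add' := by
        intro a b; simp only [ch, hs, Pi.add_apply, add_mul, Finset.sum_add_distrib, mul_add,
          Finsupp.sum_add]
      map_smul' := by
        intro e a
        simp only [ch, hs, Pi.smul_apply, smul_eq_mul, mul_assoc, ← Finset.mul_sum, RingHom.id_apply,
          Finsupp.mul_sum]
        exact Finsupp.sum_congr fun f _ => by ring }
  change w ∈ LinearMap.ker L
  refine coords_mem (E := E) w _ fun ψ => ?_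
  change ch (ac E' p) c (ac E' v) _ = 0
  refine scalar_zero (E := E) _ fun ψ' => ?_
  rw [psi_ch]
  refine h.2 _ (fun z hz => ?_) _ (tsp_psi hw ψ)
  rw [← psi_cd, hc _ (hM z hz), map_zero]

/-- `cd` as a linear map -/
def cdM {V : Set (κ → K)} (p : κ → E) (c : vI V →₀ E) : (κ → E) →ₗ[E] E where
  toFun z := cd p c z
  map_add' a b := by simp [cd, dd_add, mul_add, Finsupp.sum_add]
  map_smul' e a := by
    simp only [cd, dd_smul, RingHom.id_apply, smul_eq_mul, Finsupp.mul_sum]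
    exact Finsupp.sum_congr fun f _ => by ring

theorem ctc_psi {V : Set (κ → K)} {p : κ → E} {v : κ → E'} {M : Submodule E (κ → E)}
    {M' : Submodule E' (κ → E')} (hM : M' ≤ Submodule.span E' (ac E' '' (M : Set (κ → E))))
    (h : v ∈ ctc V (ac E' p) M') (ψ : E' →ₗ[E] E) : (fun i => ψ (v i)) ∈ ctc V p M := by
  refine ⟨tsp_psi h.1 ψ, fun c hc w hw => ?_⟩
  rw [← psi_ch', h.2 _ (fun z hz => ?_) _ (tsp_ac hw), map_zero]
  have hle : Submodule.span E' (ac E' '' (M : Set (κ → E))) ≤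
      LinearMap.ker (cdM (ac E' p) (c.mapRange (algebraMap E E') (map_zero _))) := by
    rw [Submodule.span_le]
    rintro _ ⟨z, hz, rfl⟩
    change cd _ _ _ = 0
    refine scalar_zero (E := E) _ fun ψ' => ?_
    rw [psi_cd']
    have : (fun i => ψ' (ac E' z i)) = ψ' 1 • z := by
      funext i
      simp [ac, Algebra.algebraMap_eq_smul_one, mul_comm]
    rw [this]; exact hc _ (M.smul_mem _ hz)
  exact hle (hM hz)

/-- span of tangent spaces -/
def Msp {α : Type*} (V : Set (κ → K)) (x : α → κ → E) (A : Set α) : Submodule E (κ → E) :=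
  ⨆ b ∈ A, tsp V (x b)

theorem tsp_le_Msp {α : Type*} {V : Set (κ → K)} {x : α → κ → E} {A : Set α} {a : α} (ha : a ∈ A) :
    tsp V (x a) ≤ Msp V x A := le_iSup₂_of_le a ha le_rfl

theorem Msp_mono {α : Type*} {V : Set (κ → K)} {x : α → κ → E} {A B : Set α} (h : A ⊆ B) :
    Msp V x A ≤ Msp V x B := iSup₂_le fun _ hb => tsp_le_Msp (h hb)

theorem Msp_ac {α : Type*} {V : Set (κ → K)} {x : α → κ → E} {A : Set α} {z : κ → E}
    (hz : z ∈ Msp V x A) : ac E' z ∈ Msp V (fun b => ac E' (x b)) A := by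
  let L : (κ → E) →ₗ[E] (κ → E') := 
    { toFun := ac E'
      map_add' := fun a b => by funext i; simp [ac]
      map_smul' := fun e a => by funext i; simp [ac, Algebra.smul_def] }
  have : Msp V x A ≤ ((Msp V (fun b => ac E' (x b)) A).restrictScalars E).comap L :=
    iSup₂_le fun b hb v hv => tsp_le_Msp (x := fun b => ac E' (x b)) hb (tsp_ac hv)
  exact this hz

theorem Msp_le_span {α : Type*} {V : Set (κ → K)} {x : α → κ → E} {A : Set α} :
    Msp V (fun b => ac E' (x b)) A ≤
      Submodule.span E' (ac E' '' (Msp V x A : Set (κ → E))) := by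
  refine iSup₂_le fun b hb v hv => coords_mem (E := E) v _ fun ψ => ?_
  exact Submodule.subset_span ⟨_, tsp_le_Msp hb (tsp_psi hv ψ), rfl⟩

/-- trivial contact -/
def Qc {α : Type*} (V : Set (κ → K)) (x : α → κ → E) (A : Set α) (a : α) : Prop :=
  ctc V (x a) (Msp V x A) ≤ Submodule.span E {x a}

theorem Qc.ac {α : Type*} {V : Set (κ → K)} {x : α → κ → E} {A : Set α} {a : α}
    (h : Qc V x A a) : Qc V (fun b => ac E' (x b)) A a := by
  intro v hv
  refine coords_mem (E := E) v _ fun ψ => ?_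
  have := h (ctc_psi Msp_le_span hv ψ)
  obtain ⟨c, hc⟩ := Submodule.mem_span_singleton.1 this
  rw [← hc]
  refine Submodule.mem_span_singleton.2 ⟨algebraMap E E' c, ?_⟩
  funext i; simp [ContactLoci.ac]

theorem Qc.of_ac {α : Type*} {V : Set (κ → K)} {x : α → κ → E} {A : Set α} {a : α}
    (h : Qc V (fun b => ContactLoci.ac E' (x b)) A a) : Qc V x A a := by
  intro v hv
  have := h (ctc_ac (E' := E') (fun z hz => Msp_ac hz) hv)
  obtain ⟨c, hc⟩ := Submodule.mem_span_singleton.1 this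
  by_cases h0 : x a = 0
  · have : v = 0 := by
      funext i
      have := congrFun hc i
      simp only [h0, ContactLoci.ac, Pi.smul_apply, Pi.zero_apply, map_zero, smul_zero] at this
      exact (FaithfulSMul.algebraMap_injective E E') (by rw [← this, Pi.zero_apply, map_zero])
    rw [this]; exact zero_mem _
  · obtain ⟨i0, hi⟩ := Function.ne_iff.1 h0
    refine Submodule.mem_span_singleton.2 ⟨v i0 / x a i0, ?_⟩
    have hi' : algebraMap E E' (x a i0) ≠ 0 := by simpa using hi
    have hc0 : c = algebraMap E E' (v i0 / x a i0) := by
      rw [map_div₀, eq_div_iff hi']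
      exact congrFun hc i0
    funext i
    apply FaithfulSMul.algebraMap_injective E E'
    have := congrFun hc i
    rw [hc0] at this
    simpa [ContactLoci.ac] using this
end BaseChange

section GenPts
variable {κ : Type*} [Fintype κ] {E : Type*} [Field E] [Algebra K E]

open MvPolynomial in
theorem mem_span_of_vanish {V : Set (κ → K)} (G : MvPolynomial κ E)
    (hG : ∀ u ∈ V, eval (fun i => algebraMap K E (u i)) G = 0) :
    G ∈ Submodule.span E ((map (algebraMap K E)) '' (vI V : Set (MvPolynomial κ K))) := by
  classical
  let b := Module.Basis.ofVectorSpace K E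
  let F := G.support.biUnion fun m => (b.repr (coeff m G)).support
  let Gt := fun t => ∑ m ∈ G.support, monomial m (b.repr (coeff m G) t)
  have hGt : ∀ t, Gt t ∈ vI V := by
    intro t u hu
    have h1 := congrArg (fun e => b.repr e t) (hG u hu)
    simp only [map_zero, Finsupp.coe_zero, Pi.zero_apply] at h1
    rw [← h1, eval_eq (fun i => algebraMap K E (u i)) G]
    have h2 : ∀ (s : Finset (κ →₀ ℕ)) (F : (κ →₀ ℕ) → E), b.repr (∑ m ∈ s, F m) t = ∑ m ∈ s, b.repr (F m) t := by
      intro s F; rw [map_sum, Finsupp.finset_sum_apply]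
    rw [h2]
    change eval u (∑ m ∈ G.support, _) = _
    rw [map_sum]
    refine Finset.sum_congr rfl fun m _ => ?_
    rw [eval_monomial, Finsupp.prod_fintype _ _ (by simp), ← Finset.prod_subset (Finset.subset_univ m.support)]
    · have : (∏ i ∈ m.support, algebraMap K E (u i) ^ m i) = algebraMap K E (∏ i ∈ m.support, u i ^ m i) := by
        simp
      rw [this, mul_comm (coeff m G), ← Algebra.smul_def, map_smul, Finsupp.smul_apply, smul_eq_mul, mul_comm]
    · intro i _ hi
      rw [Finsupp.notMem_support_iff.1 hi, pow_zero]
  have : G = ∑ t ∈ F, b t • map (algebraMap K E) (Gt t) := by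
    conv_lhs => rw [← support_sum_monomial_coeff G]
    simp only [Gt, map_sum, map_monomial, Finset.smul_sum, smul_monomial]
    rw [Finset.sum_comm]
    refine Finset.sum_congr rfl fun m hm => ?_
    rw [← map_sum]
    congr 1
    conv_lhs => rw [← b.linearCombination_repr (coeff m G)]
    rw [Finsupp.linearCombination_apply, Finsupp.sum_of_support_subset (s := F)]
    · exact Finset.sum_congr rfl fun t _ => by rw [Algebra.smul_def, smul_eq_mul, mul_comm]
    · exact Finset.subset_biUnion_of_mem (fun m => (b.repr (coeff m G)).support) hm
    · simp
  rw [this]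
  exact sum_mem fun t _ => Submodule.smul_mem _ _ (Submodule.subset_span ⟨_, hGt t, rfl⟩)

theorem dd_X (p v : κ → E) (i : κ) : dd p (MvPolynomial.X i : MvPolynomial κ K) v = v i := by
  classical
  unfold dd
  rw [Finset.sum_eq_single i]
  · simp
  · intro j _ hj; rw [MvPolynomial.pderiv_X_of_ne hj.symm]; simp
  · simp

open MvPolynomial in
theorem dd_map (p v : κ → E) (f : MvPolynomial κ K) :
    dd p (map (algebraMap K E) f) v = dd p f v := by
  unfold dd
  refine Finset.sum_congr rfl fun i _ => ?_
  rw [pderiv_map, aeval_map_algebraMap]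

/-- generic tuples -/
def GenT {α : Type*} (V : Set (κ → K)) (x : α → κ → E) : Prop :=
  Gen (pw α V) (fun p => x p.1 p.2)

variable {α : Type*}

open MvPolynomial in
theorem GenT.single_tangent [Fintype α] [DecidableEq α] {V : Set (κ → K)} {x : α → κ → E} (hx : GenT V x) (a : α)
    {v : κ → E} (hv : v ∈ tsp V (x a)) {g : MvPolynomial (α × κ) K} (hg : g ∈ vI (pw α V)) :
    dd (fun p => x p.1 p.2) g (fun p => if p.1 = a then v p.2 else 0) = 0 := by
  let s : α × κ → MvPolynomial κ E := fun p => if p.1 = a then X p.2 else C (x p.1 p.2)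
  have hs : ∀ g : MvPolynomial (α × κ) K, aeval (x a) (aeval s g : MvPolynomial κ E) = aeval (fun p => x p.1 p.2) g := by
    intro g
    induction g using MvPolynomial.induction_on with
    | C c => simp
    | add p q hp hq => simp only [map_add, hp, hq]
    | mul_X p i hp =>
      rw [map_mul, map_mul, hp, map_mul]
      congr 1
      simp only [aeval_X, s]
      split_ifs with h
      · rw [aeval_X, h]
      · simp
  have h1 : ∀ g : MvPolynomial (α × κ) K, dd (x a) (aeval s g : MvPolynomial κ E) v =
      dd (fun p => x p.1 p.2) g (fun p => if p.1 = a then v p.2 else 0) := by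
    intro g
    induction g using MvPolynomial.induction_on with
    | C c => simp [dd]
    | add p q hp hq => rw [map_add, dd_add_poly, dd_add_poly, hp, hq]
    | mul_X p i hp =>
      rw [map_mul, dd_mul_poly, dd_mul_poly, hp, hs]
      congr 1
      · congr 1
        simp only [aeval_X, s]
        split_ifs with h
        · rw [dd_X, dd_X, if_pos h]
        · rw [dd_X, if_neg h]; simp [dd]
      · rw [hs]
  rw [← h1]
  have h2 : (aeval s g : MvPolynomial κ E) ∈ Submodule.span E ((map (algebraMap K E)) '' (vI V : Set (MvPolynomial κ K))) := by
    refine mem_span_of_vanish _ fun u hu => ?_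
    let g' : MvPolynomial (α × κ) K := bind₁ (fun p => if p.1 = a then C (u p.2) else X p) g
    have hg' : g' ∈ vI (pw α V) := by
      intro z hz
      have : eval z g' = eval (fun p => if p.1 = a then u p.2 else z p) g := by
        rw [← aeval_eq_eval, ← aeval_eq_eval, aeval_bind₁]
        congr 1
        congr 1
        funext p
        split_ifs <;> simp
      rw [this]
      refine hg _ fun b => ?_
      by_cases h : b = a
      · simpa [h] using hu
      · simpa [h] using hz b
    have h3 := (hx g').2 hg'
    rw [← h3]
    change _ = aeval _ (bind₁ _ g)
    rw [aeval_bind₁]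
    clear hg hg' g' h3
    induction g using MvPolynomial.induction_on with
    | C c => simp
    | add p q hp hq => rw [map_add, map_add, map_add, hp, hq]
    | mul_X p i hp =>
      rw [map_mul, map_mul, map_mul, hp]
      congr 1
      simp only [aeval_X, s]
      split_ifs with h <;> simp
  generalize (aeval s g : MvPolynomial κ E) = G at h2
  induction h2 using Submodule.span_induction with
  | mem G h => obtain ⟨f, hf, rfl⟩ := h; rw [dd_map]; exact hv f hf
  | zero => simp [dd]
  | add p q _ _ hp hq => rw [dd_add_poly, hp, hq, add_zero]
  | smul c p _ hp => rw [dd_smul_poly, hp, smul_zero]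

theorem GenT.exists_dv [Fintype α] [CharZero E] {V : Set (κ → K)} {x : α → κ → E} (hx : GenT V x)
    {v : α → κ → E} (hv : ∀ a, v a ∈ tsp V (x a)) :
    ∃ δ : Derivation K E E, ∀ a, dv δ (x a) = v a := by
  classical
  obtain ⟨δ, hδ⟩ := Gen.exists_dv hx (v := fun p => v p.1 p.2) (by
    intro g hg
    have : (fun p : α × κ => v p.1 p.2) = ∑ a, (fun p : α × κ => if p.1 = a then v a p.2 else 0) := by
      funext p; rw [Finset.sum_apply]; simp
    rw [this]
    have hsum : ∀ s : Finset α, dd (fun p : α × κ => x p.1 p.2) g (∑ a ∈ s, (fun p : α × κ => if p.1 = a then v a p.2 else 0)) = 0 := by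
      intro s
      induction s using Finset.induction_on with
      | empty => simp [dd_zero]
      | insert a s ha ih => rw [Finset.sum_insert ha, dd_add, ih, hx.single_tangent a (hv a) hg, add_zero]
    exact hsum _)
  exact ⟨δ, fun a => funext fun i => congrFun hδ (a, i)⟩

open MvPolynomial in
theorem GenT.comp {β : Type*} {V : Set (κ → K)} (hV : V.Nonempty) {x : α → κ → E} (hx : GenT V x)
    {e : β → α} (he : Function.Injective e) : GenT V (fun b => x (e b)) := by
  intro g
  have h1 : aeval (fun p : β × κ => x (e p.1) p.2) g =
      aeval (fun p : α × κ => x p.1 p.2) (rename (Prod.map e id) g) := by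
    rw [aeval_rename]; rfl
  rw [h1, hx]
  obtain ⟨v0, hv0⟩ := hV
  constructor
  · intro h z hz
    classical
    have := h (fun p => Function.extend e (fun b i => z (b, i)) (fun _ => v0) p.1 p.2) (by
      intro a
      by_cases ha : ∃ b, e b = a
      · obtain ⟨b, rfl⟩ := ha
        simpa [he.extend_apply] using hz b
      · simpa [Function.extend_apply' _ _ _ ha] using hv0)
    rw [eval_rename] at this
    convert this using 3
    funext p
    simp [he.extend_apply]
  · intro h z hz
    rw [eval_rename]
    exact h _ fun b => hz (e b)

open MvPolynomial in
theorem GenT.gen {V : Set (κ → K)} (hV : V.Nonempty) {x : α → κ → E} (hx : GenT V x) (a : α) :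
    Gen V (x a) := by
  intro g
  have h1 : aeval (x a) g = aeval (fun p : α × κ => x p.1 p.2) (rename (Prod.mk a) g) := by
    rw [aeval_rename]; rfl
  rw [h1, hx]
  constructor
  · intro h v hv
    have := h (fun p => v p.2) (fun a => hv)
    rw [eval_rename] at this
    exact this
  · intro h z hz
    rw [eval_rename]
    exact h _ (hz a)

/-- the generic field -/
abbrev GFd {κ : Type*} (V : Set (κ → K)) [(vI V).IsPrime] : Type _ :=
  FractionRing (MvPolynomial κ K ⧸ vI V)

/-- the generic point -/
def gpt {κ : Type*} (V : Set (κ → K)) [(vI V).IsPrime] : κ → GFd V :=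
  fun i => algebraMap (MvPolynomial κ K ⧸ vI V) (GFd V) (Ideal.Quotient.mk _ (MvPolynomial.X i))

theorem aeval_gpt {κ : Type*} (V : Set (κ → K)) [(vI V).IsPrime] (g : MvPolynomial κ K) :
    MvPolynomial.aeval (gpt V) g =
      algebraMap (MvPolynomial κ K ⧸ vI V) (GFd V) (Ideal.Quotient.mk _ g) := by
  have : MvPolynomial.aeval (gpt V) =
    ((IsScalarTower.toAlgHom K (MvPolynomial κ K ⧸ vI V) (GFd V)).comp
      (Ideal.Quotient.mkₐ K (vI V))) := by
    apply MvPolynomial.algHom_ext; intro i; simp [gpt]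
  rw [this]; rfl

theorem gen_gpt {κ : Type*} (V : Set (κ → K)) [(vI V).IsPrime] : Gen V (gpt V) := by
  intro g
  rw [aeval_gpt, FaithfulSMul.algebraMap_eq_zero_iff, Ideal.Quotient.eq_zero_iff_mem]

theorem Gen.exists_hom {κ : Type*} {V : Set (κ → K)} [(vI V).IsPrime] {x : κ → E} (hx : Gen V x) :
    ∃ φ : GFd V →ₐ[K] E, ∀ i, φ (gpt V i) = x i := by
  let ψ : (MvPolynomial κ K ⧸ vI V) →ₐ[K] E :=
    Ideal.Quotient.liftₐ (vI V) (MvPolynomial.aeval x) (fun a ha => (hx a).2 ha)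
  have hψ : Function.Injective ψ := by
    rw [injective_iff_map_eq_zero]
    intro a ha
    obtain ⟨g, rfl⟩ := Ideal.Quotient.mk_surjective a
    exact Ideal.Quotient.eq_zero_iff_mem.2 ((hx g).1 ha)
  refine ⟨IsFractionRing.liftAlgHom hψ, fun i => ?_⟩
  rw [gpt, IsFractionRing.liftAlgHom_apply, IsFractionRing.lift_algebraMap]
  change MvPolynomial.aeval x _ = _
  simp

/-- Rational descent. -/
theorem span_constants (D : Set (Derivation K E E)) (W : Submodule E (κ → E))
    (hW : ∀ δ ∈ D, ∀ w ∈ W, dv δ w ∈ W) :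
    W ≤ Submodule.span E {w | w ∈ W ∧ ∀ δ ∈ D, dv δ w = 0} := by
  classical
  have key : ∀ (S : Finset κ) (W : Submodule E (κ → E)), (∀ δ ∈ D, ∀ w ∈ W, dv δ w ∈ W) →
      (∀ w ∈ W, ∀ i ∉ S, w i = 0) → W ≤ Submodule.span E {w | w ∈ W ∧ ∀ δ ∈ D, dv δ w = 0} := by
    intro S
    induction S using Finset.strongInduction with
    | H S ih =>
    intro W hW hS
    by_cases hbot : ∀ w ∈ W, w = 0
    · intro w hw; rw [hbot w hw]; exact zero_mem _
    push Not at hbot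
    obtain ⟨w, ⟨hw, hw0⟩, hmin⟩ := WellFounded.has_min
      (measure fun w : κ → E => (Finset.univ.filter fun i => w i ≠ 0).card).wf {w | w ∈ W ∧ w ≠ 0} hbot
    obtain ⟨i0, hi0⟩ := Function.ne_iff.1 hw0
    have hi0 : w i0 ≠ 0 := hi0
    let w1 := (w i0)⁻¹ • w
    have hw1 : w1 ∈ W := W.smul_mem _ hw
    have hw1i : w1 i0 = 1 := by simp [w1, hi0]
    have hconst : ∀ δ ∈ D, dv δ w1 = 0 := by
      intro δ hδ
      by_contra hne
      refine hmin (dv δ w1) ⟨hW δ hδ _ hw1, hne⟩ ?_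
      refine Finset.card_lt_card ?_
      rw [Finset.ssubset_iff_of_subset]
      · exact ⟨i0, by simpa using hi0, by rw [Finset.mem_filter, not_and, not_not]; intro _; simp [dv, hw1i]⟩
      · intro i hi
        simp only [Finset.mem_filter, Finset.mem_univ, true_and] at hi ⊢
        intro h; apply hi; simp [dv, w1, h]
    have hi0S : i0 ∈ S := by by_contra h; exact hi0 (hS w hw i0 h)
    let W' : Submodule E (κ → E) := W ⊓ LinearMap.ker (LinearMap.proj i0 : (κ → E) →ₗ[E] E)
    have hW'W : W' ≤ W := inf_le_left
    have h' := ih (S.erase i0) (Finset.erase_ssubset hi0S) W' (by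
        rintro δ hδ w ⟨h1, h2⟩
        refine ⟨hW δ hδ w h1, ?_⟩
        have h2 : w i0 = 0 := h2
        change δ (w i0) = 0
        rw [h2, map_zero]) (by
        rintro w ⟨h1, h2⟩ i hi
        by_cases h : i = i0
        · rw [h]; exact h2
        · exact hS w h1 i (fun h3 => hi (Finset.mem_erase.2 ⟨h, h3⟩)))
    intro z hz
    have hz' : z - z i0 • w1 ∈ W' :=
      ⟨W.sub_mem hz (W.smul_mem _ hw1), by
        change z i0 - z i0 * w1 i0 = 0
        rw [hw1i]; ring⟩
    have hz2 := Submodule.span_mono (t := {w | w ∈ W ∧ ∀ δ ∈ D, dv δ w = 0}) (fun w hw => (⟨hW'W hw.1, hw.2⟩ : w ∈ W ∧ ∀ δ ∈ D, dv δ w = 0)) (h' hz')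
    have := Submodule.add_mem _ hz2 (Submodule.smul_mem _ (z i0)
      (Submodule.subset_span (⟨hw1, hconst⟩ : w1 ∈ {w | w ∈ W ∧ ∀ δ ∈ D, dv δ w = 0})))
    simpa using this
  exact key Finset.univ W hW (fun w _ i hi => absurd (Finset.mem_univ i) hi)

theorem const_of_killed [IsAlgClosed K] [CharZero E] (c : E)
    (hc : ∀ δ : Derivation K E E, δ c = 0) : ∃ a : K, algebraMap K E a = c := by
  by_cases h : IsAlgebraic K c
  · have hi := h.isIntegral
    exact minpoly.mem_range_of_degree_eq_one K c
      (IsAlgClosed.degree_eq_one_of_irreducible K (minpoly.irreducible hi))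
  · exfalso
    have ht : AlgebraicIndependent K (fun _ : Unit => c) := by
      rw [algebraicIndependent_unique_type_iff]; exact h
    obtain ⟨δ, hδ⟩ := exists_derivation_of_tangent (K := K) (fun _ : Unit => c) (fun _ => 1) (by
      intro g hg
      rw [(algebraicIndependent_iff.1 ht) g hg]; simp [dd])
    have := congrFun hδ ()
    simp [dv, hc] at this

theorem stable_eq_top [IsAlgClosed K] [CharZero E] {V : Set (κ → K)}
    (hV : Submodule.span K V = ⊤) {x : κ → E} (hx : Gen V x) (M : Submodule E (κ → E))
    (hM : ∀ δ : Derivation K E E, ∀ w ∈ M, dv δ w ∈ M) (hxM : x ∈ M) : M = ⊤ := by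
  classical
  have h1 := span_constants (K := K) Set.univ M (fun δ _ => hM δ)
  let L : (κ → K) →ₗ[K] (κ → E) :=
    { toFun := fun u i => algebraMap K E (u i)
      map_add' := fun a b => by funext i; simp
      map_smul' := fun e a => by funext i; simp [Algebra.smul_def] }
  let W : Submodule K (κ → K) := (M.restrictScalars K).comap L
  by_cases hW : W = ⊤
  · rw [eq_top_iff]
    rintro z -
    have : z = ∑ i, z i • L (Pi.single i 1) := by
      funext j; rw [Finset.sum_apply]
      simp [L, Pi.single_apply]
    rw [this]
    refine sum_mem fun i _ => M.smul_mem _ ?_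
    have : Pi.single i 1 ∈ W := by rw [hW]; trivial
    exact this
  · exfalso
    obtain ⟨l, hl0, hl⟩ := Submodule.exists_le_ker_of_lt_top W (lt_top_iff_ne_top.2 hW)
    have hlsum : ∀ u, l u = ∑ i, l (Pi.single i 1) * u i := by
      intro u
      conv_lhs => rw [← Finset.univ_sum_single u, map_sum]
      refine Finset.sum_congr rfl fun i _ => ?_
      have : (Pi.single i (u i) : κ → K) = u i • Pi.single i 1 := by
        rw [← Pi.single_smul, smul_eq_mul, mul_one]
      rw [this, map_smul, smul_eq_mul, mul_comm]
    let lE : (κ → E) →ₗ[E] E := ∑ i, algebraMap K E (l (Pi.single i 1)) • LinearMap.proj i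
    have hlE : ∀ z, lE z = ∑ i, algebraMap K E (l (Pi.single i 1)) * z i := by
      intro z; simp [lE, Algebra.smul_def]
    have h2 : M ≤ LinearMap.ker lE := by
      refine h1.trans (Submodule.span_le.2 ?_)
      rintro w ⟨hw, hw'⟩
      have : ∀ i, ∃ a : K, algebraMap K E a = w i := fun i =>
        const_of_killed _ fun δ => congrFun (hw' δ trivial) i
      choose u hu using this
      have hLu : L u = w := funext hu
      have huW : u ∈ W := by change L u ∈ M; rwa [hLu]
      have h3 : l u = 0 := hl huW
      change lE w = 0
      rw [hlE, ← hLu]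
      have := congrArg (algebraMap K E) (hlsum u)
      rw [h3, map_zero, map_sum] at this
      rw [this]
      exact Finset.sum_congr rfl fun i _ => by rw [map_mul]; rfl
    have h3 : lE x = 0 := h2 hxM
    rw [hlE] at h3
    have h4 := (hx (∑ i, MvPolynomial.C (l (Pi.single i 1)) * MvPolynomial.X i)).1 (by
      simpa using h3)
    have h5 : (⊤ : Submodule K (κ → K)) ≤ LinearMap.ker l := by
      rw [← hV, Submodule.span_le]
      intro u hu
      change l u = 0
      rw [hlsum]
      simpa using h4 u hu
    exact hl0 (LinearMap.ext fun u => h5 trivial)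
end GenPts

section Chain
variable {κ : Type*} [Fintype κ] {E : Type*} [Field E] [Algebra K E] {α : Type*}

theorem Msp_inter {V : Set (κ → K)} {x : α → κ → E} (hind : iSupIndep fun a => tsp V (x a))
    (A B : Set α) : Msp V x A ⊓ Msp V x B ≤ Msp V x (A ∩ B) := by
  have h1 : Msp V x A ≤ Msp V x (A ∩ B) ⊔ Msp V x (A \ B) := by
    refine iSup₂_le fun b hb => ?_
    by_cases h : b ∈ B
    · exact le_sup_of_le_left (tsp_le_Msp (x := x) (A := A ∩ B) (a := b) ⟨hb, h⟩)
    · exact le_sup_of_le_right (tsp_le_Msp (x := x) (A := A \ B) (a := b) ⟨hb, h⟩)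
  have h2 : Disjoint (Msp V x (A \ B)) (Msp V x B) :=
    hind.disjoint_biSup_biSup Set.disjoint_sdiff_left
  calc Msp V x A ⊓ Msp V x B ≤ (Msp V x (A ∩ B) ⊔ Msp V x (A \ B)) ⊓ Msp V x B :=
        inf_le_inf_right _ h1
    _ = Msp V x (A ∩ B) ⊔ Msp V x (A \ B) ⊓ Msp V x B :=
        sup_inf_assoc_of_le _ (Msp_mono Set.inter_subset_right)
    _ = Msp V x (A ∩ B) := by rw [h2.eq_bot, sup_bot_eq]

theorem Msp_univ_stable {V : Set (κ → K)} {x : α → κ → E} {M : Submodule E (κ → E)}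
    (δ : Derivation K E E) {A : Set α} (h : ∀ a ∈ A, ∀ w ∈ tsp V (x a), dv δ w ∈ M)
    (hAM : Msp V x A ≤ M) {w : κ → E} (hw : w ∈ Msp V x A) : dv δ w ∈ M := by
  have : Msp V x A ≤ M ⊓ Msp V x A := by
    refine le_inf hAM le_rfl
  let N : Submodule E (κ → E) :=
    { carrier := {w | w ∈ M ∧ dv δ w ∈ M}
      add_mem' := by
        rintro a b ⟨ha, ha'⟩ ⟨hb, hb'⟩
        refine ⟨M.add_mem ha hb, ?_⟩
        have : dv δ (a + b) = dv δ a + dv δ b := by funext i; simp [dv]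
        rw [this]; exact M.add_mem ha' hb'
      zero_mem' := ⟨M.zero_mem, by
        have : dv δ (0 : κ → E) = 0 := by funext i; simp [dv]
        rw [this]; exact M.zero_mem⟩
      smul_mem' := by
        rintro c a ⟨ha, ha'⟩
        refine ⟨M.smul_mem _ ha, ?_⟩
        have : dv δ (c • a) = c • dv δ a + δ c • a := by
          funext i; simp [dv, mul_comm]
        rw [this]; exact M.add_mem (M.smul_mem _ ha') (M.smul_mem _ ha) }
  have hN : Msp V x A ≤ N := iSup₂_le fun a ha w hw => ⟨hAM (tsp_le_Msp ha hw), h a ha w hw⟩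
  exact (hN hw).2

theorem chain [IsAlgClosed K] [CharZero E] [Fintype α] {V : Set (κ → K)}
    (hVc : ∀ v ∈ V, ∀ c : K, c • v ∈ V)
    (hVn : V.Nonempty) (hV : Submodule.span K V = ⊤) {x : α → κ → E} (hx : GenT V x)
    (hx0 : ∀ a, x a ≠ 0)
    (hind : iSupIndep fun a => tsp V (x a)) (n k : ℕ) (hn : 1 ≤ n) (hk : 1 ≤ k)
    (hcard : Fintype.card α + 1 = k + n)
    (hT : ∀ a, Module.finrank E (tsp V (x a)) ≤ n + 1)
    (hF : ∀ a, ctc V (x a) (tsp V (x a)) ≤ Submodule.span E {x a})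
    (htop : Msp V x Set.univ ≠ ⊤) :
    ∃ (A : Finset α) (a : α), A.card = k ∧ a ∈ A ∧ Qc V x (A : Set α) a := by
  classical
  have : Infinite K := IsAlgClosed.instInfinite
  by_contra hcon
  push Not at hcon
  have hgen : ∀ a, Gen V (x a) := hx.gen hVn
  have key : ∀ m, k ≤ m → ∀ (A : Finset α) (a : α), A.card = m → a ∈ A →
      2 + m ≤ Module.finrank E (ctc V (x a) (Msp V x (A : Set α))) + k := by
    intro m hm
    induction m, hm using Nat.le_induction with
    | base =>
      intro A a hA ha
      have h1 := hcon A a hA ha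
      have hlt : Submodule.span E {x a} < ctc V (x a) (Msp V x (A : Set α)) := by
        refine lt_of_le_not_ge ?_ h1
        rw [Submodule.span_singleton_le_iff_mem]
        exact self_mem_ctc hVc (fun f hf => (hgen a f).2 hf) _
      have := Submodule.finrank_lt_finrank_of_lt hlt
      rw [finrank_span_singleton (hx0 a)] at this
      omega
    | succ m hm ih =>
      intro A a hA ha
      by_contra hlt
      have heq : ∀ i ∈ A.erase a, ctc V (x a) (Msp V x (A : Set α)) =
          ctc V (x a) (Msp V x ((A.erase i : Finset α) : Set α)) := by
        intro i hi
        obtain ⟨hia, hiA⟩ := Finset.mem_erase.1 hi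
        symm
        refine Submodule.eq_of_le_of_finrank_le (ctc_mono _ _ (Msp_mono ?_)) ?_
        · exact_mod_cast Finset.erase_subset i A
        · have := ih (A.erase i) a (by rw [Finset.card_erase_of_mem hiA, hA]; rfl)
            (Finset.mem_erase.2 ⟨hia.symm, ha⟩)
          omega
      have hne : (A.erase a).Nonempty := by
        rw [← Finset.card_pos, Finset.card_erase_of_mem ha]; omega
      obtain ⟨i0, hi0⟩ := hne
      have hle : ctc V (x a) (Msp V x (A : Set α)) ≤ Submodule.span E {x a} := by
        refine le_trans ?_ (hF a)
        intro v hv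
        obtain ⟨δ, rfl⟩ := (hgen a).exists_dv hv.1
        refine mem_ctc_of_dv δ hv.1 fun w hw => ?_
        have hall : ∀ i ∈ A.erase a, dv δ w ∈ Msp V x ((A.erase i : Finset α) : Set α) := by
          intro i hi
          obtain ⟨hia, hiA⟩ := Finset.mem_erase.1 hi
          rw [heq i hi] at hv
          refine dv_mem_of_ctc (tsp_le_Msp ?_) δ hv hw
          exact_mod_cast Finset.mem_erase.2 ⟨hia.symm, ha⟩
        have hS : ∀ S : Finset α, S ⊆ A.erase a → S.Nonempty →
            dv δ w ∈ Msp V x ((A : Set α) \ S) := by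
          intro S
          induction S using Finset.induction_on with
          | empty => intro _ h; simp at h
          | insert i S hi ih2 =>
            intro hS _
            have h1 := hall i (hS (Finset.mem_insert_self i S))
            by_cases hSe : S.Nonempty
            · have h2 := ih2 (fun j hj => hS (Finset.mem_insert_of_mem hj)) hSe
              refine Msp_mono ?_ (Msp_inter hind _ _ ⟨h1, h2⟩)
              intro j hj
              simp at hj ⊢; tauto
            · rw [Finset.not_nonempty_iff_eq_empty] at hSe
              subst hSe
              refine Msp_mono ?_ h1
              intro j hj
              simp at hj ⊢; tauto
        have := hS (A.erase a) (Finset.Subset.refl _) ⟨i0, hi0⟩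
        have h3 : Msp V x ((A : Set α) \ (A.erase a : Finset α)) ≤ tsp V (x a) := by
          refine iSup₂_le fun b hb => ?_
          simp at hb
          rw [show b = a by tauto]
        exact h3 this
      have h1 := Submodule.finrank_mono hle
      rw [finrank_span_singleton (hx0 a), heq i0 hi0] at h1
      have := ih (A.erase i0) a (by rw [Finset.card_erase_of_mem (Finset.mem_of_mem_erase hi0), hA]; rfl)
            (Finset.mem_erase.2 ⟨(Finset.ne_of_mem_erase hi0).symm, ha⟩)
      omega
  have hC : ∀ a, ctc V (x a) (Msp V x Set.univ) = tsp V (x a) := by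
    intro a
    refine Submodule.eq_of_le_of_finrank_le (ctc_le_tsp _ _ _) ?_
    have := key (Fintype.card α) (by omega) Finset.univ a rfl (Finset.mem_univ a)
    rw [Finset.coe_univ] at this
    have := hT a
    omega
  have hα : 0 < Fintype.card α := by omega
  obtain ⟨a0⟩ := Fintype.card_pos_iff.1 hα
  refine htop (stable_eq_top hV (hgen a0) _ (fun δ w hw => ?_)
    (tsp_le_Msp (Set.mem_univ a0) (self_mem_tsp hVc fun f hf => (hgen a0 f).2 hf)))
  refine Msp_univ_stable δ (fun a _ w hw => ?_) le_rfl hw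
  refine dv_mem_of_ctc (tsp_le_Msp (Set.mem_univ a)) δ ?_ hw
  rw [hC a]; exact (hgen a).dv_mem δ
end Chain

section LineThm
variable {κ : Type*} [Fintype κ] {E : Type*} [Field E] [Algebra K E]

theorem dv_bracket (δ ε : Derivation K E E) (z : κ → E) :
    dv δ (dv ε z) = dv ε (dv δ z) + dv ⁅δ, ε⁆ z := by
  funext i; simp [dv, Derivation.commutator_apply]

theorem ctc_stable [CharZero E] {V : Set (κ → K)} {x : κ → E} (hx : Gen V x)
    (δ : Derivation K E E) (hδ : ∀ w ∈ tsp V x, dv δ w ∈ tsp V x) {w : κ → E}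
    (hw : w ∈ ctc V x (tsp V x)) : dv δ w ∈ ctc V x (tsp V x) := by
  obtain ⟨δ', rfl⟩ := hx.exists_dv hw.1
  have hδ' : ∀ w ∈ tsp V x, dv δ' w ∈ tsp V x := fun w h => dv_mem_of_ctc le_rfl δ' hw h
  have h1 : dv δ (dv δ' x) ∈ tsp V x := hδ _ hw.1
  obtain ⟨η, hη⟩ := hx.exists_dv h1
  rw [← hη]
  refine mem_ctc_of_dv η (by rw [hη]; exact h1) fun u hu => ?_
  obtain ⟨ε, rfl⟩ := hx.exists_dv hu
  rw [dv_bracket, hη]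
  refine add_mem ?_ (hx.dv_mem _)
  rw [dv_bracket ε δ]
  refine add_mem (hδ _ ?_) ?_
  · rw [dv_bracket ε δ']
    exact add_mem (hδ' _ hu) (hx.dv_mem _)
  · rw [dv_bracket _ δ']
    exact add_mem (hδ' _ (hx.dv_mem _)) (hx.dv_mem _)

theorem exists_straight [CharZero E] {V : Set (κ → K)} {x : κ → E} (hx : Gen V x)
    (h : ¬ ctc V x (tsp V x) ≤ Submodule.span E {x}) :
    ∃ (δ : Derivation K E E) (w : κ → E), w ∉ Submodule.span E {x} ∧ dv δ x = w ∧ dv δ w = 0 := by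
  have h1 := span_constants (K := K) {δ : Derivation K E E | ∀ w ∈ tsp V x, dv δ w ∈ tsp V x}
    (ctc V x (tsp V x)) (fun δ hδ w hw => ctc_stable hx δ hδ hw)
  have : ∃ w, (w ∈ ctc V x (tsp V x) ∧ ∀ δ ∈ {δ : Derivation K E E | ∀ w ∈ tsp V x, dv δ w ∈ tsp V x},
      dv δ w = 0) ∧ w ∉ Submodule.span E {x} := by
    by_contra hcon
    push Not at hcon
    exact h (h1.trans (Submodule.span_le.2 fun w hw => hcon w hw))
  obtain ⟨w, ⟨hw, hc⟩, hw'⟩ := this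
  obtain ⟨δ, hδ⟩ := hx.exists_dv hw.1
  refine ⟨δ, w, hw', hδ, hc δ fun u hu => ?_⟩
  refine dv_mem_of_ctc le_rfl δ (by rw [hδ]; exact hw) hu

open Polynomial in
theorem straight_vanish [CharZero E] {V : Set (κ → K)} {x w : κ → E} (hx : Gen V x)
    (δ : Derivation K E E) (h1 : dv δ x = w) (h2 : dv δ w = 0) (f : MvPolynomial κ K) (hf : f ∈ vI V)
    (e : E) : MvPolynomial.aeval (x + e • w) f = 0 := by
  let P : MvPolynomial κ K → E[X] := fun f => MvPolynomial.aeval (fun i => C (x i) + X * C (w i)) f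
  have hP : ∀ (f : MvPolynomial κ K) (k : ℕ), δ ((P f).coeff k) = (P f).coeff (k + 1) * (k + 1) := by
    intro f
    induction f using MvPolynomial.induction_on with
    | C c =>
      intro k
      have : P (MvPolynomial.C c) = C (algebraMap K E c) := by simp [P]
      rw [this, coeff_C, coeff_C]
      split_ifs <;> simp_all
    | add p q hp hq =>
      intro k
      have : P (p + q) = P p + P q := map_add _ _ _
      rw [this, coeff_add, coeff_add, map_add, hp, hq, add_mul]
    | mul_X p i hp =>
      have : P (p * MvPolynomial.X i) = P p * C (x i) + P p * X * C (w i) := by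
        simp only [P, map_mul, MvPolynomial.aeval_X]; ring
      have hxi : δ (x i) = w i := congrFun h1 i
      have hwi : δ (w i) = 0 := congrFun h2 i
      rintro (_ | k)
      · simp [this, hp, hxi, hwi]; ring
      · simp [this, hp, hxi, hwi]; ring
  have h0 : ∀ k, (P f).coeff k = 0 := by
    intro k
    induction k with
    | zero =>
      have : (P f).coeff 0 = MvPolynomial.aeval x f := by
        rw [coeff_zero_eq_eval_zero]
        change Polynomial.aeval (0 : E) (MvPolynomial.aeval _ f) = _
        have := MvPolynomial.comp_aeval_apply (fun i => C (x i) + X * C (w i))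
          ((Polynomial.aeval (0 : E)).restrictScalars K : E[X] →ₐ[K] E) f
        simpa using this
      rw [this]; exact (hx f).2 hf
    | succ k ih =>
      have := hP f k
      rw [ih, map_zero] at this
      exact (mul_eq_zero.1 this.symm).resolve_right (by exact_mod_cast Nat.succ_ne_zero k)
  have h3 : P f = 0 := by ext k; simp [h0]
  have := MvPolynomial.comp_aeval_apply (fun i => C (x i) + X * C (w i))
          ((Polynomial.aeval (e : E)).restrictScalars K : E[X] →ₐ[K] E) f
  change Polynomial.aeval e (P f) = _ at this
  rw [h3, map_zero] at this
  rw [this]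
  congr 2
  funext i; simp; ring

theorem exists_clear {κ β : Type*} [Finite β] (V : Set (κ → K)) [(vI V).IsPrime] (z : β → GFd V) :
    ∃ (D : MvPolynomial κ K) (N : β → MvPolynomial κ K), D ∉ vI V ∧
      ∀ i, MvPolynomial.aeval (gpt V) D * z i = MvPolynomial.aeval (gpt V) (N i) := by
  obtain ⟨b, hb⟩ := IsLocalization.exist_integer_multiples_of_finite
    (nonZeroDivisors (MvPolynomial κ K ⧸ vI V)) z
  obtain ⟨D, hD⟩ := Ideal.Quotient.mk_surjective (b : MvPolynomial κ K ⧸ vI V)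
  choose c hc using hb
  choose N hN using fun i => Ideal.Quotient.mk_surjective (I := vI V) (c i)
  refine ⟨D, N, ?_, fun i => ?_⟩
  · rw [← Ideal.Quotient.eq_zero_iff_mem, hD]
    exact nonZeroDivisors.ne_zero b.2
  · rw [aeval_gpt, aeval_gpt, hN, hc, hD, Algebra.smul_def]

end LineThm

/-- linear subspaces -/
def plin (W : Submodule K (ι → K)) : Set (PP K ι) := {y | y.submodule ≤ W}

theorem plin_iff {W : Submodule K (ι → K)} {y : PP K ι} : y ∈ plin W ↔ y.rep ∈ W := by
  constructor
  · intro h; exact h (rep_mem_submodule y)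
  · intro h v hv
    obtain ⟨c, rfl⟩ := mem_submodule_iff.1 hv
    exact W.smul_mem _ h

theorem vspan_plin (W : Submodule K (ι → K)) : vspan (plin W) = W := by
  apply le_antisymm
  · rw [vspan, Submodule.span_le]
    intro v hv
    obtain ⟨y, hy, hv⟩ := mem_coneOf.1 hv
    exact hy hv
  · intro v hv
    by_cases h0 : v = 0
    · rw [h0]; exact zero_mem _
    refine Submodule.subset_span ((mem_coneOf_iff h0).2 ?_)
    change (Projectivization.mk K _ _).submodule ≤ _
    rw [Projectivization.submodule_mk, Submodule.span_singleton_le_iff_mem]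
    exact hv

theorem isLine_plin {p q : ι → K} (h : LinearIndependent K ![p, q]) :
    IsLine (plin (Submodule.span K {p, q})) := by
  refine ⟨?_, ?_⟩
  · change plin _ = projSpan _
    rw [projSpan, vspan_plin]; rfl
  · rw [vspan_plin]
    have := finrank_span_eq_card h
    have h2 : Set.range ![p, q] = {p, q} := by simp [Matrix.range_cons, Matrix.range_empty, Set.pair_comm]
    rw [h2] at this
    simpa using this

open MvPolynomial in
theorem uniruled_of_ctc [IsAlgClosed K] [CharZero K] {X : Set (PP K ι)} (hX : IsIntegralVariety X)
    [(vI (coneOf X)).IsPrime]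
    (h : ¬ ctc (coneOf X) (gpt (coneOf X)) (tsp (coneOf X) (gpt (coneOf X))) ≤
      Submodule.span _ {gpt (coneOf X)}) : UniruledByLines X := by
  have : Infinite K := IsAlgClosed.instInfinite
  have : CharZero (GFd (coneOf X)) := charZero_of_injective_algebraMap (algebraMap K _).injective
  set V := coneOf X with hV
  obtain ⟨δ, w, hw, h1, h2⟩ := exists_straight (gen_gpt V) h
  obtain ⟨D, N, hD, hN⟩ := exists_clear V w
  have hD0 : aeval (gpt V) D ≠ 0 := fun h => hD ((gen_gpt V D).1 h)
  have hex : ∃ i j, (MvPolynomial.X i * N j - MvPolynomial.X j * N i : MvPolynomial ι K) ∉ vI V := by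
    by_contra hcon
    push Not at hcon
    have hz : ∀ i j, gpt V i * w j = gpt V j * w i := by
      intro i j
      have := (gen_gpt V _).2 (hcon i j)
      rw [map_sub, map_mul, map_mul, aeval_X, aeval_X, ← hN, ← hN, sub_eq_zero] at this
      apply mul_left_cancel₀ hD0
      linear_combination this
    by_cases hx0 : gpt V = 0
    · apply hw
      rw [← h1, hx0]
      have : dv δ (0 : ι → GFd V) = 0 := by funext i; simp [dv]
      rw [this]; exact zero_mem _
    · obtain ⟨i, hi⟩ := Function.ne_iff.1 hx0
      apply hw
      rw [Submodule.mem_span_singleton]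
      refine ⟨w i / gpt V i, ?_⟩
      have hi : gpt V i ≠ 0 := hi
      funext j
      simp only [Pi.smul_apply, smul_eq_mul]
      rw [div_mul_eq_mul_div, div_eq_iff hi]
      linear_combination -(hz i j)
  obtain ⟨i, j, hij⟩ := hex
  refine ⟨zeroLocus {MvPolynomial.X i * N j - MvPolynomial.X j * N i}, isZClosed_zeroLocus _, ?_, ?_⟩
  · rw [zeroLocus_iff]; exact hij
  rintro x ⟨hxX, hxY⟩
  have : ∃ p ∈ x.submodule, eval p (MvPolynomial.X i * N j - MvPolynomial.X j * N i : MvPolynomial ι K) ≠ 0 := by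
    by_contra hcon
    push Not at hcon
    exact hxY (by rintro f rfl; exact hcon)
  obtain ⟨p, hpx, hp⟩ := this
  have hpV : p ∈ V := mem_coneOf.2 ⟨x, hxX, hpx⟩
  let q : ι → K := fun i => eval p (N i)
  have hvan : ∀ f ∈ vI V, ∀ t : K, eval (p + t • q) f = 0 := by
    intro f hf t
    let f' : MvPolynomial ι K := bind₁ (fun i => MvPolynomial.X i + C t * N i) f
    have hf' : f' ∈ vI V := by
      rw [← gen_gpt V]
      change aeval _ (bind₁ _ f) = 0
      rw [aeval_bind₁]
      have := straight_vanish (gen_gpt V) δ h1 h2 f hf (algebraMap K _ t * aeval (gpt V) D)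
      rw [← this]
      congr 2
      funext i
      simp [← hN]; ring
    have := hf' p hpV
    rw [← this]
    change _ = eval p (bind₁ _ f)
    rw [← aeval_eq_eval, ← aeval_eq_eval, aeval_bind₁]
    congr 2
    funext i; simp [q]
  have hvan2 : ∀ f ∈ vI V, eval q f = 0 := by
    intro f hf
    let P : Polynomial K := aeval (fun i => Polynomial.C (p i) * Polynomial.X + Polynomial.C (q i)) f
    have hPe : ∀ s, P.eval s = eval (s • p + q) f := by
      intro s
      have := comp_aeval_apply (fun i => Polynomial.C (p i) * Polynomial.X + Polynomial.C (q i))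
        (Polynomial.aeval s : Polynomial K →ₐ[K] K) f
      change Polynomial.eval s P = _ at this
      rw [this, ← aeval_eq_eval]
      congr 2
      funext i; simp; ring
    have hP0 : P = 0 := by
      refine Polynomial.eq_zero_of_infinite_isRoot P (Set.Infinite.mono (s := {s : K | s ≠ 0}) ?_ ?_)
      · intro s hs
        change P.eval s = 0
        have hs : s ≠ 0 := hs
        have : s • p + q = s • (p + s⁻¹ • q) := by
          rw [smul_add, smul_smul, mul_inv_cancel₀ hs, one_smul]
        rw [hPe, this]
        let f' : MvPolynomial ι K := bind₁ (fun i => C s * MvPolynomial.X i) f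
        have hf'e : ∀ z, eval z f' = eval (s • z) f := by
          intro z
          change eval z (bind₁ _ f) = _
          rw [← aeval_eq_eval, ← aeval_eq_eval, aeval_bind₁]
          congr 2
          funext i; simp
        have hf' : f' ∈ vI V := by
          intro z hz
          rw [hf'e]; exact hf _ (coneOf_smul s hz)
        rw [← hf'e]; exact hvan f' hf' _
      · exact Set.Infinite.mono (s := ({0} : Set K)ᶜ) (fun s hs => hs) (Set.Finite.infinite_compl (Set.finite_singleton 0))
    have := hPe 0
    rw [hP0] at this
    simpa using this.symm
  have hmem : ∀ v, (∀ f ∈ vI V, eval v f = 0) → v ∈ V := by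
    intro v hv
    by_cases h0 : v = 0
    · rw [h0]; exact zero_mem_coneOf ⟨x, hxX⟩
    · rw [hV, mem_coneOf_iff h0]; exact mem_of_closed hX.1 h0 hv
  have hli : LinearIndependent K ![p, q] := by
    rw [LinearIndependent.pair_iff]
    intro s t hst
    have hi := congrFun hst i
    have hj := congrFun hst j
    simp only [Pi.add_apply, Pi.smul_apply, smul_eq_mul, Pi.zero_apply] at hi hj
    have hp' : p i * q j - p j * q i ≠ 0 := by simpa [q] using hp
    constructor
    · have h1 : s * (p i * q j - p j * q i) = 0 := by linear_combination q j * hi - q i * hj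
      exact (mul_eq_zero.1 h1).resolve_right hp'
    · have h1 : t * (p i * q j - p j * q i) = 0 := by linear_combination p i * hj - p j * hi
      exact (mul_eq_zero.1 h1).resolve_right hp'
  refine ⟨_, isLine_plin hli, ?_, ?_⟩
  · have hp0 : p ≠ 0 := by intro h0; simpa using hli.ne_zero 0 (by simpa using h0)
    rw [← eq_mk_of_mem hpx hp0]
    change (Projectivization.mk K _ _).submodule ≤ _
    rw [Projectivization.submodule_mk, Submodule.span_singleton_le_iff_mem]
    exact Submodule.subset_span (by simp)
  · intro y hy
    have hy := plin_iff.1 hy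
    obtain ⟨s, t, hst⟩ := Submodule.mem_span_pair.1 hy
    have hyV : y.rep ∈ V := by
      rw [← hst]
      by_cases hs : s = 0
      · rw [hs, zero_smul, zero_add]
        exact coneOf_smul t (hmem q hvan2)
      · have : s • p + t • q = s • (p + (s⁻¹ * t) • q) := by
          rw [smul_add, smul_smul, ← mul_assoc, mul_inv_cancel₀ hs, one_mul]
        rw [this]
        exact coneOf_smul s (hmem _ fun f hf => hvan f hf _)
    rw [hV, mem_coneOf_iff y.rep_nonzero, Projectivization.mk_rep] at hyV
    exact hyV

section Dimn
variable {κ : Type*} [Fintype κ] {E : Type*} [Field E] [Algebra K E]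

/-- algebraically independent elements modulo an ideal -/
def Ind {R : Type*} [CommRing R] [Algebra K R] (P : Ideal R) (m : ℕ) : Prop :=
  ∃ g : Fin m → R, ∀ G : MvPolynomial (Fin m) K, MvPolynomial.aeval g G ∈ P → G = 0

theorem Ind.mono {R : Type*} [CommRing R] [Algebra K R] {P P' : Ideal R} (h : P ≤ P') {m : ℕ}
    (hi : Ind (K := K) P' m) : Ind (K := K) P m := by
  obtain ⟨g, hg⟩ := hi
  exact ⟨g, fun G hG => hg G (h hG)⟩

theorem eval_finSucc {R : Type*} [CommRing R] [Algebra K R] {m : ℕ} (g : Fin m → R) (t : R)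
    (G : MvPolynomial (Fin (m + 1)) K) :
    Polynomial.eval₂ (MvPolynomial.aeval (R := K) g : MvPolynomial (Fin m) K →ₐ[K] R).toRingHom t
      (MvPolynomial.finSuccEquiv K m G) = MvPolynomial.aeval (Fin.cons t g : Fin (m + 1) → R) G := by
  induction G using MvPolynomial.induction_on with
  | C c =>
    have h := (MvPolynomial.finSuccEquiv K m).commutes c
    rw [MvPolynomial.algebraMap_eq] at h
    rw [h, MvPolynomial.aeval_C]
    have h2 : algebraMap K (Polynomial (MvPolynomial (Fin m) K)) c = Polynomial.C (MvPolynomial.C c) := rfl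
    rw [h2, Polynomial.eval₂_C]
    simp
  | add p q hp hq => rw [map_add, Polynomial.eval₂_add, hp, hq, map_add]
  | mul_X p i hp =>
    rw [map_mul, Polynomial.eval₂_mul, hp, map_mul, MvPolynomial.aeval_X]
    congr 1
    refine Fin.cases ?_ (fun j => ?_) i
    · rw [MvPolynomial.finSuccEquiv_X_zero, Polynomial.eval₂_X]; rfl
    · rw [MvPolynomial.finSuccEquiv_X_succ, Polynomial.eval₂_C]; simp

theorem Ind.drop {R : Type*} [CommRing R] [Algebra K R] {P P' : Ideal R} [hP : P.IsPrime]
    (h : P < P') {m : ℕ} (hi : Ind (K := K) P' m) : Ind (K := K) P (m + 1) := by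
  obtain ⟨g, hg⟩ := hi
  obtain ⟨hle, t, ht', ht⟩ := SetLike.lt_iff_le_and_exists.1 h
  refine ⟨Fin.cons t g, fun G hG => ?_⟩
  have key : ∀ (d : ℕ) (p : Polynomial (MvPolynomial (Fin m) K)), p.natDegree ≤ d →
      Polynomial.eval₂ (MvPolynomial.aeval (R := K) g : MvPolynomial (Fin m) K →ₐ[K] R).toRingHom t p ∈ P → p = 0 := by
    intro d
    induction d with
    | zero =>
      intro p hp hpP
      rw [Polynomial.eq_C_of_natDegree_le_zero hp] at hpP ⊢
      rw [Polynomial.eval₂_C] at hpP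
      rw [hg _ (hle hpP), map_zero]
    | succ d ih =>
      intro p hp hpP
      rw [← Polynomial.divX_mul_X_add p, Polynomial.eval₂_add, Polynomial.eval₂_mul,
        Polynomial.eval₂_X, Polynomial.eval₂_C] at hpP
      have h0 : p.coeff 0 = 0 := by
        apply hg
        have := P'.sub_mem (hle hpP) (P'.mul_mem_left (Polynomial.eval₂
          (MvPolynomial.aeval (R := K) g : MvPolynomial (Fin m) K →ₐ[K] R).toRingHom t p.divX) ht')
        rw [add_sub_cancel_left] at this
        exact this
      rw [h0, map_zero, add_zero] at hpP
      have := ih p.divX (by rw [Polynomial.natDegree_divX_eq_natDegree_tsub_one]; omega)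
        ((hP.mem_or_mem hpP).resolve_right ht)
      rw [← Polynomial.divX_mul_X_add p, this, h0]; simp
  have h1 := key _ (MvPolynomial.finSuccEquiv K m G) le_rfl ?_
  · exact (MvPolynomial.finSuccEquiv K m).injective (by rw [h1, map_zero])
  · rw [eval_finSucc]; exact hG

theorem Ind.of_le {R : Type*} [CommRing R] [Algebra K R] {P : Ideal R} {m m' : ℕ} (h : m' ≤ m)
    (hi : Ind (K := K) P m) : Ind (K := K) P m' := by
  obtain ⟨g, hg⟩ := hi
  refine ⟨fun i => g (Fin.castLE h i), fun G hG => ?_⟩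
  apply MvPolynomial.rename_injective _ (Fin.castLE_injective h)
  rw [map_zero]
  apply hg
  rw [MvPolynomial.aeval_rename]
  exact hG

theorem Ind.le_finrank [CharZero E] [Infinite K] {V : Set (κ → K)} {x : κ → E} (hx : Gen V x) {m : ℕ}
    (hi : Ind (K := K) (vI V) m) : m ≤ Module.finrank E (tsp V x) := by
  obtain ⟨g, hg⟩ := hi
  let Φ : tsp V x →ₗ[E] (Fin m → E) :=
    { toFun := fun v j => dd x (g j) v.1
      map_add' := fun v w => by funext j; simp [dd_add]
      map_smul' := fun c v => by funext j; simp [dd_smul] }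
  have hsurj : Function.Surjective Φ := by
    intro w
    obtain ⟨δ, hδ⟩ := exists_derivation_of_tangent (K := K) (fun j => MvPolynomial.aeval x (g j)) w (by
      intro G hG
      have : G = 0 := by
        apply hg
        rw [← hx, ← hG]
        exact MvPolynomial.comp_aeval_apply g (MvPolynomial.aeval x) G
      rw [this]; simp [dd])
    refine ⟨⟨dv δ x, hx.dv_mem δ⟩, ?_⟩
    rw [← hδ]
    funext j
    exact (deriv_aeval δ x (g j)).symm
  have := LinearMap.finrank_le_finrank_of_injective (f := Φ.dualMap) (LinearMap.dualMap_injective_of_surjective hsurj)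
  simpa [Subspace.dual_finrank_eq] using this

theorem finrank_range_le_of_ker_le {M N N' : Type*} [AddCommGroup M] [Module E M] [AddCommGroup N]
    [Module E N] [AddCommGroup N'] [Module E N'] [Module.Finite E N] 
    (Φ : M →ₗ[E] N) (Ψ : M →ₗ[E] N') (h : LinearMap.ker Φ ≤ LinearMap.ker Ψ) :
    Module.finrank E (LinearMap.range Ψ) ≤ Module.finrank E N := by
  have h1 : LinearMap.range ((LinearMap.ker Φ).liftQ Ψ h) = LinearMap.range Ψ := Submodule.range_liftQ _ _ _
  have e := Φ.quotKerEquivRange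
  have : Module.Finite E (M ⧸ LinearMap.ker Φ) := Module.Finite.equiv e.symm
  rw [← h1]
  calc _ ≤ Module.finrank E (M ⧸ LinearMap.ker Φ) := LinearMap.finrank_range_le _
    _ = Module.finrank E (LinearMap.range Φ) := e.finrank_eq
    _ ≤ _ := Submodule.finrank_le _

/-- evaluation of derivations at a point -/
def dvL (x : κ → E) : Derivation K E E →ₗ[E] (κ → E) :=
  { toFun := fun δ => dv δ x
    map_add' := fun _ _ => rfl
    map_smul' := fun _ _ => rfl }

theorem Gen.range_dvL [CharZero E] {V : Set (κ → K)} {x : κ → E} (hx : Gen V x) :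
    LinearMap.range (dvL (K := K) x) = tsp V x := by
  apply le_antisymm
  · rintro _ ⟨δ, rfl⟩; exact hx.dv_mem δ
  · intro v hv
    obtain ⟨δ, rfl⟩ := hx.exists_dv hv
    exact ⟨δ, rfl⟩

/-- the field of constants of a derivation -/
def dker (δ : Derivation K E E) : Subfield E where
  carrier := {z | δ z = 0}
  mul_mem' := fun {a b} ha hb => by
    have ha : δ a = 0 := ha
    have hb : δ b = 0 := hb
    simp [ha, hb]
  one_mem' := by simp
  add_mem' := fun {a b} ha hb => by
    have ha : δ a = 0 := ha
    have hb : δ b = 0 := hb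
    simp [ha, hb]
  zero_mem' := by simp
  neg_mem' := fun {a} ha => by
    have ha : δ a = 0 := ha
    simp [ha]
  inv_mem' := fun a ha => by
    have ha : δ a = 0 := ha
    simp [Derivation.leibniz_inv, ha]

theorem deriv_alg [CharZero E] (δ : Derivation K E E) {z : E} (hz : IsAlgebraic (dker δ) z) : δ z = 0 := by
  have hz' := hz.isIntegral
  have h1 : ∀ p : Polynomial (dker δ), δ (Polynomial.aeval z p) = Polynomial.aeval z (Polynomial.derivative p) * δ z := by
    intro p
    induction p using Polynomial.induction_on' with
    | add p q hp hq => simp [hp, hq, add_mul]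
    | monomial n a =>
      have ha : δ (a : E) = 0 := a.2
      have : algebraMap (dker δ) E a = a := rfl
      simp [Polynomial.derivative_monomial, this, ha, Derivation.leibniz_pow]
      ring
  have h2 := h1 (minpoly (dker δ) z)
  rw [minpoly.aeval, map_zero] at h2
  refine (mul_eq_zero.1 h2.symm).resolve_left ?_
  exact (minpoly.irreducible hz').separable.aeval_derivative_ne_zero (minpoly.aeval _ _)

theorem noether_alg [CharZero E] (S : Subalgebra K E) (hS : S.FG) :
    ∃ (m : ℕ) (t : Fin m → S), (∃ g : MvPolynomial (Fin m) K →ₐ[K] S, Function.Injective g ∧ g.IsIntegral ∧ ∀ i, g (MvPolynomial.X i) = t i) ∧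
      ∀ δ : Derivation K E E, (∀ i, δ (t i) = 0) → ∀ z ∈ S, δ z = 0 := by
  have : Algebra.FiniteType K S := S.fg_iff_finiteType.1 hS
  obtain ⟨m, g, hg, hgi⟩ := exists_integral_inj_algHom_of_fg K S
  refine ⟨m, fun i => g (MvPolynomial.X i), ⟨g, hg, hgi, fun _ => rfl⟩, fun δ hδ z hz => ?_⟩
  apply deriv_alg
  have hmem : ∀ G : MvPolynomial (Fin m) K, (g G : E) ∈ dker δ := by
    intro G
    induction G using MvPolynomial.induction_on with
    | C c =>
      have : (g (MvPolynomial.C c) : E) = algebraMap K E c := by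
        have := g.commutes c
        rw [MvPolynomial.algebraMap_eq] at this
        rw [this]; rfl
      rw [this]
      exact δ.map_algebraMap c
    | add p q hp hq => rw [map_add]; exact add_mem hp hq
    | mul_X p i hp => rw [map_mul]; exact mul_mem hp (hδ i)
  obtain ⟨p, hp, hpz⟩ := hgi ⟨z, hz⟩
  let φ : MvPolynomial (Fin m) K →+* dker δ :=
    ((S.val.comp g).toRingHom).codRestrict (dker δ) hmem
  refine ⟨p.map φ, (hp.map φ).ne_zero, ?_⟩
  rw [Polynomial.aeval_def, Polynomial.eval₂_map]
  have := congrArg S.val hpz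
  rw [map_zero] at this
  rw [← this]
  have h2 := Polynomial.hom_eval₂ p g.toRingHom S.val.toRingHom (⟨z, hz⟩ : S)
  exact h2.symm

theorem Gen.ind [CharZero E] {V : Set (κ → K)} {x : κ → E} (hx : Gen V x) :
    Ind (K := K) (vI V) (Module.finrank E (tsp V x)) := by
  have hfg : (MvPolynomial.aeval (R := K) x).range.FG := by
    rw [← Algebra.map_top]
    exact Subalgebra.FG.map _ (Algebra.FiniteType.out)
  obtain ⟨m, t, ⟨g, hg, -, hgt⟩, ht⟩ := noether_alg (MvPolynomial.aeval (R := K) x).range hfg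
  have hle : Module.finrank E (tsp V x) ≤ m := by
    rw [← hx.range_dvL]
    refine (finrank_range_le_of_ker_le (dvL (K := K) (fun i => (t i : E))) (dvL (K := K) x) ?_).trans (by simp)
    intro δ hδ
    rw [LinearMap.mem_ker] at hδ ⊢
    funext i
    exact ht δ (fun j => congrFun hδ j) _ ⟨MvPolynomial.X i, by simp⟩
  refine Ind.of_le hle ?_
  choose G hG using fun i => (t i).2
  refine ⟨G, fun F hF => ?_⟩
  apply hg
  rw [map_zero]
  rw [← hx] at hF
  have h1 := MvPolynomial.comp_aeval_apply G (MvPolynomial.aeval (R := K) x) F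
  have hF : MvPolynomial.aeval x (MvPolynomial.aeval G F) = 0 := hF
  rw [hF] at h1
  have h2 : g = MvPolynomial.aeval t := by
    ext i; simp [hgt]
  have h3 := MvPolynomial.comp_aeval_apply t (MvPolynomial.aeval (R := K) x).range.val F
  apply Subtype.ext
  rw [h2]
  change (MvPolynomial.aeval (R := K) x).range.val (MvPolynomial.aeval t F) = 0
  rw [h3, h1]
  congr 2
  funext i; exact (hG i).symm
end Dimn

/-- closure through the vanishing ideal -/
def zcl (W : Set (PP K ι)) : Set (PP K ι) := zeroLocus (vI (coneOf W) : Set (MvPolynomial ι K))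

theorem subset_zcl (W : Set (PP K ι)) : W ⊆ zcl W := by
  intro x hx f hf v hv
  exact hf v (mem_coneOf.2 ⟨x, hx, hv⟩)

theorem zcl_subset {W Y : Set (PP K ι)} (hY : IsZClosed Y) (h : W ⊆ Y) : zcl W ⊆ Y := by
  intro x hx
  rw [← x.mk_rep]
  apply mem_of_closed hY
  intro f hf
  exact hx f (vI_mono (coneOf_mono h) hf) _ (rep_mem_submodule x)

theorem zcl_eq [Infinite K] (W : Set (PP K ι)) : zclosure W = zcl W := by
  apply le_antisymm
  · exact Set.sInter_subset_of_mem ⟨isZClosed_zeroLocus _, subset_zcl W⟩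
  · exact Set.subset_sInter fun Y hY => zcl_subset hY.1 hY.2

theorem zcl_closed [Infinite K] (W : Set (PP K ι)) : IsZClosed (zcl W) := isZClosed_zeroLocus _

theorem zclosure_eq_self {X : Set (PP K ι)} (hX : IsZClosed X) : zclosure X = X :=
  le_antisymm (Set.sInter_subset_of_mem ⟨hX, le_rfl⟩) (Set.subset_sInter fun _ h => h.2)

theorem vI_zcl (W : Set (PP K ι)) : vI (coneOf (zcl W)) = vI (coneOf W) := by
  apply le_antisymm (vI_mono (coneOf_mono (subset_zcl W)))
  intro f hf v hv
  obtain ⟨x, hx, hv⟩ := mem_coneOf.1 hv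
  exact hx f hf v hv

theorem zirr_zcl [Infinite K] {W : Set (PP K ι)} (hW : IsZIrreducible W) : IsZIrreducible (zcl W) := by
  refine ⟨hW.1.mono (subset_zcl W), fun Y Z hY hZ h => ?_⟩
  rcases hW.2 Y Z hY hZ ((subset_zcl W).trans h) with h | h
  · exact Or.inl (zcl_subset hY h)
  · exact Or.inr (zcl_subset hZ h)

/-- ideal of the origin -/
def mI (ι K : Type*) [Field K] : Ideal (MvPolynomial ι K) := vI ({0} : Set (ι → K))

theorem Ind.zero_mI : Ind (K := K) (mI ι K) 0 := by
  refine ⟨Fin.elim0, fun G hG => ?_⟩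
  have : G = MvPolynomial.C (MvPolynomial.coeff 0 G) := MvPolynomial.eq_C_of_isEmpty G
  rw [this] at hG ⊢
  rw [MvPolynomial.aeval_C] at hG
  have := hG 0 rfl
  rw [MvPolynomial.algebraMap_eq, MvPolynomial.eval_C] at this
  rw [this, map_zero]

theorem vI_lt_mI {Y : Set (PP K ι)} (hY : Y.Nonempty) : vI (coneOf Y) < mI ι K := by
  refine SetLike.lt_iff_le_and_exists.2 ⟨vI_mono (by
    rintro _ rfl; exact zero_mem_coneOf hY), ?_⟩
  obtain ⟨y, hy⟩ := hY
  obtain ⟨i, hi⟩ := Function.ne_iff.1 y.rep_nonzero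
  refine ⟨MvPolynomial.X i, ?_, fun h => hi ?_⟩
  · rintro _ rfl; simp
  · have := h _ (rep_mem_coneOf hy)
    simpa using this

theorem vI_lt_of_lt {Y Z : Set (PP K ι)} (hY : IsZClosed Y) (h : Y < Z) :
    vI (coneOf Z) < vI (coneOf Y) := by
  refine lt_of_le_of_ne (vI_mono (coneOf_mono h.le)) fun he => h.not_ge ?_
  intro x hx
  rw [← x.mk_rep]
  apply mem_of_closed hY
  rw [← he]
  intro f hf
  exact hf _ (rep_mem_coneOf hx)

theorem ind_of_zdim [Infinite K] {σ : Set (PP K ι)} {l : ℕ}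
    (h : ((l : ℕ∞) : WithBot ℕ∞) ≤ zdim σ) : Ind (K := K) (vI (coneOf σ)) (l + 1) := by
  have h' : (l : WithBot ℕ∞) ≤ zdim σ := h
  rw [zdim, Order.le_krullDim_iff] at h'
  obtain ⟨L, rfl⟩ := h'
  have key : ∀ i : ℕ, ∀ hi : i < L.length + 1, Ind (K := K) (vI (coneOf (L ⟨i, hi⟩).1)) (i + 1) := by
    intro i
    induction i with
    | zero =>
      intro hi
      have := vI_prime (L ⟨0, hi⟩).2.2.1
      exact Ind.zero_mI.drop (vI_lt_mI (L ⟨0, hi⟩).2.2.1.1)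
    | succ i ih =>
      intro hi
      have := vI_prime (L ⟨i + 1, hi⟩).2.2.1
      refine (ih (by omega)).drop (vI_lt_of_lt (L ⟨i, _⟩).2.1 ?_)
      exact L.strictMono (by simp)
  refine (key L.length (by omega)).mono ?_
  rw [← vI_zcl σ, ← zcl_eq]
  exact vI_mono (coneOf_mono (L _).2.2.2)

/-- homogenization with respect to a variable -/
def hmg (i0 : ι) (F : MvPolynomial ι K) : MvPolynomial ι K :=
  ∑ d ∈ Finset.range (F.totalDegree + 1),
    MvPolynomial.X i0 ^ (F.totalDegree - d) * MvPolynomial.homogeneousComponent d F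

theorem hmg_homog (i0 : ι) (F : MvPolynomial ι K) : (hmg i0 F).IsHomogeneous F.totalDegree := by
  refine MvPolynomial.IsHomogeneous.sum _ _ _ fun d hd => ?_
  have h := (MvPolynomial.isHomogeneous_X_pow (R := K) i0 (F.totalDegree - d)).mul
    (MvPolynomial.homogeneousComponent_isHomogeneous d F)
  rw [Finset.mem_range] at hd
  rwa [Nat.sub_add_cancel (by omega)] at h

theorem hmg_eval (i0 : ι) (F : MvPolynomial ι K) {v : ι → K} (hv : v i0 = 1) :
    MvPolynomial.eval v (hmg i0 F) = MvPolynomial.eval v F := by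
  conv_rhs => rw [← MvPolynomial.sum_homogeneousComponent F]
  simp [hmg, hv]

/-- points of the affine chart killed by an ideal -/
def pts (i0 : ι) (P : Ideal (MvPolynomial ι K)) : Set (PP K ι) :=
  {x | ∃ v ∈ x.submodule, v i0 = 1 ∧ ∀ f ∈ P, MvPolynomial.eval v f = 0}

theorem pts_nss [IsAlgClosed K] {i0 : ι} {P : Ideal (MvPolynomial ι K)} [P.IsPrime]
    (h1 : MvPolynomial.X i0 - 1 ∈ P) {F : MvPolynomial ι K} (hF : F ∉ P) :
    ∃ (v : ι → K) (h0 : v ≠ 0), Projectivization.mk K v h0 ∈ pts i0 P ∧ v i0 = 1 ∧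
      MvPolynomial.eval v F ≠ 0 := by
  have h := MvPolynomial.IsPrime.vanishingIdeal_zeroLocus (K := K) P
  rw [← h] at hF
  have : ∃ v ∈ MvPolynomial.zeroLocus K P, MvPolynomial.eval v F ≠ 0 := by
    by_contra hcon
    push Not at hcon
    exact hF (MvPolynomial.mem_vanishingIdeal_iff.2 fun v hv => by
      rw [MvPolynomial.aeval_eq_eval]; exact hcon v hv)
  obtain ⟨v, hv, hF⟩ := this
  have hv : ∀ f ∈ P, MvPolynomial.eval v f = 0 := fun f hf => by
    have := hv f hf
    rwa [MvPolynomial.aeval_eq_eval] at this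
  have hv1 : v i0 = 1 := by
    have := hv _ h1
    simpa [sub_eq_zero] using this
  have h0 : v ≠ 0 := by rintro rfl; simp at hv1
  refine ⟨v, h0, ⟨v, ?_, hv1, hv⟩, hv1, hF⟩
  rw [Projectivization.submodule_mk]; exact Submodule.mem_span_singleton_self v

theorem homog_ne {f : MvPolynomial ι K} {d : ℕ} (hf : f.IsHomogeneous d) {x : PP K ι}
    {v : ι → K} (hv : v ∈ x.submodule) (hv0 : v ≠ 0) (h : MvPolynomial.eval v f = 0) :
    x ∈ zeroLocus {f} := by
  rintro g rfl w hw
  rw [← eq_mk_of_mem hv hv0, Projectivization.submodule_mk, Submodule.mem_span_singleton] at hw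
  obtain ⟨c, rfl⟩ := hw
  have := eval_smul_homog hf c v
  rw [MvPolynomial.aeval_eq_eval] at this
  change MvPolynomial.eval (c • v) g = _ at this
  rw [this]
  change _ * MvPolynomial.eval v g = 0
  rw [h, mul_zero]

theorem pts_irr [IsAlgClosed K] {i0 : ι} {P : Ideal (MvPolynomial ι K)} [hP : P.IsPrime]
    (h1 : MvPolynomial.X i0 - 1 ∈ P) : IsZIrreducible (pts i0 P) := by
  constructor
  · obtain ⟨v, h0, h, -⟩ := pts_nss h1 (F := 1) (fun h => hP.ne_top ((Ideal.eq_top_iff_one _).2 h))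
    exact ⟨_, h⟩
  · rintro Y Z ⟨SY, hSY, rfl⟩ ⟨SZ, hSZ, rfl⟩ h
    by_contra hcon
    rw [not_or] at hcon
    have aux : ∀ S : Set (MvPolynomial ι K), (∀ f ∈ S, ∃ d : ℕ, f.IsHomogeneous d) →
        ¬ pts i0 P ⊆ zeroLocus S → ∃ f ∈ S, f ∉ P := by
      intro S hS hn
      by_contra hc
      push Not at hc
      apply hn
      rintro x ⟨v, hv, hv1, hvP⟩ f hf
      obtain ⟨d, hd⟩ := hS f hf
      have hv0 : v ≠ 0 := by rintro rfl; simp at hv1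
      exact homog_ne hd hv hv0 (hvP f (hc f hf)) f rfl
    obtain ⟨f, hf, hfP⟩ := aux SY hSY hcon.1
    obtain ⟨g, hg, hgP⟩ := aux SZ hSZ hcon.2
    obtain ⟨v, h0, hv, -, hne⟩ := pts_nss h1 (F := f * g) (fun h => (hP.mem_or_mem h).elim hfP hgP)
    have hvm : v ∈ (Projectivization.mk K v h0).submodule := by
      rw [Projectivization.submodule_mk]; exact Submodule.mem_span_singleton_self v
    rw [map_mul] at hne
    rcases h hv with h | h
    · exact hne (by rw [h f hf v hvm, zero_mul])
    · exact hne (by rw [h g hg v hvm, mul_zero])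

theorem pts_lt [IsAlgClosed K] {i0 : ι} {P P' : Ideal (MvPolynomial ι K)} [hP : P.IsPrime]
    (h1 : MvPolynomial.X i0 - 1 ∈ P) (h : P < P') : zcl (pts i0 P') < zcl (pts i0 P) := by
  have : Infinite K := IsAlgClosed.instInfinite
  have hsub : pts i0 P' ⊆ pts i0 P := by
    rintro x ⟨v, hv, hv1, hvP⟩
    exact ⟨v, hv, hv1, fun f hf => hvP f (h.le hf)⟩
  refine lt_of_le_not_ge (zcl_subset (zcl_closed _) (hsub.trans (subset_zcl _))) fun hle => ?_
  obtain ⟨F, hF', hF⟩ := SetLike.exists_of_lt h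
  obtain ⟨v, h0, hv, hv1, hne⟩ := pts_nss h1 hF
  have h2 : zcl (pts i0 P') ⊆ zeroLocus {hmg i0 F} := by
    refine zcl_subset (isZClosed_zeroLocus _) ?_
    rintro x ⟨v, hv, hv1, hvP⟩
    have hv0 : v ≠ 0 := by rintro rfl; simp at hv1
    refine homog_ne (hmg_homog i0 F) hv hv0 ?_
    rw [hmg_eval i0 F hv1]; exact hvP F hF'
  have h3 := h2 (hle (subset_zcl _ hv)) _ rfl v (by
    rw [Projectivization.submodule_mk]; exact Submodule.mem_span_singleton_self v)
  rw [hmg_eval i0 F hv1] at h3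
  exact hne h3

open MvPolynomial in
theorem finrank_tsp_le [IsAlgClosed K] [CharZero K] {X : Set (PP K ι)} (hX : IsIntegralVariety X)
    [(vI (coneOf X)).IsPrime] {n : ℕ} (hn : zdim X ≤ ((n : ℕ∞) : WithBot ℕ∞)) :
    Module.finrank (GFd (coneOf X)) (tsp (coneOf X) (gpt (coneOf X))) ≤ n + 1 := by
  have : Infinite K := IsAlgClosed.instInfinite
  have : CharZero (GFd (coneOf X)) := charZero_of_injective_algebraMap (algebraMap K _).injective
  set V := coneOf X with hV
  obtain ⟨x0, hx0⟩ := hX.2.1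
  obtain ⟨i0, hi0⟩ := Function.ne_iff.1 x0.rep_nonzero
  have hy0 : gpt V i0 ≠ 0 := by
    intro h
    have h1 : aeval (gpt V) (MvPolynomial.X i0 : MvPolynomial ι K) = 0 := by rw [aeval_X, h]
    rw [gen_gpt V] at h1
    have := h1 _ (rep_mem_coneOf hx0)
    rw [eval_X] at this
    exact hi0 this
  let π : ι → GFd V := fun i => gpt V i / gpt V i0
  have hπ0 : π i0 = 1 := div_self hy0
  have hfg : (aeval (R := K) π).range.FG := by
    rw [← Algebra.map_top]
    exact Subalgebra.FG.map _ (Algebra.FiniteType.out)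
  set S := (aeval (R := K) π).range with hS
  obtain ⟨m, t, ⟨g, hg, hgi, hgt⟩, ht⟩ := noether_alg S hfg
  have hle : Module.finrank (GFd V) (tsp V (gpt V)) ≤ m + 1 := by
    rw [← (gen_gpt V).range_dvL]
    refine (finrank_range_le_of_ker_le (dvL (K := K) (fun i : Option (Fin m) => i.elim (gpt V i0) (fun j => (t j : GFd V))))
      (dvL (K := K) (gpt V)) ?_).trans (by simp)
    intro δ hδ
    rw [LinearMap.mem_ker] at hδ ⊢
    have h0 : δ (gpt V i0) = 0 := congrFun hδ none
    funext i
    have h1 := ht δ (fun j => congrFun hδ (some j)) (π i) ⟨MvPolynomial.X i, by simp⟩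
    change δ (gpt V i) = 0
    have h2 : gpt V i = π i * gpt V i0 := (div_mul_cancel₀ _ hy0).symm
    rw [h2, δ.leibniz, h1, h0]; simp
  refine hle.trans (Nat.succ_le_succ ?_)
  -- Krull dimension of `S`
  have hdS : ((m : ℕ) : WithBot ℕ∞) ≤ Order.krullDim (PrimeSpectrum S) := by
    have h1 : ((m : ℕ) : WithBot ℕ∞) ≤ Order.krullDim (PrimeSpectrum (MvPolynomial (Fin m) K)) := by
      change _ ≤ ringKrullDim (MvPolynomial (Fin m) K)
      rw [MvPolynomial.ringKrullDim_of_isNoetherianRing, ringKrullDim_eq_zero_of_field]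
      simp
    rw [Order.le_krullDim_iff] at h1 ⊢
    obtain ⟨l, hl⟩ := h1
    letI : Algebra (MvPolynomial (Fin m) K) S := g.toRingHom.toAlgebra
    haveI : Algebra.IsIntegral (MvPolynomial (Fin m) K) S := ⟨hgi⟩
    obtain ⟨Q, -, hQ, hQc⟩ := Ideal.exists_ideal_over_prime_of_isIntegral (S := S) l.head.asIdeal ⊥ (by
      intro z hz
      have : z = 0 := hg (by rw [map_zero]; exact hz)
      rw [this]; exact zero_mem _)
    haveI : Q.LiesOver l.head.asIdeal := ⟨hQc.symm⟩
    obtain ⟨L, hL, -⟩ := Ideal.exists_ltSeries_of_hasGoingUp (S := S) l Q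
    exact ⟨L, hL.trans hl⟩
  let q : MvPolynomial ι K →ₐ[K] S := (aeval (R := K) π).rangeRestrict
  have hq : Function.Surjective q := AlgHom.rangeRestrict_surjective _
  have h1mem : ∀ Q : PrimeSpectrum S, (MvPolynomial.X i0 - 1 : MvPolynomial ι K) ∈ Q.asIdeal.comap q := by
    intro Q
    have : q (MvPolynomial.X i0 - 1) = 0 := by
      apply Subtype.ext
      change aeval π (MvPolynomial.X i0 - 1 : MvPolynomial ι K) = 0
      simp [hπ0]
    rw [Ideal.mem_comap, this]; exact zero_mem _
  have hptsX : ∀ Q : PrimeSpectrum S, zcl (pts i0 (Q.asIdeal.comap q)) ⊆ X := by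
    intro Q
    refine zcl_subset hX.1 ?_
    obtain ⟨SX, hSX, hXS⟩ := hX.1
    rintro x ⟨v, hv, hv1, hvP⟩
    have hv0 : v ≠ 0 := by rintro rfl; simp at hv1
    rw [hXS]
    intro f hf
    obtain ⟨d, hd⟩ := hSX f hf
    refine homog_ne hd hv hv0 (hvP f ?_) f rfl
    have : q f = 0 := by
      apply Subtype.ext
      change aeval π f = 0
      have hπ : π = (gpt V i0)⁻¹ • gpt V := by
        funext i; simp [π, div_eq_inv_mul]
      rw [hπ, eval_smul_homog hd, (gen_gpt V f).2, mul_zero]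
      intro w hw
      obtain ⟨y, hy, hw⟩ := mem_coneOf.1 hw
      rw [hXS] at hy
      exact hy f hf w hw
    rw [Ideal.mem_comap, this]; exact zero_mem _
  let Ff : (PrimeSpectrum S)ᵒᵈ → {Y : Set (PP K ι) // IsZClosed Y ∧ IsZIrreducible Y ∧ Y ⊆ zclosure X} :=
    fun Q => ⟨zcl (pts i0 ((OrderDual.ofDual Q).asIdeal.comap q)), zcl_closed _, zirr_zcl (pts_irr (h1mem _)),
      by rw [zclosure_eq_self hX.1]; exact hptsX _⟩
  have hmono : StrictMono Ff := by
    intro Q Q' h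
    refine pts_lt (h1mem _) ?_
    have h : (OrderDual.ofDual Q').asIdeal < (OrderDual.ofDual Q).asIdeal := h
    refine lt_of_le_of_ne (Ideal.comap_mono h.le) fun he => h.ne ?_
    exact Ideal.comap_injective_of_surjective q hq he
  have h4 := Order.krullDim_le_of_strictMono Ff hmono
  rw [Order.krullDim_orderDual] at h4
  have h5 := (hdS.trans h4).trans hn
  exact_mod_cast h5

theorem isZClosed_plin [Infinite K] (W : Submodule K (ι → K)) : IsZClosed (plin W) := by
  classical
  have : plin W = zeroLocus {f | ∃ l : Module.Dual K (ι → K), (∀ w ∈ W, l w = 0) ∧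
      f = ∑ i, MvPolynomial.C (l (Pi.single i 1)) * MvPolynomial.X i} := by
    have hl : ∀ (l : Module.Dual K (ι → K)) v, MvPolynomial.eval v
        (∑ i, MvPolynomial.C (l (Pi.single i 1)) * MvPolynomial.X i : MvPolynomial ι K) = l v := by
      intro l v
      rw [LinearMap.pi_apply_eq_sum_univ l v]
      simp only [map_sum, map_mul, MvPolynomial.eval_C, MvPolynomial.eval_X, smul_eq_mul]
      refine Finset.sum_congr rfl fun i _ => ?_
      rw [mul_comm]
      congr 2
      funext j; simp [Pi.single_apply, eq_comm]
    ext x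
    constructor
    · rintro hx f ⟨l, hlW, rfl⟩ v hv
      rw [hl]; exact hlW v (hx hv)
    · intro hx v hv
      by_contra hvW
      obtain ⟨l, hl1, hl2⟩ := Submodule.exists_dual_map_eq_bot_of_notMem hvW inferInstance
      apply hl1
      rw [← hl]
      refine hx _ ⟨l, fun w hw => ?_, rfl⟩ v hv
      have : l w ∈ W.map l := ⟨w, hw, rfl⟩
      rw [hl2] at this
      exact (Submodule.mem_bot K).1 this
  rw [this]; exact isZClosed_zeroLocus _

theorem plin_submodule (x : PP K ι) : plin x.submodule = {x} := by
  ext y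
  rw [plin_iff, Set.mem_singleton_iff]
  constructor
  · intro h; rw [← eq_mk_of_mem h y.rep_nonzero, y.mk_rep]
  · rintro rfl; exact rep_mem_submodule y

theorem isZClosed_singleton [Infinite K] (x : PP K ι) : IsZClosed ({x} : Set (PP K ι)) := by
  rw [← plin_submodule]; exact isZClosed_plin _

theorem isZClosed_empty [Infinite K] : IsZClosed (∅ : Set (PP K ι)) := by
  have : (∅ : Set (PP K ι)) = zeroLocus {1} := by
    ext x
    simp only [Set.mem_empty_iff_false, false_iff]
    intro h
    have := h 1 rfl 0 (zero_mem _)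
    simp at this
  rw [this]; exact isZClosed_zeroLocus _

theorem isZClosed_union [Infinite K] {Y Z : Set (PP K ι)} (hY : IsZClosed Y) (hZ : IsZClosed Z) :
    IsZClosed (Y ∪ Z) := by
  have : Y ∪ Z = zcl (Y ∪ Z) := by
    refine le_antisymm (subset_zcl _) ?_
    intro x hx
    by_contra hcon
    rw [Set.mem_union, not_or] at hcon
    have aux : ∀ Y : Set (PP K ι), IsZClosed Y → x ∉ Y → ∃ f ∈ vI (coneOf Y), MvPolynomial.eval x.rep f ≠ 0 := by
      intro Y hY hxY
      by_contra hc
      push Not at hc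
      apply hxY
      rw [← x.mk_rep]
      exact mem_of_closed hY x.rep_nonzero hc
    obtain ⟨f, hf, hfx⟩ := aux Y hY hcon.1
    obtain ⟨g, hg, hgx⟩ := aux Z hZ hcon.2
    have := hx (f * g) (by
      intro v hv
      obtain ⟨y, hy, hv⟩ := mem_coneOf.1 hv
      rw [map_mul]
      rcases hy with hy | hy
      · rw [hf v (mem_coneOf.2 ⟨y, hy, hv⟩), zero_mul]
      · rw [hg v (mem_coneOf.2 ⟨y, hy, hv⟩), mul_zero]) x.rep (rep_mem_submodule x)
    rw [map_mul] at this
    exact (mul_ne_zero hfx hgx) this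
  rw [this]; exact zcl_closed _

theorem isZClosed_finite [Infinite K] {F : Set (PP K ι)} (hF : F.Finite) : IsZClosed F := by
  induction F, hF using Set.Finite.induction_on with
  | empty => exact isZClosed_empty
  | insert _ _ ih => rw [Set.insert_eq]; exact isZClosed_union (isZClosed_singleton _) ih

theorem irr_subset_finite [Infinite K] {X F : Set (PP K ι)} (hX : IsZIrreducible X) (hF : F.Finite)
    (h : X ⊆ F) : ∃ x ∈ F, X ⊆ {x} := by
  induction F, hF using Set.Finite.induction_on with
  | empty => exact absurd hX.1 (by rw [Set.subset_empty_iff.1 h]; simp)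
  | @insert a s _ hs ih =>
    rw [Set.insert_eq] at h
    rcases hX.2 _ _ (isZClosed_singleton a) (isZClosed_finite hs) h with h | h
    · exact ⟨a, by simp, h⟩
    · obtain ⟨x, hx, h⟩ := ih h
      exact ⟨x, by simp [hx], h⟩

theorem vspan_finset (S : Finset (PP K ι)) {v : ι → K} :
    v ∈ vspan (S : Set (PP K ι)) ↔ ∃ c : PP K ι → K, v = ∑ x ∈ S, c x • x.rep := by
  constructor
  · intro hv
    induction hv using Submodule.span_induction with
    | mem v hv =>
      classical
      obtain ⟨x, hx, hv⟩ := mem_coneOf.1 hv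
      obtain ⟨c, rfl⟩ := mem_submodule_iff.1 hv
      refine ⟨fun y => if y = x then c else 0, ?_⟩
      rw [Finset.sum_eq_single x]
      · simp
      · intro y _ h; simp [h]
      · intro h; exact absurd hx h
    | zero => exact ⟨0, by simp⟩
    | add v w _ _ hv hw =>
      obtain ⟨c, rfl⟩ := hv
      obtain ⟨d, rfl⟩ := hw
      exact ⟨c + d, by simp [add_smul, Finset.sum_add_distrib]⟩
    | smul a v _ hv =>
      obtain ⟨c, rfl⟩ := hv
      exact ⟨a • c, by simp [mul_smul, Finset.smul_sum]⟩
  · rintro ⟨c, rfl⟩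
    refine Submodule.sum_mem _ fun x hx => Submodule.smul_mem _ _ (Submodule.subset_span ?_)
    exact mem_coneOf.2 ⟨x, hx, rep_mem_submodule x⟩

theorem mem_projSpan_iff {S : Set (PP K ι)} {q : PP K ι} {v : ι → K} (hv : v ∈ q.submodule)
    (h0 : v ≠ 0) : q ∈ projSpan S ↔ v ∈ vspan S := by
  rw [← eq_mk_of_mem hv h0]
  change (Projectivization.mk K _ _).submodule ≤ _ ↔ _
  rw [Projectivization.submodule_mk, Submodule.span_singleton_le_iff_mem]

theorem sum_of_projSpan {X : Set (PP K ι)} {S : Finset (PP K ι)} (hS : ↑S ⊆ X) {v : ι → K}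
    (hv : v ∈ vspan (S : Set (PP K ι))) :
    ∃ u : Fin S.card → ι → K, (∀ a, u a ∈ coneOf X) ∧ v = ∑ a, u a ∧
      ∀ a, u a ∈ (S.equivFin.symm a).1.submodule := by
  obtain ⟨c, rfl⟩ := (vspan_finset S).1 hv
  have hm : ∀ a, c (S.equivFin.symm a).1 • (S.equivFin.symm a).1.rep ∈ (S.equivFin.symm a).1.submodule :=
    fun a => Submodule.smul_mem _ _ (rep_mem_submodule _)
  refine ⟨fun a => c (S.equivFin.symm a).1 • (S.equivFin.symm a).1.rep, fun a => ?_, ?_, hm⟩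
  · exact mem_coneOf.2 ⟨_, hS (S.equivFin.symm a).2, hm a⟩
  · rw [← Finset.sum_coe_sort, ← S.equivFin.symm.sum_comp]

theorem exists_finset_of_sum {X : Set (PP K ι)} {j : ℕ} {u : Fin j → ι → K}
    (hu : ∀ a, u a ∈ coneOf X) : ∃ S : Finset (PP K ι), ↑S ⊆ X ∧ S.card ≤ j ∧
      ∑ a, u a ∈ vspan (S : Set (PP K ι)) := by
  classical
  choose y hy hyu using fun a => mem_coneOf.1 (hu a)
  refine ⟨Finset.univ.image y, ?_, ?_, ?_⟩
  · intro x hx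
    simp only [Finset.coe_image, Finset.coe_univ, Set.image_univ, Set.mem_range] at hx
    obtain ⟨a, rfl⟩ := hx; exact hy a
  · exact Finset.card_image_le.trans (by simp)
  · refine Submodule.sum_mem _ fun a _ => Submodule.subset_span ?_
    exact mem_coneOf.2 ⟨y a, by simp, hyu a⟩

theorem exists_card_eq {X : Set (PP K ι)} (hX : X.Infinite) {j : ℕ} {S : Finset (PP K ι)}
    (hS : ↑S ⊆ X) (hc : S.card ≤ j) : ∃ S' : Finset (PP K ι), S ⊆ S' ∧ ↑S' ⊆ X ∧ S'.card = j := by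
  classical
  obtain ⟨T, hT, hTc⟩ := (hX.diff S.finite_toSet).exists_subset_card_eq (j - S.card)
  refine ⟨S ∪ T, Finset.subset_union_left, ?_, ?_⟩
  · rw [Finset.coe_union]
    exact Set.union_subset hS (hT.trans Set.diff_subset)
  · rw [Finset.card_union_of_disjoint, hTc]
    · omega
    · rw [Finset.disjoint_left]
      intro x hx hxT
      exact (hT hxT).2 hx

theorem vspan_mono {S T : Set (PP K ι)} (h : S ⊆ T) : vspan S ≤ vspan T :=
  Submodule.span_mono (coneOf_mono h)

/-- sums of points in the cone -/
def sumSet (j : ℕ) (V : Set (ι → K)) : Set (ι → K) := {v | ∃ u : Fin j → ι → K, (∀ a, u a ∈ V) ∧ v = ∑ a, u a}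

theorem vI_secant [Infinite K] {X : Set (PP K ι)} (hX : X.Infinite) {j : ℕ} (hj : 1 ≤ j) :
    vI (coneOf (secant j X)) = vI (sumSet j (coneOf X)) := by
  rw [secant, zcl_eq, vI_zcl]
  congr 1
  ext v
  constructor
  · intro hv
    obtain ⟨q, ⟨S, hS, hc, hq⟩, hvq⟩ := mem_coneOf.1 hv
    subst hc
    obtain ⟨u, hu, h, -⟩ := sum_of_projSpan hS (hq hvq)
    exact ⟨u, hu, h⟩
  · rintro ⟨u, hu, rfl⟩
    obtain ⟨S, hS, hc, hm⟩ := exists_finset_of_sum hu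
    obtain ⟨S', hSS, hS', hc'⟩ := exists_card_eq hX hS hc
    have hm' := vspan_mono (Finset.coe_subset.2 hSS) hm
    by_cases h0 : ∑ a, u a = 0
    · rw [h0]
      apply zero_mem_coneOf
      have : S'.Nonempty := by rw [← Finset.card_pos]; omega
      obtain ⟨y, hy⟩ := this
      refine ⟨y, S', hS', hc', ?_⟩
      rw [mem_projSpan_iff (rep_mem_submodule y) y.rep_nonzero]
      exact Submodule.subset_span (mem_coneOf.2 ⟨y, hy, rep_mem_submodule y⟩)
    · rw [mem_coneOf_iff h0]
      refine ⟨S', hS', hc', ?_⟩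
      rw [mem_projSpan_iff (v := ∑ a, u a) _ h0]
      · exact hm'
      · rw [Projectivization.submodule_mk]; exact Submodule.mem_span_singleton_self _

section Terr
variable {E : Type*} [Field E] [Algebra K E]

theorem gen_sum {V : Set (ι → K)} {j : ℕ} {x : Fin j → ι → E} (hx : GenT V x) :
    Gen (sumSet j V) (∑ a, x a) := by
  intro f
  let f' : MvPolynomial (Fin j × ι) K := MvPolynomial.bind₁ (fun i => ∑ a, MvPolynomial.X (a, i)) f
  have h1 : MvPolynomial.aeval (fun p : Fin j × ι => x p.1 p.2) f' = MvPolynomial.aeval (∑ a, x a) f := by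
    change MvPolynomial.aeval _ (MvPolynomial.bind₁ _ f) = _
    rw [MvPolynomial.aeval_bind₁]
    congr 2
    funext i; simp
  have h2 : ∀ u : Fin j × ι → K, MvPolynomial.eval u f' = MvPolynomial.eval (∑ a, fun i => u (a, i)) f := by
    intro u
    change MvPolynomial.eval _ (MvPolynomial.bind₁ _ f) = _
    rw [← MvPolynomial.aeval_eq_eval, ← MvPolynomial.aeval_eq_eval, MvPolynomial.aeval_bind₁]
    congr 2
    funext i; simp
  rw [← h1, hx f']
  constructor
  · rintro h v ⟨u, hu, rfl⟩
    have := h (fun p => u p.1 p.2) hu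
    rwa [h2] at this
  · intro h u hu
    rw [h2]
    exact h _ ⟨_, hu, rfl⟩

theorem tsp_sum [CharZero E] {V : Set (ι → K)} (hVn : V.Nonempty) {j : ℕ} {x : Fin j → ι → E} (hx : GenT V x) :
    tsp (sumSet j V) (∑ a, x a) = ⨆ a, tsp V (x a) := by
  have hdv : ∀ δ : Derivation K E E, dv δ (∑ a, x a) = ∑ a, dv δ (x a) := by
    intro δ; funext i; simp [dv]
  apply le_antisymm
  · intro v hv
    obtain ⟨δ, rfl⟩ := (gen_sum hx).exists_dv hv
    rw [hdv]
    exact Submodule.sum_mem _ fun a _ => Submodule.mem_iSup_of_mem a ((hx.gen hVn a).dv_mem δ)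
  · refine iSup_le fun a v hv => ?_
    classical
    obtain ⟨δ, hδ⟩ := hx.exists_dv (v := Pi.single a v) (by
      intro b
      by_cases h : b = a
      · subst h; simpa using hv
      · simp [h])
    have := (gen_sum hx).dv_mem δ
    rw [hdv] at this
    simpa [hδ, Finset.sum_pi_single'] using this

theorem Gen.finrank_eq [CharZero E] [Infinite K] {E' : Type*} [Field E'] [Algebra K E'] [CharZero E']
    {V : Set (ι → K)} {x : ι → E} (hx : Gen V x) {x' : ι → E'} (hx' : Gen V x') :
    Module.finrank E (tsp V x) = Module.finrank E' (tsp V x') :=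
  le_antisymm (hx.ind.le_finrank hx') (hx'.ind.le_finrank hx)

theorem indep_of_finrank {α : Type*} [Fintype α] {N : ℕ} (W : α → Submodule E (ι → E))
    (hW : ∀ a, Module.finrank E (W a) ≤ N) (h : Fintype.card α * N ≤ Module.finrank E (⨆ a, W a : Submodule E (ι → E))) :
    iSupIndep W ∧ ∀ a, Module.finrank E (W a) = N := by
  classical
  let Φ : (Π a, W a) →ₗ[E] (ι → E) := ∑ a, (W a).subtype ∘ₗ LinearMap.proj a
  have hΦ : ∀ w, Φ w = ∑ a, (w a : ι → E) := by intro w; simp [Φ]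
  have hr : LinearMap.range Φ = ⨆ a, W a := by
    apply le_antisymm
    · rintro _ ⟨w, rfl⟩
      rw [hΦ]
      exact Submodule.sum_mem _ fun a _ => Submodule.mem_iSup_of_mem a (w a).2
    · refine iSup_le fun a v hv => ⟨Pi.single a ⟨v, hv⟩, ?_⟩
      rw [hΦ, Finset.sum_eq_single a]
      · simp
      · intro b _ hb; simp [hb]
      · simp
  have h1 := LinearMap.finrank_range_add_finrank_ker Φ
  rw [hr, Module.finrank_pi_fintype] at h1
  have h2 : ∑ a, Module.finrank E (W a) ≤ Fintype.card α * N := by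
    calc _ ≤ ∑ a : α, N := Finset.sum_le_sum fun a _ => hW a
      _ = _ := by simp
  have h3 : Module.finrank E (LinearMap.ker Φ) = 0 := by omega
  have h4 : LinearMap.ker Φ = ⊥ := Submodule.finrank_eq_zero.1 h3
  refine ⟨?_, ?_⟩
  · apply iSupIndep_of_dfinsupp_lsum_injective
    refine (injective_iff_map_eq_zero _).2 fun m hm => ?_
    have h6 : (fun a => m a : Π a, W a) ∈ LinearMap.ker Φ := by
      rw [LinearMap.mem_ker, hΦ, ← hm, DFinsupp.lsum_apply_apply, DFinsupp.sumAddHom_apply, DFinsupp.sum]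
      symm
      apply Finset.sum_subset (Finset.subset_univ _)
      intro a _ ha
      simpa using ha
    rw [h4, Submodule.mem_bot] at h6
    ext a : 1
    exact congrFun h6 a
  · have h5 : ∑ a, Module.finrank E (W a) = ∑ a : α, N := by simp; omega
    intro a
    exact (Finset.sum_eq_sum_iff_of_le fun a _ => hW a).1 h5 a (Finset.mem_univ a)

end Terr

section SetupA
variable {κ : Type*} [Fintype κ] {E : Type*} [Field E] [Algebra K E] {E' : Type*} [Field E'] [Algebra K E']

theorem Qc.hom {α : Type*} {V : Set (κ → K)} {x : α → κ → E} {A : Set α} {a : α} (h : Qc V x A a)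
    (φ : E →ₐ[K] E') : Qc V (fun b i => φ (x b i)) A a := by
  letI := φ.toRingHom.toAlgebra
  haveI : IsScalarTower K E E' := IsScalarTower.of_algebraMap_eq fun c => (φ.commutes c).symm
  exact h.ac (E' := E')

theorem Qc.of_hom {α : Type*} {V : Set (κ → K)} {x : α → κ → E} {A : Set α} {a : α}
    (φ : E →ₐ[K] E') (h : Qc V (fun b i => φ (x b i)) A a) : Qc V x A a := by
  letI := φ.toRingHom.toAlgebra
  haveI : IsScalarTower K E E' := IsScalarTower.of_algebraMap_eq fun c => (φ.commutes c).symm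
  exact Qc.of_ac (E' := E') h

/-- the canonical generic tuple -/
def gtup (j : ℕ) (V : Set (κ → K)) [(vI (pw (Fin j) V)).IsPrime] : Fin j → κ → GFd (pw (Fin j) V) :=
  fun a i => gpt (pw (Fin j) V) (a, i)

theorem genT_gtup (j : ℕ) (V : Set (κ → K)) [(vI (pw (Fin j) V)).IsPrime] : GenT V (gtup j V) :=
  gen_gpt _

theorem GenT.hom {j : ℕ} {V : Set (κ → K)} [(vI (pw (Fin j) V)).IsPrime] {x : Fin j → κ → E}
    (hx : GenT V x) : ∃ φ : GFd (pw (Fin j) V) →ₐ[K] E, (fun a i => φ (gtup j V a i)) = x := by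
  obtain ⟨φ, hφ⟩ := Gen.exists_hom (V := pw (Fin j) V) hx
  exact ⟨φ, by funext a i; exact hφ (a, i)⟩

theorem charZero_alg (K E : Type*) [Field K] [CharZero K] [Field E] [Algebra K E] : CharZero E :=
  charZero_of_injective_algebraMap (algebraMap K E).injective

/-- everything needed about the cone in the sequel -/
structure Hyp (V : Set (κ → K)) (n j : ℕ) : Prop where
  cone : ∀ v ∈ V, ∀ c : K, c • v ∈ V
  zero : (0 : κ → K) ∈ V
  nz : ∃ v ∈ V, v ≠ 0
  prime : (vI V).IsPrime
  one : 1 ≤ n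
  tdim : ∀ (_ : (vI V).IsPrime), Module.finrank (GFd V) (tsp V (gpt V)) = n + 1
  ind : ∀ (_ : (vI (pw (Fin j) V)).IsPrime), iSupIndep fun a => tsp V (gtup j V a)
  qc : ∀ (_ : (vI (pw (Fin j) V)).IsPrime), ∀ b, Qc V (gtup j V) Set.univ b

theorem Gen.ne_zero {V : Set (κ → K)} (hnz : ∃ v ∈ V, v ≠ 0) {x : κ → E} (hx : Gen V x) : x ≠ 0 := by
  rintro rfl
  obtain ⟨v, hv, h0⟩ := hnz
  apply h0
  funext i
  have := (hx (MvPolynomial.X i)).1 (by simp) v hv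
  simpa using this

theorem finrank_iSup_le' {α : Type*} [Fintype α] (W : α → Submodule E (κ → E)) :
    Module.finrank E (⨆ a, W a : Submodule E (κ → E)) ≤ ∑ a, Module.finrank E (W a) := by
  classical
  rw [Submodule.iSup_eq_range_dfinsupp_lsum]
  have := LinearMap.finrank_range_le (DFinsupp.lsum ℕ (M := fun a => W a) fun i => (W i).subtype)
  refine this.trans (le_of_eq ?_)
  exact Module.finrank_directSum E (fun a => W a)

theorem finrank_iSup_eq {α : Type*} [Fintype α] (W : α → Submodule E (κ → E)) (h : iSupIndep W) :
    Module.finrank E (⨆ a, W a : Submodule E (κ → E)) = ∑ a, Module.finrank E (W a) := by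
  classical
  rw [Submodule.iSup_eq_range_dfinsupp_lsum, LinearMap.finrank_range_of_inj h.dfinsupp_lsum_injective]
  exact Module.finrank_directSum E (fun a => W a)

end SetupA

theorem hyp_of [IsAlgClosed K] [CharZero K] {r n k : ℕ} (hι : Fintype.card ι = r + 1)
    {X : Set (PP K ι)} (hX : IsIntegralVariety X) (hXnd : Nondegenerate X)
    (hXdim : zdim X = ((n : ℕ∞) : WithBot ℕ∞)) (hk : 1 ≤ k) (hnl : ¬UniruledByLines X)
    (hsec : zdim (secant (k + n - 1) X) = ((((k + n - 1) * (n + 1) - 1 : ℕ) : ℕ∞) : WithBot ℕ∞))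
    (hlt : (k + n - 1) * (n + 1) - 1 < r) :
    X.Infinite ∧ ∀ j, 1 ≤ j → j ≤ k → Hyp (coneOf X) n j := by
  classical
  haveI : Infinite K := IsAlgClosed.instInfinite
  have hprime : (vI (coneOf X)).IsPrime := vI_prime hX.2
  have hspan : Submodule.span K (coneOf X) = ⊤ := hXnd
  have hVc : ∀ v ∈ coneOf X, ∀ c : K, c • v ∈ coneOf X := fun v hv c => coneOf_smul c hv
  have hV0 := zero_mem_coneOf hX.2.1
  have hVn : (coneOf X).Nonempty := ⟨_, hV0⟩
  have hnz : ∃ v ∈ coneOf X, v ≠ 0 := by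
    obtain ⟨x, hx⟩ := hX.2.1
    exact ⟨x.rep, rep_mem_coneOf hx, x.rep_nonzero⟩
  haveI := charZero_alg K (GFd (coneOf X))
  have hg := gen_gpt (coneOf X)
  have hinf : X.Infinite := by
    intro hfin
    obtain ⟨x, -, hx⟩ := irr_subset_finite hX.2 hfin le_rfl
    have h1 : vspan X ≤ Submodule.span K {x.rep} := by
      refine Submodule.span_le.2 fun v hv => ?_
      obtain ⟨y, hy, hvy⟩ := mem_coneOf.1 hv
      rw [Set.mem_singleton_iff.1 (hx hy)] at hvy
      obtain ⟨c, rfl⟩ := mem_submodule_iff.1 hvy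
      exact Submodule.smul_mem _ _ (Submodule.mem_span_singleton_self _)
    have h2 := Submodule.finrank_mono h1
    rw [hXnd, finrank_top, Module.finrank_fintype_fun_eq_card, hι] at h2
    have := finrank_span_singleton (K := K) x.rep_nonzero
    omega
  have hT := finrank_tsp_le hX hXdim.le
  have hn : 1 ≤ n := by
    by_contra hn
    have hn : n = 0 := by omega
    subst hn
    have h1 : Submodule.span _ {gpt (coneOf X)} = tsp (coneOf X) (gpt (coneOf X)) := by
      apply Submodule.eq_of_le_of_finrank_le
      · rw [Submodule.span_singleton_le_iff_mem]
        exact self_mem_tsp hVc fun f hf => (hg f).2 hf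
      · rw [finrank_span_singleton (hg.ne_zero hnz)]; exact hT
    have h2 := stable_eq_top hspan hg _ (fun δ w hw => ?_)
      (self_mem_tsp hVc fun f hf => (hg f).2 hf)
    · rw [h2, finrank_top, Module.finrank_fintype_fun_eq_card, hι] at hT
      omega
    · rw [← h1] at hw
      obtain ⟨c, rfl⟩ := Submodule.mem_span_singleton.1 hw
      have : dv δ (c • gpt (coneOf X)) = c • dv δ (gpt (coneOf X)) + δ c • gpt (coneOf X) := by
        funext i; simp [dv, mul_comm]
      rw [this]
      exact Submodule.add_mem _ (Submodule.smul_mem _ _ (hg.dv_mem δ))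
        (Submodule.smul_mem _ _ (self_mem_tsp hVc fun f hf => (hg f).2 hf))
  refine ⟨hinf, ?_⟩
  obtain ⟨s, hs⟩ : ∃ s, s = k + n - 1 := ⟨_, rfl⟩
  rw [← hs] at hsec hlt
  have hs1 : 1 ≤ s := by omega
  haveI hps : (vI (pw (Fin s) (coneOf X))).IsPrime := pw_prime hprime
  haveI := charZero_alg K (GFd (pw (Fin s) (coneOf X)))
  set x := gtup s (coneOf X) with hxdef
  have hx : GenT (coneOf X) x := genT_gtup s _
  have hpos : 1 ≤ s * (n + 1) := Nat.mul_pos hs1 (by omega)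
  have hI := ind_of_zdim hsec.ge
  rw [vI_secant hinf hs1, Nat.sub_add_cancel hpos] at hI
  have hfr := hI.le_finrank (gen_sum hx)
  rw [tsp_sum hVn hx] at hfr
  have hTx : ∀ a, Module.finrank (GFd (pw (Fin s) (coneOf X))) (tsp (coneOf X) (x a)) ≤ n + 1 := fun a => by
    rw [(hx.gen hVn a).finrank_eq hg]; exact hT
  obtain ⟨hind, hdim⟩ := indep_of_finrank (fun a => tsp (coneOf X) (x a)) hTx (by simpa using hfr)
  have htd : Module.finrank (GFd (coneOf X)) (tsp (coneOf X) (gpt (coneOf X))) = n + 1 := by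
    rw [hg.finrank_eq (hx.gen hVn ⟨0, hs1⟩)]; exact hdim _
  have hMu : Msp (coneOf X) x Set.univ = ⨆ a, tsp (coneOf X) (x a) := by simp [Msp]
  have hQ1 : ctc (coneOf X) (gpt (coneOf X)) (tsp (coneOf X) (gpt (coneOf X))) ≤ Submodule.span _ {gpt (coneOf X)} := by
    by_contra h
    exact hnl (uniruled_of_ctc hX h)
  have hF : ∀ a, ctc (coneOf X) (x a) (tsp (coneOf X) (x a)) ≤ Submodule.span _ {x a} := by
    intro a
    obtain ⟨φ, hφ⟩ := (hx.gen hVn a).exists_hom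
    have h1 : Qc (coneOf X) (fun _ : Unit => gpt (coneOf X)) Set.univ () := by
      simpa [Qc, Msp] using hQ1
    have h2 := h1.hom φ
    have h3 : (fun (_ : Unit) i => φ (gpt (coneOf X) i)) = fun _ => x a := by
      funext _ i; exact hφ i
    rw [h3] at h2
    simpa [Qc, Msp] using h2
  have htop : (⨆ a, tsp (coneOf X) (x a)) ≠ ⊤ := by
    intro h
    have h1 : Module.finrank (GFd (pw (Fin s) (coneOf X))) (⨆ a, tsp (coneOf X) (x a) : Submodule _ _) ≤ s * (n + 1) := by
      have := finrank_iSup_le' (fun a => tsp (coneOf X) (x a))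
      simpa [hdim] using this
    rw [h, finrank_top, Module.finrank_fintype_fun_eq_card, hι] at h1
    omega
  obtain ⟨A, a, hA, haA, hQ⟩ := chain hVc hVn hspan hx (fun a => (hx.gen hVn a).ne_zero hnz) hind n k hn hk
    (by simp; omega) hTx hF (by simpa [hMu] using htop)
  intro j hj1 hjk
  have emb : ∀ b : Fin j, ∃ e : Fin j → Fin s, Function.Injective e ∧ e b = a ∧ ∀ c, e c ∈ A := by
    intro b
    obtain ⟨B, hB1, hB2⟩ := Finset.exists_subset_card_eq (s := A.erase a) (n := j - 1) (by
      rw [Finset.card_erase_of_mem haA]; omega)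
    have hc : (insert a B).card = j := by
      rw [Finset.card_insert_of_notMem (fun h => by simpa using hB1 h), hB2]; omega
    let f := (insert a B).equivFinOfCardEq hc
    let c := f ⟨a, Finset.mem_insert_self _ _⟩
    refine ⟨fun d => (f.symm (Equiv.swap b c d)).1, ?_, ?_, ?_⟩
    · intro d d' h
      exact (Equiv.swap b c).injective (f.symm.injective (Subtype.ext h))
    · simp [c]
    · intro d
      have := (f.symm (Equiv.swap b c d)).2
      rcases Finset.mem_insert.1 this with h | h
      · simp only [h]; exact haA
      · exact Finset.mem_of_mem_erase (hB1 h)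
  refine ⟨hVc, hV0, hnz, hprime, hn, fun _ => htd, ?_, ?_⟩
  · intro hpj
    haveI := charZero_alg K (GFd (pw (Fin j) (coneOf X)))
    obtain ⟨e, he, -, -⟩ := emb ⟨0, hj1⟩
    have hxe := hx.comp hVn he
    have h1 : Module.finrank (GFd (pw (Fin s) (coneOf X))) (⨆ a, tsp (coneOf X) (x (e a)) : Submodule _ _) = j * (n + 1) := by
      rw [finrank_iSup_eq (fun a => tsp (coneOf X) (x (e a))) (hind.comp he)]
      simp [hdim]
    have h2 := (gen_sum hxe).ind
    rw [tsp_sum hVn hxe, h1] at h2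
    have hy := genT_gtup j (coneOf X)
    have h3 := h2.le_finrank (gen_sum hy)
    rw [tsp_sum hVn hy] at h3
    exact (indep_of_finrank (N := n + 1) _ (fun a => by rw [(hy.gen hVn a).finrank_eq hg]; exact hT) (by simpa using h3)).1
  · intro hpj b
    obtain ⟨e, he, heb, heA⟩ := emb b
    obtain ⟨φ, hφ⟩ := (hx.comp hVn he).hom
    refine Qc.of_hom φ ?_
    rw [hφ]
    have h1 : Msp (coneOf X) (fun c => x (e c)) Set.univ ≤ Msp (coneOf X) x ↑A :=
      iSup₂_le fun c _ => tsp_le_Msp (heA c)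
    refine (ctc_mono _ _ h1).trans ?_
    have : Qc (coneOf X) x ↑A a := hQ
    rw [← heb] at this
    exact this

section Rows
variable {κ : Type*} [Fintype κ] {β : Type*}

theorem spec_eq {W : Set (β → K)} [(vI W).IsPrime] {p q : MvPolynomial β K}
    (h : MvPolynomial.aeval (gpt W) p = MvPolynomial.aeval (gpt W) q) {u : β → K} (hu : u ∈ W) :
    MvPolynomial.eval u p = MvPolynomial.eval u q := by
  have h1 : MvPolynomial.aeval (gpt W) (p - q) = 0 := by rw [map_sub, h, sub_self]
  have h2 := (gen_gpt W _).1 h1 u hu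
  rwa [map_sub, sub_eq_zero] at h2

/-- rows which, after specialization, kill the test vectors -/
def grow (W : Set (β → K)) [(vI W).IsPrime] (Z : (β → K) → Set (κ → K)) :
    Submodule (GFd W) (κ → GFd W) where
  carrier := {ρ | ∃ (D : MvPolynomial β K) (N : κ → MvPolynomial β K), D ∉ vI W ∧
    (∀ i, MvPolynomial.aeval (gpt W) D * ρ i = MvPolynomial.aeval (gpt W) (N i)) ∧
    ∀ u ∈ W, MvPolynomial.eval u D ≠ 0 → ∀ z ∈ Z u, ∑ i, MvPolynomial.eval u (N i) * z i = 0}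
  zero_mem' := ⟨1, 0, fun h => (Ideal.ne_top_iff_one _).1 (Ideal.IsPrime.ne_top inferInstance) h,
    by simp, by simp⟩
  add_mem' := by
    rintro ρ σ ⟨D, N, hD, h1, h2⟩ ⟨D', N', hD', h1', h2'⟩
    refine ⟨D * D', fun i => D' * N i + D * N' i, ?_, fun i => ?_, fun u hu hDu z hz => ?_⟩
    · intro h
      exact (Ideal.IsPrime.mem_or_mem inferInstance h).elim hD hD'
    · simp only [map_mul, map_add, Pi.add_apply, ← h1, ← h1']; ring
    · rw [map_mul] at hDu
      have e1 := h2 u hu (left_ne_zero_of_mul hDu) z hz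
      have e2 := h2' u hu (right_ne_zero_of_mul hDu) z hz
      simp only [map_mul, map_add, add_mul, Finset.sum_add_distrib, mul_assoc, ← Finset.mul_sum, e1, e2]
      simp
  smul_mem' := by
    rintro c ρ ⟨D, N, hD, h1, h2⟩
    obtain ⟨D', N', hD', h1'⟩ := exists_clear W (fun _ : Unit => c)
    refine ⟨D * D', fun i => N' () * N i, ?_, fun i => ?_, fun u hu hDu z hz => ?_⟩
    · intro h
      exact (Ideal.IsPrime.mem_or_mem inferInstance h).elim hD hD'
    · simp only [map_mul, Pi.smul_apply, smul_eq_mul, ← h1, ← h1']; ring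
    · rw [map_mul] at hDu
      have e1 := h2 u hu (left_ne_zero_of_mul hDu) z hz
      simp only [map_mul, mul_assoc, ← Finset.mul_sum, e1]
      simp

theorem grow_spec {W : Set (β → K)} [(vI W).IsPrime] {Z : (β → K) → Set (κ → K)}
    {R : κ → MvPolynomial β K} (h : (fun i => MvPolynomial.aeval (gpt W) (R i)) ∈ grow W Z) :
    ∃ D ∉ vI W, ∀ u ∈ W, MvPolynomial.eval u D ≠ 0 → ∀ z ∈ Z u, ∑ i, MvPolynomial.eval u (R i) * z i = 0 := by
  obtain ⟨D, N, hD, h1, h2⟩ := h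
  refine ⟨D, hD, fun u hu hDu z hz => ?_⟩
  have h3 := h2 u hu hDu z hz
  have h4 : ∀ i, MvPolynomial.eval u (N i) = MvPolynomial.eval u D * MvPolynomial.eval u (R i) := by
    intro i
    rw [← map_mul]
    refine spec_eq ?_ hu
    rw [map_mul]; exact (h1 i).symm
  simp only [h4, mul_assoc, ← Finset.mul_sum] at h3
  exact (mul_eq_zero.1 h3).resolve_left hDu

theorem clear_fs {V : Set (κ → K)} (W : Set (β → K)) [(vI W).IsPrime] (c : vI V →₀ GFd W) :
    ∃ (D : MvPolynomial β K) (C : vI V → MvPolynomial β K), D ∉ vI W ∧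
      ∀ h ∈ c.support, MvPolynomial.aeval (gpt W) D * c h = MvPolynomial.aeval (gpt W) (C h) := by
  classical
  obtain ⟨D, N, hD, h⟩ := exists_clear W (fun h : c.support => c h.1)
  refine ⟨D, fun h => if hh : h ∈ c.support then N ⟨h, hh⟩ else 0, hD, fun g hg => ?_⟩
  simp only [dif_pos hg]; exact h ⟨g, hg⟩

theorem aeval_row {j : ℕ} {V : Set (κ → K)} [(vI (pw (Fin j) V)).IsPrime] (b : Fin j) (f : MvPolynomial κ K) :
    MvPolynomial.aeval (gpt (pw (Fin j) V)) (MvPolynomial.rename (Prod.mk b) f) =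
      MvPolynomial.aeval (gtup j V b) f := by
  rw [MvPolynomial.aeval_rename]; rfl

theorem eval_row {j : ℕ} (u : Fin j × κ → K) (b : Fin j) (f : MvPolynomial κ K) :
    MvPolynomial.eval u (MvPolynomial.rename (Prod.mk b) f) = MvPolynomial.eval (fun i => u (b, i)) f := by
  rw [MvPolynomial.eval_rename]; rfl

theorem kill_spec {j : ℕ} {V : Set (κ → K)} [(vI (pw (Fin j) V)).IsPrime] (b : Fin j)
    (L : κ → MvPolynomial (Fin j × κ) K)
    (hL : ∀ z ∈ tsp V (gtup j V b), ∑ i, z i * MvPolynomial.aeval (gpt (pw (Fin j) V)) (L i) = 0) :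
    ∃ D ∉ vI (pw (Fin j) V), ∀ u ∈ pw (Fin j) V, MvPolynomial.eval u D ≠ 0 →
      ∀ z ∈ tsp V (fun i => u (b, i)), ∑ i, z i * MvPolynomial.eval u (L i) = 0 := by
  classical
  let l : Module.Dual (GFd (pw (Fin j) V)) (κ → GFd (pw (Fin j) V)) :=
    ∑ i, MvPolynomial.aeval (gpt (pw (Fin j) V)) (L i) • LinearMap.proj i
  have hl : ∀ z, l z = ∑ i, z i * MvPolynomial.aeval (gpt (pw (Fin j) V)) (L i) := by
    intro z; simp [l, mul_comm]
  obtain ⟨c, hc⟩ := exists_cd l (fun z hz => by rw [hl]; exact hL z hz)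
  obtain ⟨D, C, hD, hC⟩ := clear_fs (pw (Fin j) V) c
  refine ⟨D, hD, fun u hu hDu z hz => ?_⟩
  have key : ∀ i, MvPolynomial.eval u (D * L i) = MvPolynomial.eval u
      (∑ h ∈ c.support, C h * MvPolynomial.rename (Prod.mk b) (MvPolynomial.pderiv i h.1)) := by
    intro i
    refine spec_eq ?_ hu
    have := hc (Pi.single i 1)
    rw [hl] at this
    simp only [Pi.single_apply, ite_mul, zero_mul, one_mul, Finset.sum_ite_eq', Finset.mem_univ, if_true] at this
    rw [map_mul, ← this, cd, Finsupp.sum, Finset.mul_sum, map_sum]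
    refine Finset.sum_congr rfl fun h hh => ?_
    rw [map_mul, ← hC h hh, aeval_row, mul_assoc]
    congr 2
    simp [dd, Pi.single_apply]
  have h5 : MvPolynomial.eval u D * ∑ i, z i * MvPolynomial.eval u (L i) = 0 := by
    calc _ = ∑ i, z i * MvPolynomial.eval u (D * L i) := by
          rw [Finset.mul_sum]; refine Finset.sum_congr rfl fun i _ => ?_
          rw [map_mul]; ring
      _ = ∑ h ∈ c.support, MvPolynomial.eval u (C h) * dd (fun i => u (b, i)) h.1 z := by
          simp only [key, map_sum, map_mul, eval_row, Finset.mul_sum, dd]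
          rw [Finset.sum_comm]
          refine Finset.sum_congr rfl fun h _ => Finset.sum_congr rfl fun i _ => ?_
          rw [MvPolynomial.aeval_eq_eval]; ring
      _ = 0 := Finset.sum_eq_zero fun h _ => by rw [hz h.1 h.2, mul_zero]
  exact (mul_eq_zero.1 h5).resolve_left hDu

/-- contact vectors at the `a`-th point of `u` -/
def ctst {j : ℕ} (V : Set (κ → K)) (a : Fin j) (u : Fin j × κ → K) : Set (κ → K) :=
  {z | (fun i => u (a, i)) ≠ 0 ∧ ∃ C ⊆ V,
    (∀ y ∈ C, y ≠ 0 → tsp V y ≤ Msp V (fun b i => u (b, i)) Set.univ) ∧ z ∈ tsp C (fun i => u (a, i))}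

theorem grow_grad {j : ℕ} {V : Set (κ → K)} [(vI (pw (Fin j) V)).IsPrime] (a : Fin j)
    {f : MvPolynomial κ K} (hf : f ∈ vI V) :
    (fun i => MvPolynomial.aeval (gtup j V a) (MvPolynomial.pderiv i f)) ∈ grow (pw (Fin j) V) (ctst V a) := by
  refine ⟨1, fun i => MvPolynomial.rename (Prod.mk a) (MvPolynomial.pderiv i f),
    fun h => (Ideal.ne_top_iff_one _).1 (Ideal.IsPrime.ne_top inferInstance) h, fun i => ?_, ?_⟩
  · rw [aeval_row, map_one, one_mul]
  · rintro u hu - z ⟨-, C, hC, -, hz⟩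
    have := hz f (vI_mono hC hf)
    rw [← this, dd]
    refine Finset.sum_congr rfl fun i _ => ?_
    rw [eval_row, MvPolynomial.aeval_eq_eval]; ring

theorem dd_sum {τ : Type*} (p : κ → K) (s : Finset τ) (F : τ → MvPolynomial κ K) (z : κ → K) :
    dd p (∑ t ∈ s, F t) z = ∑ t ∈ s, dd p (F t) z := by
  simp only [dd, map_sum, Finset.mul_sum]
  rw [Finset.sum_comm]

theorem grow_hess {j : ℕ} {V : Set (κ → K)} [DecidableEq κ] [(vI (pw (Fin j) V)).IsPrime] (a : Fin j)
    (c : vI V →₀ GFd (pw (Fin j) V)) (hc : ∀ z ∈ Msp V (gtup j V) Set.univ, cd (gtup j V a) c z = 0)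
    {w : κ → GFd (pw (Fin j) V)} (hw : w ∈ tsp V (gtup j V a)) :
    (fun i => ch (gtup j V a) c (Pi.single i 1) w) ∈ grow (pw (Fin j) V) (ctst V a) := by
  classical
  obtain ⟨D1, C, hD1, hC⟩ := clear_fs (pw (Fin j) V) c
  obtain ⟨D2, N, hD2, hN⟩ := exists_clear (pw (Fin j) V) w
  let L : κ → MvPolynomial (Fin j × κ) K := fun i =>
    ∑ h ∈ c.support, C h * MvPolynomial.rename (Prod.mk a) (MvPolynomial.pderiv i h.1)
  have hL : ∀ b, ∀ z ∈ tsp V (gtup j V b),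
      ∑ i, z i * MvPolynomial.aeval (gpt (pw (Fin j) V)) (L i) = 0 := by
    intro b z hz
    have h1 := hc z (tsp_le_Msp (Set.mem_univ b) hz)
    have h2 : ∑ i, z i * MvPolynomial.aeval (gpt (pw (Fin j) V)) (L i) =
        MvPolynomial.aeval (gpt (pw (Fin j) V)) D1 * cd (gtup j V a) c z := by
      simp only [L, map_sum, map_mul, aeval_row, Finset.mul_sum, cd, Finsupp.sum, dd]
      rw [Finset.sum_comm]
      refine Finset.sum_congr rfl fun h hh => Finset.sum_congr rfl fun i _ => ?_
      rw [← hC h hh]; ring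
    rw [h2, h1, mul_zero]
  choose Db hDb hDb' using fun b => kill_spec b L (hL b)
  refine ⟨D1 * D2 * ∏ b, Db b, fun i => (∏ b, Db b) * ∑ h ∈ c.support, C h * ∑ k, N k *
    MvPolynomial.rename (Prod.mk a) (MvPolynomial.pderiv i (MvPolynomial.pderiv k h.1)), ?_, ?_, ?_⟩
  · intro h
    rcases Ideal.IsPrime.mem_or_mem inferInstance h with h | h
    · exact (Ideal.IsPrime.mem_or_mem inferInstance h).elim hD1 hD2
    · obtain ⟨b, -, hb⟩ := (Ideal.IsPrime.prod_mem_iff (hp := inferInstance)).1 h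
      exact hDb b hb
  · intro i
    simp only [map_mul, map_sum, aeval_row, ch, Finsupp.sum, Finset.mul_sum, hs]
    refine Finset.sum_congr rfl fun h hh => Finset.sum_congr rfl fun k _ => ?_
    rw [← hC h hh, ← hN]
    have : dd (gtup j V a) (MvPolynomial.pderiv k h.1) (Pi.single i 1) =
        MvPolynomial.aeval (gtup j V a) (MvPolynomial.pderiv i (MvPolynomial.pderiv k h.1)) := by
      simp [dd, Pi.single_apply]
    rw [this]; ring
  · rintro u hu hDu z ⟨hu0, S, hSV, hS, hz⟩
    have hDbu : ∀ b, MvPolynomial.eval u (Db b) ≠ 0 := by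
      intro b h
      apply hDu
      rw [map_mul, map_prod, Finset.prod_eq_zero (Finset.mem_univ b) h, mul_zero]
    choose N' hN' using fun k => exists_eval_sub a u (N k)
    let G : MvPolynomial κ K := ∑ k, (MvPolynomial.C (MvPolynomial.eval u (L k)) -
      ∑ h ∈ c.support, MvPolynomial.C (MvPolynomial.eval u (C h)) * MvPolynomial.pderiv k h.1) * N' k
    have htan : ∀ y ∈ V, (fun k => MvPolynomial.eval y (N' k)) ∈ tsp V y := by
      intro y hy f hf
      have hy' : (fun p : Fin j × κ => if p.1 = a then y p.2 else u p) ∈ pw (Fin j) V := by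
        intro b
        by_cases hb : b = a
        · simpa [hb] using hy
        · simpa [hb] using hu b
      have h1 := spec_eq (W := pw (Fin j) V) (p := ∑ k, N k * MvPolynomial.rename (Prod.mk a) (MvPolynomial.pderiv k f))
        (q := 0) (by
          have := hw f hf
          simp only [map_sum, map_mul, aeval_row, ← hN, mul_assoc, ← Finset.mul_sum]
          rw [dd] at this
          rw [this, mul_zero, map_zero]) hy'
      simp only [map_sum, map_mul, eval_row, if_true, map_zero] at h1
      simp only [dd, hN', MvPolynomial.aeval_eq_eval]
      exact h1
    have hGy : ∀ y ∈ S, y ≠ 0 → MvPolynomial.eval y G = 0 := by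
      intro y hy hy0
      have h1 : ∑ k, MvPolynomial.eval y (N' k) * MvPolynomial.eval u (L k) = 0 := by
        have h2 : Msp V (fun b i => u (b, i)) Set.univ ≤
            LinearMap.ker (∑ k, MvPolynomial.eval u (L k) • LinearMap.proj k : (κ → K) →ₗ[K] K) := by
          refine iSup₂_le fun b _ v hv => ?_
          rw [LinearMap.mem_ker, ← hDb' b u hu (hDbu b) v hv]
          simp [mul_comm]
        have h3 := h2 (hS y hy hy0 (htan y (hSV hy)))
        rw [LinearMap.mem_ker] at h3
        rw [← h3]; simp [mul_comm]
      have h4 : ∀ h : vI V, ∑ k, MvPolynomial.eval y (N' k) * MvPolynomial.eval y (MvPolynomial.pderiv k h.1) = 0 := by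
        intro h
        have := htan y (hSV hy) h.1 h.2
        rwa [dd, MvPolynomial.aeval_eq_eval] at this
      simp only [G, map_sum, map_mul, map_sub, MvPolynomial.eval_C, sub_mul, Finset.sum_sub_distrib, Finset.sum_mul]
      rw [Finset.sum_comm (s := Finset.univ) (t := c.support)]
      have h5 : ∑ k, MvPolynomial.eval u (L k) * MvPolynomial.eval y (N' k) = 0 := by
        rw [← h1]; exact Finset.sum_congr rfl fun k _ => mul_comm _ _
      rw [h5, zero_sub, neg_eq_zero]
      refine Finset.sum_eq_zero fun h _ => ?_
      rw [← mul_zero (MvPolynomial.eval u (C h)), ← h4 h, Finset.mul_sum]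
      exact Finset.sum_congr rfl fun k _ => by ring
    obtain ⟨i0, hi0⟩ := Function.ne_iff.1 hu0
    have hXG : MvPolynomial.X i0 * G ∈ vI S := by
      intro y hy
      rw [map_mul, MvPolynomial.eval_X]
      by_cases hy0 : y = 0
      · simp [hy0]
      · rw [hGy y hy hy0, mul_zero]
    have hfac : ∀ k, MvPolynomial.aeval (fun i => u (a, i)) (MvPolynomial.C (MvPolynomial.eval u (L k)) -
      ∑ h ∈ c.support, MvPolynomial.C (MvPolynomial.eval u (C h)) * MvPolynomial.pderiv k h.1) = 0 := by
      intro k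
      simp [MvPolynomial.aeval_eq_eval, L, eval_row]
    have hG0 : MvPolynomial.aeval (fun i => u (a, i)) G = 0 := by
      simp only [G, map_sum, map_mul, hfac, zero_mul, Finset.sum_const_zero]
    have h6 := hz _ hXG
    rw [dd_mul_poly, hG0, zero_mul, add_zero, MvPolynomial.aeval_X] at h6
    have h7 := (mul_eq_zero.1 h6).resolve_left hi0
    have dC : ∀ r : K, dd (fun i => u (a, i)) (MvPolynomial.C r : MvPolynomial κ K) z = 0 := by
      intro r; simp [dd]
    have hNu : ∀ k, MvPolynomial.aeval (fun i => u (a, i)) (N' k) = MvPolynomial.eval u (N k) := by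
      intro k
      rw [MvPolynomial.aeval_eq_eval, hN']
      congr 2
      funext p
      split_ifs with h
      · rw [← h]
      · rfl
    simp only [G, dd_sum, dd_mul_poly, hfac, zero_mul, zero_add, dd_sub_poly, dC, mul_zero, add_zero, hNu,
      MvPolynomial.aeval_C, zero_sub, Algebra.algebraMap_self, RingHom.id_apply] at h7
    simp only [map_mul, map_sum, eval_row, mul_assoc, ← Finset.mul_sum]
    refine mul_eq_zero_of_right _ ?_
    rw [← neg_eq_zero, ← h7, ← Finset.sum_neg_distrib]
    simp only [dd, MvPolynomial.aeval_eq_eval, Finset.sum_mul, Finset.mul_sum, ← Finset.sum_neg_distrib]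
    calc _ = ∑ h ∈ c.support, ∑ i, ∑ k, _ := Finset.sum_comm
      _ = ∑ h ∈ c.support, ∑ k, ∑ i, _ := Finset.sum_congr rfl fun h _ => by
          rw [Finset.sum_comm]
          refine Finset.sum_congr rfl fun k _ => Finset.sum_congr rfl fun i _ => ?_
          rw [show ∀ A B C D : K, -(A * (B * C) * D) = B * -(A * (D * C)) by intros; ring]
      _ = _ := Finset.sum_comm

end Rows

section SpecT
variable {κ : Type*} [Fintype κ]

theorem ch_lin {E : Type*} [Field E] [Algebra K E] [DecidableEq κ] {V : Set (κ → K)} (p : κ → E) (c : vI V →₀ E)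
    (z w : κ → E) : ch p c z w = ∑ i, ch p c (Pi.single i 1) w * z i := by
  have hd : ∀ (f : MvPolynomial κ K), dd p f z = ∑ i, dd p f (Pi.single i 1) * z i := by
    intro f
    simp [dd, Pi.single_apply, mul_comm]
  simp only [ch, hs, Finsupp.sum, hd, Finset.mul_sum, Finset.sum_mul]
  calc _ = ∑ f ∈ c.support, ∑ i, ∑ k, _ := Finset.sum_congr rfl fun f _ => Finset.sum_comm
    _ = ∑ i, ∑ f ∈ c.support, ∑ k, _ := Finset.sum_comm
    _ = _ := Finset.sum_congr rfl fun i _ => Finset.sum_congr rfl fun f _ => Finset.sum_congr rfl fun k _ => by ring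

theorem grow_par {V : Set (κ → K)} {n j : ℕ} [DecidableEq κ] (hH : Hyp V n j) [hp : (vI (pw (Fin j) V)).IsPrime]
    (a : Fin j) (i0 i : κ) :
    (fun k => MvPolynomial.aeval (gpt (pw (Fin j) V))
      ((if k = i then MvPolynomial.X (a, i0) else 0) - (if k = i0 then MvPolynomial.X (a, i) else 0) :
        MvPolynomial (Fin j × κ) K)) ∈ grow (pw (Fin j) V) (ctst V a) := by
  classical
  by_contra hcon
  obtain ⟨l, hl0, hl⟩ := Submodule.exists_dual_map_eq_bot_of_notMem hcon inferInstance
  have hl' : ∀ ρ ∈ grow (pw (Fin j) V) (ctst V a), l ρ = 0 := by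
    intro ρ hρ
    have : l ρ ∈ Submodule.map l (grow (pw (Fin j) V) (ctst V a)) := ⟨ρ, hρ, rfl⟩
    rwa [hl, Submodule.mem_bot] at this
  let z : κ → GFd (pw (Fin j) V) := fun i => l (Pi.single i 1)
  have hlz : ∀ ρ, l ρ = ∑ i, ρ i * z i := by
    intro ρ
    conv_lhs => rw [← Finset.univ_sum_single ρ]
    rw [map_sum]
    refine Finset.sum_congr rfl fun i _ => ?_
    rw [show (Pi.single i (ρ i) : κ → GFd (pw (Fin j) V)) = ρ i • Pi.single i 1 by
      rw [← Pi.single_smul, smul_eq_mul, mul_one], map_smul, smul_eq_mul]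
  have hz : z ∈ ctc V (gtup j V a) (Msp V (gtup j V) Set.univ) := by
    refine ⟨fun f hf => ?_, fun c hc w hw => ?_⟩
    · have := hl' _ (grow_grad a hf)
      rw [hlz] at this
      rw [← this, dd]
      exact Finset.sum_congr rfl fun i _ => mul_comm _ _
    · have := hl' _ (grow_hess a c hc hw)
      rw [hlz] at this
      rw [ch_lin, this]
  obtain ⟨s, hs⟩ := Submodule.mem_span_singleton.1 (hH.qc hp a hz)
  apply hl0
  rw [hlz, ← hs]
  simp only [map_sub, sub_mul, Finset.sum_sub_distrib, apply_ite (MvPolynomial.aeval (gpt (pw (Fin j) V))), map_zero,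
    MvPolynomial.aeval_X, ite_mul, zero_mul, Finset.sum_ite_eq', Finset.mem_univ, if_true, Pi.smul_apply, smul_eq_mul]
  simp only [gtup]
  ring

theorem spec_tangent {V : Set (κ → K)} {n j : ℕ} (hH : Hyp V n j) [hp : (vI (pw (Fin j) V)).IsPrime] :
    ∃ D ∉ vI (pw (Fin j) V), ∀ u ∈ pw (Fin j) V, MvPolynomial.eval u D ≠ 0 → ∀ a,
      (fun i => u (a, i)) ≠ 0 ∧ ∀ z ∈ ctst V a u, ∃ s : K, z = s • (fun i => u (a, i)) := by
  classical
  obtain ⟨v, hv, hv0⟩ := hH.nz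
  obtain ⟨i0, hi0⟩ := Function.ne_iff.1 hv0
  choose D hD hD' using fun a i => grow_spec (grow_par hH a i0 i)
  refine ⟨∏ a, (MvPolynomial.X (a, i0) * ∏ i, D a i), fun h => ?_, fun u hu hDu a => ?_⟩
  · obtain ⟨a, -, ha⟩ := (Ideal.IsPrime.prod_mem_iff (hp := inferInstance)).1 h
    rcases Ideal.IsPrime.mem_or_mem inferInstance ha with ha | ha
    · have := ha (fun p => v p.2) (fun _ => hv)
      rw [MvPolynomial.eval_X] at this
      exact hi0 this
    · obtain ⟨i, -, hi⟩ := (Ideal.IsPrime.prod_mem_iff (hp := inferInstance)).1 ha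
      exact hD a i hi
  · rw [map_prod, Finset.prod_ne_zero_iff] at hDu
    have h1 := hDu a (Finset.mem_univ a)
    rw [map_mul, map_prod, MvPolynomial.eval_X] at h1
    have h2 := left_ne_zero_of_mul h1
    have h3 := Finset.prod_ne_zero_iff.1 (right_ne_zero_of_mul h1)
    refine ⟨fun h => h2 (congrFun h i0), fun z hz => ⟨z i0 / u (a, i0), ?_⟩⟩
    funext i
    have h4 := hD' a i u hu (h3 i (Finset.mem_univ i)) z hz
    simp only [map_sub, sub_mul, Finset.sum_sub_distrib, apply_ite (MvPolynomial.eval u), map_zero,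
      MvPolynomial.eval_X, ite_mul, zero_mul, Finset.sum_ite_eq', Finset.mem_univ, if_true] at h4
    simp only [Pi.smul_apply, smul_eq_mul]
    field_simp
    linear_combination h4

theorem finrank_tsp_le_one [CharZero K] {V : Set (κ → K)} [(vI V).IsPrime] {u : κ → K} (hu : u ∈ V) (hu0 : u ≠ 0)
    (h : ∀ z ∈ tsp V u, ∃ s : K, z = s • u) : Module.finrank (GFd V) (tsp V (gpt V)) ≤ 1 := by
  classical
  obtain ⟨i0, hi0⟩ := Function.ne_iff.1 hu0
  have hex : ∀ i, ∃ f ∈ vI V, ∀ z, dd u f z = z i - u i / u i0 * z i0 := by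
    intro i
    obtain ⟨c, hc⟩ := exists_cd (V := V) (p := u) (LinearMap.proj i - (u i / u i0) • LinearMap.proj i0 :
      Module.Dual K (κ → K)) (by
        intro z hz
        obtain ⟨s, rfl⟩ := h z hz
        have : u i0 ≠ 0 := hi0
        simp only [LinearMap.sub_apply, LinearMap.proj_apply, LinearMap.smul_apply, smul_eq_mul, Pi.smul_apply]
        field_simp
        ring)
    refine ⟨∑ f ∈ c.support, c f • f.1, Ideal.sum_mem _ fun f _ => ?_, fun z => ?_⟩
    · rw [MvPolynomial.smul_eq_C_mul]; exact Ideal.mul_mem_left _ _ f.2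
    · have := hc z
      simp only [LinearMap.sub_apply, LinearMap.proj_apply, LinearMap.smul_apply, smul_eq_mul] at this
      rw [← this, dd_sum, cd, Finsupp.sum]
      exact Finset.sum_congr rfl fun f _ => by rw [dd_smul_poly, smul_eq_mul]
  choose f hf hf' using hex
  let A : Matrix κ κ (MvPolynomial κ K) := fun i k =>
    if i = i0 then (if k = i0 then 1 else 0) else MvPolynomial.pderiv k (f i)
  have hAu : MvPolynomial.eval u A.det ≠ 0 := by
    rw [RingHom.map_det]
    intro h0
    obtain ⟨z, hz0, hz⟩ := Matrix.exists_mulVec_eq_zero_iff.2 h0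
    have hz' : ∀ i, ∑ k, MvPolynomial.eval u (A i k) * z k = 0 := fun i => congrFun hz i
    have h1 : z i0 = 0 := by
      have := hz' i0
      simpa [A, apply_ite (MvPolynomial.eval u)] using this
    apply hz0
    funext i
    by_cases hi : i = i0
    · rw [hi]; exact h1
    · have h2 := hz' i
      simp only [A, if_neg hi] at h2
      have h3 := hf' i z
      rw [dd, MvPolynomial.aeval_eq_eval, h1, mul_zero, sub_zero] at h3
      rw [Pi.zero_apply, ← h3, ← h2]
      exact Finset.sum_congr rfl fun k _ => mul_comm _ _
  have hA : MvPolynomial.aeval (gpt V) A.det ≠ 0 := fun h0 => hAu ((gen_gpt V _).1 h0 u hu)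
  have hinj : Function.Injective ((LinearMap.proj i0 : (κ → GFd V) →ₗ[GFd V] GFd V).domRestrict (tsp V (gpt V))) := by
    rw [← LinearMap.ker_eq_bot, LinearMap.ker_eq_bot']
    rintro ⟨z, hz⟩ h0
    have h0' : z i0 = 0 := h0
    rw [Subtype.ext_iff]
    change z = 0
    by_contra hz0
    apply hA
    rw [AlgHom.map_det]
    refine Matrix.exists_mulVec_eq_zero_iff.1 ⟨z, hz0, ?_⟩
    funext i
    change ∑ k, MvPolynomial.aeval (gpt V) (A i k) * z k = 0
    by_cases hi : i = i0
    · simp [A, hi, apply_ite (MvPolynomial.aeval (gpt V)), h0']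
    · simp only [A, if_neg hi]
      rw [← hz (f i) (hf i), dd]
      exact Finset.sum_congr rfl fun k _ => mul_comm _ _
  calc _ ≤ Module.finrank (GFd V) (GFd V) := LinearMap.finrank_le_finrank_of_injective hinj
    _ = 1 := Module.finrank_self _

end SpecT

theorem irr_singleton (x : PP K ι) : IsZIrreducible ({x} : Set (PP K ι)) := by
  refine ⟨⟨x, rfl⟩, fun Y Z _ _ h => ?_⟩
  simpa using h rfl

theorem irr_point [IsAlgClosed K] [CharZero K] {C : Set (PP K ι)} (hC : IsZIrreducible C) {x : PP K ι} (hx : x ∈ C)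
    {u : ι → K} (hu : u ∈ x.submodule) (hu0 : u ≠ 0) (h : ∀ z ∈ tsp (coneOf C) u, ∃ s : K, z = s • u) :
    C = {x} := by
  haveI := IsAlgClosed.instInfinite (K := K)
  by_contra hne
  haveI := vI_prime hC
  have h1 := finrank_tsp_le_one (mem_coneOf.2 ⟨x, hx, hu⟩) hu0 h
  have hlt : ({x} : Set (PP K ι)) < zcl C := by
    refine lt_of_le_of_ne (Set.singleton_subset_iff.2 (subset_zcl C hx)) fun he => hne ?_
    exact Set.Subset.antisymm (he ▸ subset_zcl C) (Set.singleton_subset_iff.2 hx)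
  have h2 := vI_lt_of_lt (isZClosed_singleton x) hlt
  rw [vI_zcl] at h2
  haveI := vI_prime (irr_singleton x)
  have h3 := Ind.drop (K := K) h2 (Ind.drop (K := K) (vI_lt_mI (Set.singleton_nonempty x)) Ind.zero_mI)
  haveI := charZero_alg K (GFd (coneOf C))
  have h4 := h3.le_finrank (gen_gpt (coneOf C))
  omega

theorem mem_tsp_homog [Infinite K] {V : Set (ι → K)} (hV : ∀ v ∈ V, ∀ c : K, c • v ∈ V) {p z : ι → K}
    (h : ∀ f ∈ vI V, ∀ d, f.IsHomogeneous d → dd p f z = 0) : z ∈ tsp V p := by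
  intro f hf
  rw [← MvPolynomial.sum_homogeneousComponent f, dd_sum]
  exact Finset.sum_eq_zero fun d _ => h _ (homogComp_mem_vI hV hf d) d
    (MvPolynomial.homogeneousComponent_isHomogeneous d f)

theorem tsp_smul_le [Infinite K] {V : Set (ι → K)} (hV : ∀ v ∈ V, ∀ c : K, c • v ∈ V) (p : ι → K) {c : K} (hc : c ≠ 0) :
    tsp V (c • p) ≤ tsp V p := by
  intro z hz
  refine mem_tsp_homog hV fun f hf d hd => ?_
  have h1 := hz f hf
  have h2 : dd (c • p) f z = c ^ (d - 1) * dd p f z := by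
    simp only [dd, Finset.mul_sum]
    refine Finset.sum_congr rfl fun i _ => ?_
    rw [eval_smul_homog (MvPolynomial.IsHomogeneous.pderiv hd)]; ring
  rw [h2] at h1
  exact (mul_eq_zero.1 h1).resolve_left (pow_ne_zero _ hc)

theorem tsp_smul_eq [Infinite K] {V : Set (ι → K)} (hV : ∀ v ∈ V, ∀ c : K, c • v ∈ V) (p : ι → K) {c : K} (hc : c ≠ 0) :
    tsp V (c • p) = tsp V p := by
  refine le_antisymm (tsp_smul_le hV p hc) ?_
  have := tsp_smul_le hV (c • p) (inv_ne_zero hc)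
  rwa [smul_smul, inv_mul_cancel₀ hc, one_smul] at this

theorem tsp_rep [Infinite K] {X : Set (PP K ι)} {x : PP K ι} {v : ι → K} (hv : v ∈ x.submodule) (h0 : v ≠ 0) :
    tsp (coneOf X) v = tsp (coneOf X) x.rep := by
  obtain ⟨c, rfl⟩ := mem_submodule_iff.1 hv
  exact tsp_smul_eq (fun v hv c => coneOf_smul c hv) _ (fun h => h0 (by rw [h, zero_smul]))

theorem embT_eq [Infinite K] (X : Set (PP K ι)) (x : PP K ι) :
    embTangentSpace X x = plin (tsp (coneOf X) x.rep) := by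
  ext y
  rw [plin_iff]
  constructor
  · intro h
    refine mem_tsp_homog (fun v hv c => coneOf_smul c hv) fun f hf d hd => ?_
    have := h f ⟨⟨d, hd⟩, fun x hx v hv => hf v (mem_coneOf.2 ⟨x, hx, hv⟩)⟩
    rwa [dd, MvPolynomial.aeval_eq_eval]
  · rintro h f ⟨-, hf⟩
    have := h f (fun v hv => by
      obtain ⟨x, hx, hv⟩ := mem_coneOf.1 hv
      exact hf x hx v hv)
    rwa [dd, MvPolynomial.aeval_eq_eval] at this

theorem not_wd [IsAlgClosed K] [CharZero K] {X : Set (PP K ι)} {n j : ℕ}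
    (hH : Hyp (coneOf X) n j) : ¬WeaklyDefective X j := by
  haveI := IsAlgClosed.instInfinite (K := K)
  haveI := hH.prime
  haveI hp := pw_prime (α := Fin j) hH.prime
  rintro ⟨T, ⟨S, hS, rfl⟩, ⟨u0, hu0X, hu0T⟩, hall⟩
  simp only [multiZeroLocus, Set.mem_setOf_eq, not_forall] at hu0T
  obtain ⟨f, hfS, v, hv, hvf⟩ := hu0T
  obtain ⟨D, hD, hD'⟩ := spec_tangent hH
  have hf : f ∉ vI (pw (Fin j) (coneOf X)) := fun h =>
    hvf (h _ fun a => mem_coneOf.2 ⟨u0 a, hu0X a, hv a⟩)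
  have hfD : f * D ∉ vI (pw (Fin j) (coneOf X)) := fun h => (hp.mem_or_mem h).elim hf hD
  have : ∃ w ∈ pw (Fin j) (coneOf X), MvPolynomial.eval w (f * D) ≠ 0 := by
    by_contra! hcon
    exact hfD hcon
  obtain ⟨w, hw, hwfD⟩ := this
  rw [map_mul] at hwfD
  have hwD := hD' w hw (right_ne_zero_of_mul hwfD)
  let u : Fin j → PP K ι := fun a => Projectivization.mk K (fun i => w (a, i)) (hwD a).1
  have hwu : ∀ a, (fun i => w (a, i)) ∈ (u a).submodule := by
    intro a
    rw [Projectivization.submodule_mk]; exact Submodule.mem_span_singleton_self _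
  have huX : ∀ a, u a ∈ X := fun a => (mem_coneOf_iff (hwD a).1).1 (hw a)
  have huT : u ∉ multiZeroLocus S := fun h =>
    left_ne_zero_of_mul hwfD (h f hfS (fun a i => w (a, i)) hwu)
  have hpos := hall u huX huT
  have hsub : contactLocus X (Set.range u) ⊆ Set.range u := by
    rw [contactLocus, zcl_eq]
    refine zcl_subset (isZClosed_finite (Set.finite_range u)) ?_
    refine Set.iUnion₂_subset ?_
    rintro C ⟨⟨hCirr, hCt, -⟩, x, hxC, a, rfl⟩
    have : C = {u a} := by
      refine irr_point hCirr hxC (hwu a) (hwD a).1 fun z hz => (hwD a).2 z ⟨(hwD a).1, coneOf C, ?_, ?_, hz⟩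
      · exact coneOf_mono fun y hy => (hCt hy).1.1
      · intro y hy hy0 t ht
        obtain ⟨c, hc, hyc⟩ := mem_coneOf.1 hy
        by_cases ht0 : t = 0
        · rw [ht0]; exact Submodule.zero_mem _
        rw [tsp_rep hyc hy0] at ht
        have h1 := (hCt hc).2
        rw [embT_eq] at h1
        have htm : t ∈ (Projectivization.mk K t ht0).submodule := by
          rw [Projectivization.submodule_mk]; exact Submodule.mem_span_singleton_self _
        have h2 : Projectivization.mk K t ht0 ∈ plin (tsp (coneOf X) c.rep) := by
          rw [plin, Set.mem_setOf_eq, Projectivization.submodule_mk, Submodule.span_singleton_le_iff_mem]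
          exact ht
        have h3 := (mem_projSpan_iff htm ht0).1 (h1 h2)
        refine (Submodule.span_le.2 ?_) h3
        intro s hs
        obtain ⟨q, hq, hsq⟩ := mem_coneOf.1 hs
        simp only [Set.mem_iUnion] at hq
        obtain ⟨_, ⟨b, rfl⟩, hq⟩ := hq
        rw [embT_eq, ← tsp_rep (hwu b) (hwD b).1] at hq
        exact tsp_le_Msp (x := fun b i => w (b, i)) (Set.mem_univ b) (hq hsq)
    rw [this]
    exact Set.singleton_subset_iff.2 ⟨a, rfl⟩
  refine absurd hpos (not_lt.2 ?_)
  rw [zdim, Order.krullDim_nonpos_iff_forall_isMax]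
  rintro ⟨Y, hY, hYi, hYs⟩ ⟨Z, hZ, hZi, hZs⟩ hle
  have hcl : zclosure (contactLocus X (Set.range u)) ⊆ Set.range u := by
    rw [zcl_eq]; exact zcl_subset (isZClosed_finite (Set.finite_range u)) hsub
  obtain ⟨z, -, hz⟩ := irr_subset_finite hZi (Set.finite_range u) (hZs.trans hcl)
  obtain ⟨y, hy⟩ := hYi.1
  have hyz : y = z := hz (hle hy)
  intro t ht
  rw [hz ht, ← hyz]; exact hy

section Uniq
variable {E : Type*} [Field E] [Algebra K E]

theorem indep_comp {j : ℕ} {W : Fin j → Submodule E (ι → E)} (hW : iSupIndep W) {u v : Fin j → ι → E}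
    (hu : ∀ a, u a ∈ W a) (hv : ∀ a, v a ∈ W a) (h : ∑ a, u a ∈ Submodule.span E (Set.range v)) (a : Fin j) :
    ∃ s : E, u a = s • v a := by
  obtain ⟨s, hs⟩ := (Submodule.mem_span_range_iff_exists_fun E).1 h
  refine ⟨s a, ?_⟩
  rw [iSupIndep_iff_finsetSum_eq_zero_imp_eq_zero] at hW
  have := hW Finset.univ (fun a => u a - s a • v a) (fun a _ => Submodule.sub_mem _ (hu a) (Submodule.smul_mem _ _ (hv a)))
    (by rw [Finset.sum_sub_distrib, hs, sub_self]) a (Finset.mem_univ a)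
  exact sub_eq_zero.1 this

theorem dv_sum {τ : Type*} (s : Finset τ) (δ : Derivation K E E) (x : τ → ι → E) :
    dv δ (∑ a ∈ s, x a) = ∑ a ∈ s, dv δ (x a) := by
  funext i
  simp only [dv, Finset.sum_apply, map_sum]

theorem dv_smul' (δ : Derivation K E E) (c : E) (x : ι → E) : dv δ (c • x) = c • dv δ x + δ c • x := by
  funext i
  simp [dv, mul_comm]

theorem exch [CharZero E] [Infinite K] {V : Set (ι → K)} (hVc : ∀ v ∈ V, ∀ c : K, c • v ∈ V) (hVn : V.Nonempty) {j : ℕ}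
    {x y : Fin j → ι → E} (hx : GenT V x) (hy : GenT V y) (hq : ∑ a, x a = ∑ a, y a)
    (hQ : ∀ b, Qc V y Set.univ b) :
    ∃ l : Fin j → Fin j → E, ∀ a, x a = ∑ b, l a b • y b := by
  classical
  have hM : Msp V x Set.univ = Msp V y Set.univ := by
    have h1 := tsp_sum hVn hx
    have h2 := tsp_sum hVn hy
    rw [hq, h2] at h1
    simp only [Msp, Set.mem_univ, iSup_pos]
    exact h1.symm
  have hδ : ∀ a, ∃ δ : Derivation K E E, ∀ c, dv δ (x c) = if c = a then x a else 0 := by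
    intro a
    refine hx.exists_dv fun c => ?_
    split_ifs with h
    · rw [h]
      exact self_mem_tsp hVc fun f hf => ((hx.gen hVn a) f).2 hf
    · exact Submodule.zero_mem _
  choose δ hδ using hδ
  have hst : ∀ a, ∀ w ∈ Msp V x Set.univ, dv (δ a) w ∈ Msp V x Set.univ := by
    intro a w hw
    refine Msp_univ_stable (δ a) (fun c _ w hw => tsp_le_Msp (Set.mem_univ c) ?_) le_rfl hw
    by_cases h : c = a
    · exact dv_tsp_of_self hVc _ (by rw [hδ, if_pos h, h]) hw
    · exact dv_tsp_of_zero _ (by rw [hδ, if_neg h]) hw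
  have hl : ∀ a b, ∃ s : E, s • y b = dv (δ a) (y b) := by
    intro a b
    refine Submodule.mem_span_singleton.1 (hQ b (mem_ctc_of_dv _ ((hy.gen hVn b).dv_mem _) fun w hw => ?_))
    rw [← hM]
    exact hst a w (hM ▸ tsp_le_Msp (Set.mem_univ b) hw)
  choose l hl using hl
  refine ⟨l, fun a => ?_⟩
  simp only [hl]
  rw [← dv_sum, ← hq, dv_sum]
  simp [hδ]

theorem uniq_gen [CharZero E] [Infinite K] {V : Set (ι → K)} (hVc : ∀ v ∈ V, ∀ c : K, c • v ∈ V) (hVn : V.Nonempty)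
    (hnz : ∃ v ∈ V, v ≠ 0) {j : ℕ}
    {x y : Fin j → ι → E} (hx : GenT V x) (hy : GenT V y) (hq : ∑ a, x a = ∑ a, y a)
    (hQx : ∀ b, Qc V x Set.univ b) (hQ : ∀ b, Qc V y Set.univ b)
    (hix : iSupIndep fun a => tsp V (x a)) (hiy : iSupIndep fun a => tsp V (y a))
    (hd : ∀ b, 2 ≤ Module.finrank E (tsp V (y b))) (b : Fin j) : ∃ a, ∃ s : E, x a = s • y b := by
  classical
  obtain ⟨l, hl⟩ := exch hVc hVn hx hy hq hQ
  obtain ⟨m, hm⟩ := exch hVc hVn hy hx hq.symm hQx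
  have hxs : ∀ a, x a ∈ tsp V (x a) := fun a => self_mem_tsp hVc fun f hf => ((hx.gen hVn a) f).2 hf
  have hys : ∀ a, y a ∈ tsp V (y a) := fun a => self_mem_tsp hVc fun f hf => ((hy.gen hVn a) f).2 hf
  have hxY : ∀ a, x a ∈ Submodule.span E (Set.range y) := fun a => by
    rw [hl a]; exact Submodule.sum_mem _ fun b _ => Submodule.smul_mem _ _ (Submodule.subset_span ⟨b, rfl⟩)
  have hyX : ∀ a, y a ∈ Submodule.span E (Set.range x) := fun a => by
    rw [hm a]; exact Submodule.sum_mem _ fun b _ => Submodule.smul_mem _ _ (Submodule.subset_span ⟨b, rfl⟩)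
  have hYX : Submodule.span E (Set.range y) ≤ Submodule.span E (Set.range x) :=
    Submodule.span_le.2 (by rintro _ ⟨a, rfl⟩; exact hyX a)
  have hy0 : ∀ b, y b ≠ 0 := fun b => (hy.gen hVn b).ne_zero hnz
  have hx0 : ∀ b, x b ≠ 0 := fun b => (hx.gen hVn b).ne_zero hnz
  -- each column has at most one nonzero entry
  have hone : ∀ b a a', l a b ≠ 0 → l a' b ≠ 0 → a = a' := by
    intro b a a' h h'
    by_contra hne
    have hle : tsp V (y b) ≤ Submodule.span E {y b} := by
      intro t ht
      obtain ⟨δ, hδ⟩ := hy.exists_dv (v := fun c => if c = b then t else 0) (fun c => by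
        split_ifs with hc
        · rw [hc]; exact ht
        · exact Submodule.zero_mem _)
      have hdx : ∀ c, dv δ (x c) = l c b • t + ∑ e, δ (l c e) • y e := by
        intro c
        conv_lhs => rw [hl c]
        rw [dv_sum]
        simp only [dv_smul', hδ, Finset.sum_add_distrib]
        simp
      have hW : ∀ c, ∑ e, δ (l c e) • y e ∈ Submodule.span E (Set.range y) := fun c =>
        Submodule.sum_mem _ fun e _ => Submodule.smul_mem _ _ (Submodule.subset_span ⟨e, rfl⟩)
      have hcomp := indep_comp hix (u := fun c => if c = a then l a' b • dv δ (x a) else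
        if c = a' then -(l a b • dv δ (x a')) else 0) (v := x) (fun c => by
          split_ifs with h1 h2
          · rw [h1]; exact Submodule.smul_mem _ _ ((hx.gen hVn a).dv_mem δ)
          · rw [h2]; exact Submodule.neg_mem _ (Submodule.smul_mem _ _ ((hx.gen hVn a').dv_mem δ))
          · exact Submodule.zero_mem _) hxs (by
            have : ∑ c, (if c = a then l a' b • dv δ (x a) else if c = a' then -(l a b • dv δ (x a')) else 0) =
                l a' b • dv δ (x a) - l a b • dv δ (x a') := by
              rw [Finset.sum_eq_add a a' hne]
              · simp [Ne.symm hne, sub_eq_add_neg]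
              · rintro c - ⟨h1, h2⟩; simp [h1, h2]
              · simp
              · simp
            rw [this, hdx, hdx]
            have : l a' b • (l a b • t + ∑ e, δ (l a e) • y e) - l a b • (l a' b • t + ∑ e, δ (l a' e) • y e) =
              l a' b • (∑ e, δ (l a e) • y e) - l a b • (∑ e, δ (l a' e) • y e) := by
              simp only [smul_add, smul_smul]
              rw [mul_comm (l a' b) (l a b)]; abel
            rw [this]
            exact hYX (Submodule.sub_mem _ (Submodule.smul_mem _ _ (hW _)) (Submodule.smul_mem _ _ (hW _)))) a
      obtain ⟨s, hs⟩ := hcomp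
      rw [if_pos rfl] at hs
      have hdY : l a' b • dv δ (x a) ∈ Submodule.span E (Set.range y) := by
        rw [hs]; exact Submodule.smul_mem _ _ (hxY a)
      rw [Submodule.smul_mem_iff _ h', hdx] at hdY
      have htY := (Submodule.add_mem_iff_left _ (hW a)).1 hdY
      rw [Submodule.smul_mem_iff _ h] at htY
      obtain ⟨s', hs'⟩ := indep_comp hiy (u := fun c => if c = b then t else 0) (v := y) (fun c => by
        split_ifs with hc
        · rw [hc]; exact ht
        · exact Submodule.zero_mem _) hys (by simpa using htY) b
      rw [if_pos rfl] at hs'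
      exact Submodule.mem_span_singleton.2 ⟨s', hs'.symm⟩
    have h1 := Submodule.finrank_mono hle
    have h2 := hd b
    rw [finrank_span_singleton (hy0 b)] at h1
    omega
  have hli : LinearIndependent E y := hiy.linearIndependent _ hys hy0
  have hex : ∀ b, ∃ a, l a b ≠ 0 := by
    intro b
    by_contra! hcon
    have h1 : ∑ c, (∑ a, l a c) • y c = ∑ c, (1 : E) • y c := by
      simp only [one_smul, ← hq, Finset.sum_smul]
      rw [Finset.sum_comm]
      exact Finset.sum_congr rfl fun a _ => (hl a).symm
    have h2 := Fintype.linearIndependent_iff.1 hli (fun c => ∑ a, l a c - 1) (by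
      simp only [sub_smul, Finset.sum_sub_distrib]; rw [h1, sub_self]) b
    simp [hcon] at h2
  choose σ hσ using hex
  have hsurj : Function.Surjective σ := by
    intro a
    by_contra! hcon
    apply hx0 a
    rw [hl a]
    refine Finset.sum_eq_zero fun c _ => ?_
    have : l a c = 0 := by
      by_contra h
      exact hcon c (hone c _ _ (hσ c) h)
    rw [this, zero_smul]
  have hinj := Finite.injective_iff_surjective.2 hsurj
  refine ⟨σ b, l (σ b) b, ?_⟩
  conv_lhs => rw [hl (σ b)]
  refine Finset.sum_eq_single b (fun c _ hc => ?_) (by simp)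
  have : l (σ b) c = 0 := by
    by_contra h
    exact hc (hinj (hone c _ _ (hσ c) h))
  rw [this, zero_smul]

end Uniq

theorem vI_zeros [IsAlgClosed K] {κ : Type*} [Finite κ] (P : Ideal (MvPolynomial κ K)) [P.IsPrime] :
    vI {z : κ → K | ∀ f ∈ P, MvPolynomial.eval z f = 0} = P := by
  have h := MvPolynomial.IsPrime.vanishingIdeal_zeroLocus (K := K) P
  refine Eq.trans ?_ h
  ext f
  rw [mem_vI, MvPolynomial.mem_vanishingIdeal_iff]
  simp only [MvPolynomial.mem_zeroLocus_iff, Set.mem_setOf_eq, MvPolynomial.aeval_eq_eval]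

theorem exists_spec_prime [IsAlgClosed K] {κ : Type*} [Finite κ] (Z : Set (κ → K)) (h : MvPolynomial κ K)
    (hh : ∀ z ∈ Z, MvPolynomial.eval z h ≠ 0) (Q : ι → MvPolynomial κ K) (p : Ideal (MvPolynomial ι K)) [hpp : p.IsPrime]
    (hp : ∀ g, (∀ z ∈ Z, MvPolynomial.eval z (MvPolynomial.aeval Q g) = 0) → g ∈ p) :
    ∃ W : Set (κ → K), (vI W).IsPrime ∧ vI Z ≤ vI W ∧ h ∉ vI W ∧
      ∀ g, MvPolynomial.aeval Q g ∈ vI W → g ∈ p := by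
  let S : Submonoid (MvPolynomial κ K) := Submonoid.powers h ⊔ p.primeCompl.map (MvPolynomial.aeval (R := K) Q)
  have hS : Disjoint (vI Z : Set (MvPolynomial κ K)) S := by
    rw [Set.disjoint_left]
    intro f hf hfS
    obtain ⟨_, ⟨n, rfl⟩, _, ⟨g, hg, rfl⟩, rfl⟩ := Submonoid.mem_sup.1 hfS
    refine hg (hp g fun z hz => ?_)
    have := hf z hz
    simp only [map_mul, map_pow] at this
    exact (mul_eq_zero.1 this).resolve_left (pow_ne_zero _ (hh z hz))
  obtain ⟨P, hP, hle, hdis⟩ := Ideal.exists_le_prime_disjoint _ _ hS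
  have hW := vI_zeros P
  refine ⟨{z | ∀ f ∈ P, MvPolynomial.eval z f = 0}, by rw [hW]; exact hP, by rw [hW]; exact hle, ?_, ?_⟩
  · rw [hW]
    intro hhP
    exact Set.disjoint_left.1 hdis hhP (Submonoid.mem_sup_left (Submonoid.mem_powers h))
  · rw [hW]
    intro g hg
    by_contra hgp
    exact Set.disjoint_left.1 hdis hg (Submonoid.mem_sup_right ⟨g, hgp, rfl⟩)

section GenSum
variable {E : Type*} [Field E] [Algebra K E]

theorem Hyp.gen [CharZero K] [CharZero E] {V : Set (ι → K)} {n j : ℕ} (hH : Hyp V n j) {x : Fin j → ι → E} (hx : GenT V x) :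
    (∀ a, Module.finrank E (tsp V (x a)) = n + 1) ∧ (iSupIndep fun a => tsp V (x a)) ∧
      (∀ b, Qc V x Set.univ b) ∧ Module.finrank E (tsp (sumSet j V) (∑ a, x a)) = j * (n + 1) := by
  haveI : Infinite K := inferInstance
  haveI := hH.prime
  haveI hp := pw_prime (α := Fin j) hH.prime
  haveI := charZero_alg K (GFd V)
  haveI := charZero_alg K (GFd (pw (Fin j) V))
  have hVn : V.Nonempty := ⟨0, hH.zero⟩
  have h1 : ∀ a, Module.finrank E (tsp V (x a)) = n + 1 := fun a => by
    rw [(hx.gen hVn a).finrank_eq (gen_gpt V)]; exact hH.tdim _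
  have hg := genT_gtup j V
  have h4 : Module.finrank E (tsp (sumSet j V) (∑ a, x a)) = j * (n + 1) := by
    rw [(gen_sum hx).finrank_eq (gen_sum hg), tsp_sum hVn hg, finrank_iSup_eq _ (hH.ind hp)]
    rw [Finset.sum_congr rfl fun a _ => ((hg.gen hVn a).finrank_eq (gen_gpt V)).trans (hH.tdim _)]
    simp
  refine ⟨h1, ?_, ?_, h4⟩
  · refine (indep_of_finrank (N := n + 1) (fun a => tsp V (x a)) (fun a => (h1 a).le) ?_).1
    rw [← tsp_sum hVn hx, h4]; simp
  · obtain ⟨φ, rfl⟩ := hx.hom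
    exact fun b => (hH.qc hp b).hom φ

theorem finrank_tsp_pw_le {V : Set (ι → K)} {j N : ℕ} {x : Fin j → ι → E}
    (h : ∀ a, Module.finrank E (tsp V (x a)) ≤ N) :
    Module.finrank E (tsp (pw (Fin j) V) (fun p => x p.1 p.2)) ≤ j * N := by
  have hrow : ∀ w ∈ tsp (pw (Fin j) V) (fun p => x p.1 p.2), ∀ a, (fun i => w (a, i)) ∈ tsp V (x a) := by
    intro w hw a f hf
    have := hw (MvPolynomial.rename (Prod.mk a) f) (fun u hu => by rw [eval_row]; exact hf _ (hu a))
    rw [← this, dd, dd, Fintype.sum_prod_type, Finset.sum_eq_single a]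
    · refine Finset.sum_congr rfl fun i _ => ?_
      rw [MvPolynomial.pderiv_rename (Prod.mk_right_injective a), MvPolynomial.aeval_rename]
      rfl
    · intro b _ hb
      refine Finset.sum_eq_zero fun i _ => ?_
      classical
      rw [MvPolynomial.pderiv_eq_zero_of_notMem_vars, map_zero, mul_zero]
      intro hm
      obtain ⟨i', _, h'⟩ := Finset.mem_image.1 (MvPolynomial.vars_rename _ _ hm)
      exact hb (congrArg Prod.fst h').symm
    · exact fun h => absurd (Finset.mem_univ a) h
  let Φ : tsp (pw (Fin j) V) (fun p => x p.1 p.2) →ₗ[E] (∀ a, tsp V (x a)) :=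
    { toFun := fun w a => ⟨fun i => w.1 (a, i), hrow w.1 w.2 a⟩
      map_add' := fun _ _ => rfl
      map_smul' := fun _ _ => rfl }
  have hΦ : Function.Injective Φ := by
    intro w w' hww
    apply Subtype.ext
    funext ⟨a, i⟩
    exact congrFun (congrArg Subtype.val (congrFun hww a)) i
  refine (LinearMap.finrank_le_finrank_of_injective hΦ).trans ?_
  rw [Module.finrank_pi_fintype]
  refine (Finset.sum_le_sum fun a _ => h a).trans ?_
  simp

theorem genT_of_sum [CharZero K] [CharZero E] {V : Set (ι → K)} {n j : ℕ} (hH : Hyp V n j) {x : Fin j → ι → E}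
    (hx : ∀ f ∈ vI (pw (Fin j) V), MvPolynomial.aeval (fun p : Fin j × ι => x p.1 p.2) f = 0)
    (hq : Gen (sumSet j V) (∑ a, x a)) : GenT V x := by
  haveI := hH.prime
  haveI hp := pw_prime (α := Fin j) hH.prime
  haveI := charZero_alg K (GFd (pw (Fin j) V))
  have hVn : V.Nonempty := ⟨0, hH.zero⟩
  have hg := genT_gtup j V
  intro f
  refine ⟨fun hf => ?_, hx f⟩
  by_contra hfn
  let P : Ideal (MvPolynomial (Fin j × ι) K) :=
    RingHom.ker (MvPolynomial.aeval (R := K) (fun p : Fin j × ι => x p.1 p.2))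
  have hlt : vI (pw (Fin j) V) < P := by
    refine SetLike.lt_iff_le_and_exists.2 ⟨fun g hg => ?_, f, ?_, hfn⟩
    · exact hx g hg
    · exact hf
  obtain ⟨g, hgi⟩ := hq.ind
  let φ : MvPolynomial ι K →ₐ[K] MvPolynomial (Fin j × ι) K :=
    MvPolynomial.aeval fun i => ∑ a, MvPolynomial.X (a, i)
  have hφ : ∀ G, MvPolynomial.aeval (fun p : Fin j × ι => x p.1 p.2) (φ G) = MvPolynomial.aeval (∑ a, x a) G := by
    intro G
    rw [← AlgHom.comp_apply]
    congr 1
    ext i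
    simp [φ]
  have hP : Ind (K := K) P (Module.finrank E (tsp (sumSet j V) (∑ a, x a))) := by
    refine ⟨fun t => φ (g t), fun G hG => hgi G ?_⟩
    have h0 : φ (MvPolynomial.aeval g G) = MvPolynomial.aeval (fun t => φ (g t)) G := by
      rw [← AlgHom.comp_apply, MvPolynomial.comp_aeval]
    rw [← hq, ← hφ, h0]
    exact hG
  have h1 := (Ind.drop (K := K) hlt hP).le_finrank hg
  have h2 := finrank_tsp_pw_le (fun a => ((Hyp.gen hH hg).1 a).le)
  have h3 : Module.finrank E (tsp (sumSet j V) (∑ a, x a)) = j * (n + 1) := by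
    rw [hq.finrank_eq (gen_sum hg)]
    exact (Hyp.gen hH hg).2.2.2
  omega

end GenSum

theorem eval_sumPoly {j : ℕ} (u : Fin j × ι → K) (g : MvPolynomial ι K) :
    MvPolynomial.eval u (MvPolynomial.aeval (fun i => ∑ a : Fin j, MvPolynomial.X (R := K) (a, i)) g) =
      MvPolynomial.eval (∑ a, fun i => u (a, i)) g := by
  have : (MvPolynomial.aeval (R := K) u).comp
      (MvPolynomial.aeval (fun i => ∑ a : Fin j, MvPolynomial.X (R := K) (a, i))) =
      MvPolynomial.aeval (∑ a, fun i => u (a, i)) := by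
    ext i; simp
  exact DFunLike.congr_fun this g

theorem exists_dense [IsAlgClosed K] {V : Set (ι → K)} {j : ℕ} (hp : (vI (pw (Fin j) V)).IsPrime)
    (hV : ∀ v, (∀ f ∈ vI V, MvPolynomial.eval v f = 0) → v ∈ V) :
    ∃ g, g ∉ vI (sumSet j V) ∧ ∀ v, (∀ f ∈ vI (sumSet j V), MvPolynomial.eval v f = 0) →
      MvPolynomial.eval v g ≠ 0 → v ∈ sumSet j V := by
  let φ0 : MvPolynomial ι K →ₐ[K] MvPolynomial (Fin j × ι) K :=
    MvPolynomial.aeval fun i => ∑ a, MvPolynomial.X (a, i)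
  let φ := (Ideal.Quotient.mkₐ K (vI (pw (Fin j) V))).comp φ0
  have hker : ∀ g, φ g = 0 ↔ g ∈ vI (sumSet j V) := by
    intro g
    rw [AlgHom.comp_apply, Ideal.Quotient.mkₐ_eq_mk, Ideal.Quotient.eq_zero_iff_mem, mem_vI, mem_vI]
    constructor
    · rintro h _ ⟨u, hu, rfl⟩
      have := h (fun p => u p.1 p.2) hu
      rwa [eval_sumPoly] at this
    · intro h z hz
      rw [eval_sumPoly]
      exact h _ ⟨_, hz, rfl⟩
  have hft : φ.toRingHom.FiniteType := by
    refine RingHom.FiniteType.of_comp_finiteType (f := algebraMap K _) ?_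
    have : φ.toRingHom.comp (algebraMap K _) = algebraMap K (MvPolynomial (Fin j × ι) K ⧸ vI (pw (Fin j) V)) :=
      φ.comp_algebraMap
    rw [this, RingHom.finiteType_algebraMap]
    infer_instance
  have hcon := PrimeSpectrum.isConstructible_range_comap (RingHom.FinitePresentation.of_finiteType.1 hft)
  obtain ⟨S, hS⟩ := PrimeSpectrum.exists_constructibleSetData_iff.2 hcon
  have h0 : PrimeSpectrum.comap φ.toRingHom ⟨⊥, Ideal.isPrime_bot⟩ ∈ S.toSet := by
    rw [hS]; exact ⟨_, rfl⟩
  obtain ⟨C, hCS, hC⟩ := Set.mem_iUnion₂.1 h0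
  refine ⟨C.f, fun h => hC.2 ?_, fun v hv hf => ?_⟩
  · rintro _ rfl
    exact (hker _).2 h
  · let m : PrimeSpectrum (MvPolynomial ι K) :=
      ⟨RingHom.ker (MvPolynomial.eval v), RingHom.ker_isPrime _⟩
    have hm : m ∈ S.toSet := by
      refine Set.mem_iUnion₂.2 ⟨C, hCS, ?_, fun h => hf (h rfl)⟩
      rintro _ ⟨t, rfl⟩
      exact hv _ ((hker _).1 (hC.1 ⟨t, rfl⟩))
    rw [hS] at hm
    obtain ⟨P, hP⟩ := hm
    let P' : Ideal (MvPolynomial (Fin j × ι) K) := P.asIdeal.comap (Ideal.Quotient.mk _)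
    haveI := P.isPrime
    haveI hP' : P'.IsPrime := Ideal.comap_isPrime _ _
    have hz : ∃ z : Fin j × ι → K, ∀ f ∈ P', MvPolynomial.eval z f = 0 := by
      by_contra! hne
      refine hP'.ne_top ?_
      rw [← vI_zeros P', Ideal.eq_top_iff_one, mem_vI]
      intro z hz
      obtain ⟨f, hf1, hf2⟩ := hne z
      exact absurd (hz f hf1) hf2
    obtain ⟨z, hz⟩ := hz
    refine ⟨fun a i => z (a, i), fun a => hV _ fun f hf => ?_, ?_⟩
    · rw [← eval_row]
      refine hz _ ?_
      have : Ideal.Quotient.mk (vI (pw (Fin j) V)) (MvPolynomial.rename (Prod.mk a) f) = 0 := by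
        rw [Ideal.Quotient.eq_zero_iff_mem]
        intro u hu
        rw [eval_row]; exact hf _ (hu a)
      rw [Ideal.mem_comap, this]
      exact zero_mem _
    · funext i
      have h1 : (MvPolynomial.X i - MvPolynomial.C (v i) : MvPolynomial ι K) ∈ m.asIdeal := by
        change MvPolynomial.eval v _ = 0
        simp
      rw [← hP] at h1
      have h2 := hz _ (show φ0 (MvPolynomial.X i - MvPolynomial.C (v i)) ∈ P' from h1)
      rw [eval_sumPoly] at h2
      simp only [map_sub, MvPolynomial.eval_X, MvPolynomial.eval_C] at h2
      exact (sub_eq_zero.1 h2).symm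

theorem sumSet_prime {V : Set (ι → K)} {j : ℕ} (hp : (vI (pw (Fin j) V)).IsPrime) : (vI (sumSet j V)).IsPrime := by
  have : vI (sumSet j V) = RingHom.ker (MvPolynomial.aeval (R := K) (∑ a, gtup j V a)) := by
    ext g
    exact (gen_sum (genT_gtup j V) g).symm
  rw [this]
  exact RingHom.ker_isPrime _

theorem exists_rank [CharZero K] {V : Set (ι → K)} {n j : ℕ} (hH : Hyp V n (j + 1)) :
    ∃ g, g ∈ vI (sumSet j V) ∧ g ∉ vI (sumSet (j + 1) V) := by
  by_contra! h
  haveI := hH.prime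
  haveI hp := pw_prime (α := Fin j) hH.prime
  haveI hp' := pw_prime (α := Fin (j + 1)) hH.prime
  haveI := charZero_alg K (GFd V)
  haveI := charZero_alg K (GFd (pw (Fin j) V))
  haveI := charZero_alg K (GFd (pw (Fin (j + 1)) V))
  have hVn : V.Nonempty := ⟨0, hH.zero⟩
  have hg := genT_gtup j V
  have hg' := genT_gtup (j + 1) V
  have h1 := (Ind.mono (K := K) (show vI (sumSet j V) ≤ vI (sumSet (j + 1) V) from h)
    (gen_sum hg').ind).le_finrank (gen_sum hg)
  rw [(hH.gen hg').2.2.2, tsp_sum hVn hg] at h1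
  have h2 := finrank_iSup_le' fun a => tsp V (gtup j V a)
  rw [Finset.sum_congr rfl fun a _ => ((hg.gen hVn a).finrank_eq (gen_gpt V)).trans (hH.tdim _)] at h2
  simp at h2
  have := h1.trans h2
  nlinarith


theorem exists_uniq_one [IsAlgClosed K] [CharZero K] {V : Set (ι → K)} {n j : ℕ} (hH : Hyp V n j)
    (b : Fin j) (m : Fin j → ι × ι) :
    ∃ g, g ∉ vI (sumSet j V) ∧ ∀ x y : Fin j → ι → K, (∀ a, x a ∈ V) → (∀ a, y a ∈ V) →
      ∑ a, x a = ∑ a, y a → MvPolynomial.eval (∑ a, x a) g ≠ 0 →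
      ∏ a, (x a (m a).1 * y b (m a).2 - x a (m a).2 * y b (m a).1) = 0 := by
  by_contra! hcon
  haveI := hH.prime
  haveI hp := pw_prime (α := Fin j) hH.prime
  haveI hps := sumSet_prime hp
  let κ := (Fin j × ι) ⊕ (Fin j × ι)
  let Z : Set (κ → K) := {z | (∀ a, (fun i => z (Sum.inl (a, i))) ∈ V) ∧ (∀ a, (fun i => z (Sum.inr (a, i))) ∈ V) ∧
    (∀ i, ∑ a, z (Sum.inl (a, i)) = ∑ a, z (Sum.inr (a, i))) ∧
    ∏ a, (z (Sum.inl (a, (m a).1)) * z (Sum.inr (b, (m a).2)) - z (Sum.inl (a, (m a).2)) * z (Sum.inr (b, (m a).1))) ≠ 0}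
  let h : MvPolynomial κ K := ∏ a, (MvPolynomial.X (Sum.inl (a, (m a).1)) * MvPolynomial.X (Sum.inr (b, (m a).2))
    - MvPolynomial.X (Sum.inl (a, (m a).2)) * MvPolynomial.X (Sum.inr (b, (m a).1)))
  let Q : ι → MvPolynomial κ K := fun i => ∑ a, MvPolynomial.X (Sum.inl (a, i))
  have hQ : ∀ (z : κ → K) g, MvPolynomial.eval z (MvPolynomial.aeval Q g) =
      MvPolynomial.eval (∑ a, fun i => z (Sum.inl (a, i))) g := by
    intro z g
    have : (MvPolynomial.aeval (R := K) z).comp (MvPolynomial.aeval Q) =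
        MvPolynomial.aeval (∑ a, fun i => z (Sum.inl (a, i))) := by
      ext i; simp [Q]
    exact DFunLike.congr_fun this g
  obtain ⟨W, hW, hZW, hhW, hgW⟩ := exists_spec_prime Z h (fun z hz => by
      simpa [h, MvPolynomial.eval_prod] using hz.2.2.2) Q (vI (sumSet j V)) (fun g hg => by
      by_contra hgn
      obtain ⟨x, y, hx, hy, hxy, hne, hpr⟩ := hcon g hgn
      refine hne ?_
      have := hg (Sum.elim (fun p => x p.1 p.2) (fun p => y p.1 p.2))
        ⟨hx, hy, fun i => by simpa using congrFun hxy i, hpr⟩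
      rw [hQ] at this
      exact this)
  let e := gpt W
  have he : Gen W e := gen_gpt W
  haveI := charZero_alg K (GFd W)
  let x : Fin j → ι → GFd W := fun a i => e (Sum.inl (a, i))
  let y : Fin j → ι → GFd W := fun a i => e (Sum.inr (a, i))
  have hx : ∀ f ∈ vI (pw (Fin j) V), MvPolynomial.aeval (fun p : Fin j × ι => x p.1 p.2) f = 0 := by
    intro f hf
    have h1 : MvPolynomial.rename Sum.inl f ∈ vI W := hZW fun z hz => by
      rw [MvPolynomial.eval_rename]; exact hf _ hz.1
    have h2 := (he _).2 h1
    rw [MvPolynomial.aeval_rename] at h2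
    exact h2
  have hy : ∀ f ∈ vI (pw (Fin j) V), MvPolynomial.aeval (fun p : Fin j × ι => y p.1 p.2) f = 0 := by
    intro f hf
    have h1 : MvPolynomial.rename Sum.inr f ∈ vI W := hZW fun z hz => by
      rw [MvPolynomial.eval_rename]; exact hf _ hz.2.1
    have h2 := (he _).2 h1
    rw [MvPolynomial.aeval_rename] at h2
    exact h2
  have hxy : ∑ a, x a = ∑ a, y a := by
    funext i
    have h1 : (∑ a, MvPolynomial.X (Sum.inl (a, i)) - ∑ a, MvPolynomial.X (Sum.inr (a, i)) : MvPolynomial κ K) ∈ vI W :=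
      hZW fun z hz => by simpa [sub_eq_zero] using hz.2.2.1 i
    have h2 := (he _).2 h1
    simp only [map_sub, map_sum, MvPolynomial.aeval_X] at h2
    simpa [x, y, Finset.sum_apply] using sub_eq_zero.1 h2
  have hgen : Gen (sumSet j V) (∑ a, x a) := by
    intro g
    have h1 : MvPolynomial.aeval (∑ a, x a) g = MvPolynomial.aeval e (MvPolynomial.aeval Q g) := by
      have : (MvPolynomial.aeval (R := K) e).comp (MvPolynomial.aeval Q) = MvPolynomial.aeval (∑ a, x a) := by
        ext i; simp [Q, x]
      exact (DFunLike.congr_fun this g).symm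
    rw [h1, he]
    refine ⟨hgW g, fun hg => hZW fun z hz => ?_⟩
    rw [hQ]
    exact hg _ ⟨_, hz.1, rfl⟩
  have hgx := genT_of_sum hH hx hgen
  have hgy := genT_of_sum hH hy (hxy ▸ hgen)
  obtain ⟨-, hx2, hx3, -⟩ := hH.gen hgx
  obtain ⟨hy1, hy2, hy3, -⟩ := hH.gen hgy
  obtain ⟨a, s, hs⟩ := uniq_gen hH.cone ⟨0, hH.zero⟩ hH.nz hgx hgy hxy hx3 hy3 hx2 hy2
    (fun b => by rw [hy1 b]; have := hH.one; omega) b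
  refine hhW ((he h).1 ?_)
  rw [map_prod]
  refine Finset.prod_eq_zero (Finset.mem_univ a) ?_
  simp only [map_sub, map_mul, MvPolynomial.aeval_X]
  have h1 : ∀ i, e (Sum.inl (a, i)) = s * e (Sum.inr (b, i)) := fun i => congrFun hs i
  rw [h1, h1]
  ring

theorem exists_uniq [IsAlgClosed K] [CharZero K] {V : Set (ι → K)} {n j : ℕ} (hH : Hyp V n j) :
    ∃ g, g ∉ vI (sumSet j V) ∧ ∀ x y : Fin j → ι → K, (∀ a, x a ∈ V) → (∀ a, y a ∈ V) →
      ∑ a, x a = ∑ a, y a → MvPolynomial.eval (∑ a, x a) g ≠ 0 →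
      ∀ b, ∃ a, ∀ i i', x a i * y b i' = x a i' * y b i := by
  classical
  haveI hps := sumSet_prime (pw_prime (α := Fin j) hH.prime)
  choose g hg1 hg2 using exists_uniq_one hH
  refine ⟨∏ b, ∏ m, g b m, ?_, fun x y hx hy hxy hne b => ?_⟩
  · simp only [hps.prod_mem_iff]
    push Not
    exact fun b _ m _ => hg1 b m
  · by_contra! hc
    choose i i' hii using hc
    rw [MvPolynomial.eval_prod, Finset.prod_ne_zero_iff] at hne
    have := hne b (Finset.mem_univ _)
    rw [MvPolynomial.eval_prod, Finset.prod_ne_zero_iff] at this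
    have := hg2 b (fun a => (i a, i' a)) x y hx hy hxy (this _ (Finset.mem_univ _))
    obtain ⟨a, -, ha⟩ := Finset.prod_eq_zero_iff.1 this
    exact hii a (sub_eq_zero.1 ha)

theorem identifiable_of [IsAlgClosed K] [CharZero K] {X : Set (PP K ι)} (hX : IsZClosed X) (hXinf : X.Infinite)
    {n j : ℕ} (hj : 1 ≤ j) (hH : Hyp (coneOf X) n j) : Identifiable X j := by
  classical
  obtain ⟨j, rfl⟩ : ∃ i, j = i + 1 := ⟨j - 1, by omega⟩
  have hp := pw_prime (α := Fin (j + 1)) hH.prime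
  haveI hps := sumSet_prime hp
  obtain ⟨g1, h1, hd⟩ := exists_dense hp (V := coneOf X) (fun v hv => by
    by_cases h0 : v = 0
    · rw [h0]; exact hH.zero
    · exact (mem_coneOf_iff h0).2 (mem_of_closed hX h0 hv))
  obtain ⟨g2, h2, h2'⟩ := exists_rank hH
  obtain ⟨g3, h3, hu⟩ := exists_uniq hH
  obtain ⟨i0, h4⟩ : ∃ i, (MvPolynomial.X i : MvPolynomial ι K) ∉ vI (sumSet (j + 1) (coneOf X)) := by
    by_contra! hc
    obtain ⟨v, hv, hv0⟩ := hH.nz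
    refine hv0 (funext fun i => ?_)
    have := hc i v ⟨fun a => if a = 0 then v else 0, fun a => by
      dsimp only; split_ifs; exacts [hv, hH.zero], by simp⟩
    simpa using this
  have hsec := vI_secant hXinf hj
  refine ⟨zeroLocus {g1 * g2 * g3 * MvPolynomial.X i0}, isZClosed_zeroLocus _, ?_, ?_⟩
  · rw [zeroLocus_iff, hsec]
    intro h
    rcases hps.mem_or_mem h with h | h
    · rcases hps.mem_or_mem h with h | h
      · rcases hps.mem_or_mem h with h | h
        exacts [h1 h, h2' h]
      · exact h3 h
    · exact h4 h
  rintro q ⟨hq, hqY⟩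
  obtain ⟨v, hvq, hne⟩ : ∃ v ∈ q.submodule, MvPolynomial.eval v (g1 * g2 * g3 * MvPolynomial.X i0) ≠ 0 := by
    by_contra! hc
    exact hqY fun f hf v hv => by rw [Set.mem_singleton_iff.1 hf]; exact hc v hv
  simp only [map_mul, mul_ne_zero_iff, MvPolynomial.eval_X] at hne
  obtain ⟨⟨⟨e1, e2⟩, e3⟩, e4⟩ := hne
  have hv0 : v ≠ 0 := fun h => e4 (by rw [h]; rfl)
  have hvs : v ∈ sumSet (j + 1) (coneOf X) := hd v (fun f hf => by
    rw [← hsec] at hf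
    exact hf v (mem_coneOf.2 ⟨q, hq, hvq⟩)) e1
  have hnot : v ∉ sumSet j (coneOf X) := fun h => e2 (h2 v h)
  have hcard : ∀ S : Finset (PP K ι), ↑S ⊆ X → v ∈ vspan (S : Set (PP K ι)) → j + 1 ≤ S.card := by
    intro S hS hvS
    by_contra! hlt
    obtain ⟨S', hSS, hS'X, hc⟩ := exists_card_eq hXinf hS (Nat.lt_succ_iff.1 hlt)
    obtain ⟨u, hu1, hu2, -⟩ := sum_of_projSpan hS'X (vspan_mono (Finset.coe_subset.2 hSS) hvS)
    subst hc
    exact hnot ⟨u, hu1, hu2⟩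
  obtain ⟨S, hSX, hSc, hvS⟩ : ∃ S : Finset (PP K ι), ↑S ⊆ X ∧ S.card = j + 1 ∧ v ∈ vspan (S : Set (PP K ι)) := by
    obtain ⟨u, hu1, hu2⟩ := hvs
    obtain ⟨S, hS1, hS2, hS3⟩ := exists_finset_of_sum hu1
    rw [← hu2] at hS3
    exact ⟨S, hS1, le_antisymm hS2 (hcard S hS1 hS3), hS3⟩
  have hrank : xrank X q = j + 1 := by
    refine le_antisymm (Nat.sInf_le ⟨S, hSX, hSc, (mem_projSpan_iff hvq hv0).2 hvS⟩) ?_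
    refine le_csInf ⟨_, S, hSX, hSc, (mem_projSpan_iff hvq hv0).2 hvS⟩ ?_
    rintro _ ⟨T, hT, rfl, hqT⟩
    exact hcard T hT ((mem_projSpan_iff hvq hv0).1 hqT)
  have key : ∀ T : Finset (PP K ι), ↑T ⊆ X → T.card = j + 1 → v ∈ vspan (T : Set (PP K ι)) →
      ∃ u : Fin (j + 1) → ι → K, ∃ t : Fin (j + 1) → PP K ι, (∀ a, u a ∈ coneOf X) ∧ v = ∑ a, u a ∧
        (∀ a, u a ∈ (t a).submodule) ∧ (∀ a, u a ≠ 0) ∧ (∀ a, t a ∈ T) ∧ ∀ p ∈ T, ∃ a, t a = p := by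
    intro T hT hTc hvT
    obtain ⟨u, hu1, hu2, hu3⟩ := sum_of_projSpan hT hvT
    subst_vars
    let c : Fin (j + 1) ≃ Fin T.card := finCongr hTc.symm
    refine ⟨fun a => u (c a), fun a => (T.equivFin.symm (c a)).1, fun a => hu1 _, (Equiv.sum_comp c u).symm,
      fun a => hu3 _, fun a h0 => hnot ?_, fun a => (T.equivFin.symm (c a)).2, fun p hp =>
        ⟨c.symm (T.equivFin ⟨p, hp⟩), by simp⟩⟩
    refine ⟨fun b => u (c (a.succAbove b)), fun b => hu1 _, ?_⟩
    rw [← Equiv.sum_comp c u, Fin.sum_univ_succAbove _ a, show u (c a) = 0 from h0, zero_add]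
  refine ⟨S, ⟨hSX, hSc.trans hrank.symm, (mem_projSpan_iff hvq hv0).2 hvS⟩, ?_⟩
  rintro T ⟨hTX, hTc, hqT⟩
  rw [hrank] at hTc
  obtain ⟨x, s, hx1, hx2, hx3, hx4, hx5, -⟩ := key S hSX hSc hvS
  obtain ⟨y, t, hy1, hy2, hy3, hy4, -, hy6⟩ := key T hTX hTc ((mem_projSpan_iff hvq hv0).1 hqT)
  refine Finset.eq_of_subset_of_card_le ?_ (by rw [hSc, hTc])
  intro p hp
  obtain ⟨b, rfl⟩ := hy6 p hp
  obtain ⟨a, ha⟩ := hu x y hx1 hy1 (hx2.symm.trans hy2) (by rw [← hx2]; exact e3) b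
  suffices h : s a = t b by rw [← h]; exact hx5 a
  rw [← eq_mk_of_mem (hx3 a) (hx4 a), ← eq_mk_of_mem (hy3 b) (hy4 b), Projectivization.mk_eq_mk_iff']
  obtain ⟨i, hi⟩ := Function.ne_iff.1 (hy4 b)
  refine ⟨x a i / y b i, funext fun i' => ?_⟩
  have := ha i i'
  simp only [Pi.smul_apply, smul_eq_mul, Pi.zero_apply] at hi ⊢
  field_simp
  linear_combination this


/-- **Theorem (ip1).** Let `X ⊆ ℙ^r` be an integral and non-degenerate variety of
dimension `n` over an algebraically closed field of characteristic `0`, and let `k`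
be a positive integer.  If `X` is not uniruled by lines and
`dim σ_{k+n-1}(X) = (k+n-1)(n+1) - 1 < r`, then `X` is not weakly `j`-defective
(hence it is `j`-identifiable) for every `j ≤ k`. -/
theorem statement0 {K : Type*} [Field K] [IsAlgClosed K] [CharZero K]
    {ι : Type*} [Fintype ι] (r n k : ℕ) (hι : Fintype.card ι = r + 1)
    (X : Set (PP K ι)) (hX : IsIntegralVariety X) (hXnd : Nondegenerate X)
    (hXdim : zdim X = ((n : ℕ∞) : WithBot ℕ∞)) (hk : 1 ≤ k)
    (hnl : ¬UniruledByLines X)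
    (hsec : zdim (secant (k + n - 1) X) =
      ((((k + n - 1) * (n + 1) - 1 : ℕ) : ℕ∞) : WithBot ℕ∞))
    (hlt : (k + n - 1) * (n + 1) - 1 < r) :
    ∀ j : ℕ, 1 ≤ j → j ≤ k → ¬WeaklyDefective X j ∧ Identifiable X j := by
  obtain ⟨hinf, hall⟩ := hyp_of hι hX hXnd hXdim hk hnl hsec hlt
  intro j hj hjk
  exact ⟨not_wd (hall j hj hjk), identifiable_of hX.1 hinf hj (hall j hj hjk)⟩

end ContactLoci
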